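/- Splitting for prime graphs: let G be a graph, let P be a prime graph with n vertices that is not isomorphic to the two-vertex edgeless graph ⅋, and let M1, …, Mn be non-empty graphs. If G ⅋ P⟨M1, …, Mn⟩ is provable in GS, then one of the following holds: (A) there exist a context C[·]_R and graphs K1, …, Kn such that there is a GS derivation from C[P̄⟨K1, …, Kn⟩]_R to G, Ki ⅋ Mi is provable in GS for every i ∈ {1, …, n}, and C is provable in GS; or (B) there exist a context C[·]_R, graphs K_X and K_Y, and an index i ∈ {1, …, n} such that there is a GS derivation from C[K_X ⅋ K_Y]_R to G, K_X ⅋ Mi is provable in GS, K_Y ⅋ P⟨M1, …, M_{i-1}, ∅, M_{i+1}, …, Mn⟩ is provable in GS, and C is provable in GS. -/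

import Mathlib

namespace GSP

/-- Atoms: a propositional variable (coded by a natural number) with a polarity. -/
abbrev Atom := ℕ × Bool

/-- The dual atom. -/
def dualAtom (a : Atom) : Atom := (a.1, !a.2)

/-- A finite, simple, undirected graph whose vertices are labelled by atoms. -/
structure LGraph where
  V : Type
  [fintype : Fintype V]
  adj : V → V → Prop
  symm : ∀ {v w : V}, adj v w → adj w v
  irrefl : ∀ v : V, ¬ adj v v
  label : V → Atom

attribute [instance] LGraph.fintype

namespace LGraph

/-- An isomorphism of labelled graphs: a vertex bijection preserving labels and
preserving and reflecting edges. -/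
structure Iso (G H : LGraph) where
  toEquiv : G.V ≃ H.V
  adj_iff : ∀ v w : G.V, G.adj v w ↔ H.adj (toEquiv v) (toEquiv w)
  label_eq : ∀ v : G.V, H.label (toEquiv v) = G.label v

/-- `G ≅ H` : the graphs `G` and `H` are isomorphic. -/
def iso (G H : LGraph) : Prop := Nonempty (Iso G H)

/-- The empty graph. -/
def empty : LGraph where
  V := Empty
  adj _ _ := False
  symm h := h.elim
  irrefl v := v.elim
  label v := v.elim

/-- The single-vertex graph labelled by the atom `a`. -/
def single (a : Atom) : LGraph where
  V := Unit
  adj _ _ := False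
  symm h := h.elim
  irrefl _ h := h
  label _ := a

def parAdj (G H : LGraph) : G.V ⊕ H.V → G.V ⊕ H.V → Prop
  | .inl a, .inl b => G.adj a b
  | .inr a, .inr b => H.adj a b
  | _, _ => False

/-- The par `G ⅋ H` : disjoint union of `G` and `H`. -/
def par (G H : LGraph) : LGraph where
  V := G.V ⊕ H.V
  adj := parAdj G H
  symm := by
    rintro (a | a) (b | b) h
    · exact G.symm h
    · exact h.elim
    · exact h.elim
    · exact H.symm h
  irrefl := by
    rintro (a | a) h
    · exact G.irrefl a h
    · exact H.irrefl a h
  label := Sum.elim G.label H.label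

def tensorAdj (G H : LGraph) : G.V ⊕ H.V → G.V ⊕ H.V → Prop
  | .inl a, .inl b => G.adj a b
  | .inr a, .inr b => H.adj a b
  | .inl _, .inr _ => True
  | .inr _, .inl _ => True

/-- The tensor `G ⊗ H` : join of `G` and `H` (disjoint union plus all edges in between). -/
def tensor (G H : LGraph) : LGraph where
  V := G.V ⊕ H.V
  adj := tensorAdj G H
  symm := by
    rintro (a | a) (b | b) h
    · exact G.symm h
    · exact trivial
    · exact trivial
    · exact H.symm h
  irrefl := by
    rintro (a | a) h
    · exact G.irrefl a h
    · exact H.irrefl a h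
  label := Sum.elim G.label H.label

/-- The dual graph `Ḡ` : same vertices, complemented edges, dualized labels. -/
def dual (G : LGraph) : LGraph where
  V := G.V
  adj v w := v ≠ w ∧ ¬ G.adj v w
  symm h := ⟨fun e => h.1 e.symm, fun h' => h.2 (G.symm h')⟩
  irrefl _ h := h.1 rfl
  label v := dualAtom (G.label v)

def plugAdj (C : LGraph) (R : Set C.V) (X : LGraph) : C.V ⊕ X.V → C.V ⊕ X.V → Prop
  | .inl a, .inl b => C.adj a b
  | .inr a, .inr b => X.adj a b
  | .inl a, .inr _ => a ∈ R
  | .inr _, .inl b => b ∈ R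

/-- `C[X]_R` : the graph obtained from the context `C[·]_R` by inserting the graph `X`
as a module whose vertices are adjacent exactly to the vertices in `R`. -/
def plug (C : LGraph) (R : Set C.V) (X : LGraph) : LGraph where
  V := C.V ⊕ X.V
  adj := plugAdj C R X
  symm := by
    rintro (a | a) (b | b) h
    · exact C.symm h
    · exact h
    · exact h
    · exact X.symm h
  irrefl := by
    rintro (a | a) h
    · exact C.irrefl a h
    · exact X.irrefl a h
  label := Sum.elim C.label X.label

def compAdj (G : LGraph) (H : G.V → LGraph) :
    (Σ v : G.V, (H v).V) → (Σ v : G.V, (H v).V) → Prop := fun x y =>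
  (∃ (v : G.V) (a b : (H v).V), x = ⟨v, a⟩ ∧ y = ⟨v, b⟩ ∧ (H v).adj a b) ∨
    (x.1 ≠ y.1 ∧ G.adj x.1 y.1)

/-- The composition `G⟨H v₁, …, H vₙ⟩` of the family `H` via the graph `G`:
replace each vertex `v` of `G` by the graph `H v`. -/
def comp (G : LGraph) (H : G.V → LGraph) : LGraph where
  V := Σ v : G.V, (H v).V
  adj := compAdj G H
  symm := by
    rintro x y (⟨v, a, b, hx, hy, hab⟩ | ⟨hne, hadj⟩)
    · exact Or.inl ⟨v, b, a, hy, hx, (H v).symm hab⟩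
    · exact Or.inr ⟨hne.symm, G.symm hadj⟩
  irrefl := by
    rintro ⟨v, a⟩ (⟨w, x, y, hx, hy, hxy⟩ | ⟨hne, _⟩)
    · have h := hx.symm.trans hy
      obtain rfl : x = y := by simpa using h
      exact (H w).irrefl x hxy
    · exact hne rfl
  label x := (H x.1).label x.2

/-- A module of `G` : a set `M` of vertices such that every vertex outside `M`
is adjacent either to all vertices of `M` or to none of them. -/
def IsModule (G : LGraph) (M : Set G.V) : Prop :=
  ∀ v ∉ M, ∀ x ∈ M, ∀ y ∈ M, (G.adj v x ↔ G.adj v y)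

/-- A prime graph: at least 2 vertices and only trivial modules. -/
def Prime (G : LGraph) : Prop :=
  2 ≤ Fintype.card G.V ∧
    ∀ M : Set G.V, G.IsModule M → M = ∅ ∨ (∃ v, M = {v}) ∨ M = Set.univ

/-- `G` is `P₄`-free: no four distinct vertices induce a path on 4 vertices. -/
def P4Free (G : LGraph) : Prop :=
  ¬ ∃ v₁ v₂ v₃ v₄ : G.V,
      v₁ ≠ v₂ ∧ v₁ ≠ v₃ ∧ v₁ ≠ v₄ ∧ v₂ ≠ v₃ ∧ v₂ ≠ v₄ ∧ v₃ ≠ v₄ ∧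
      G.adj v₁ v₂ ∧ G.adj v₂ v₃ ∧ G.adj v₃ v₄ ∧
      ¬ G.adj v₁ v₃ ∧ ¬ G.adj v₁ v₄ ∧ ¬ G.adj v₂ v₄

end LGraph

open LGraph

/-- The `n`-fold tensor `X₁ ⊗ ⋯ ⊗ Xₙ`. -/
def bigTensor : (n : ℕ) → (Fin n → LGraph) → LGraph
  | 0, _ => LGraph.empty
  | n + 1, F => (F 0).tensor (bigTensor n fun i => F i.succ)

/-- The `n`-fold par `X₁ ⅋ ⋯ ⅋ Xₙ`. -/
def bigPar : (n : ℕ) → (Fin n → LGraph) → LGraph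
  | 0, _ => LGraph.empty
  | n + 1, F => (F 0).par (bigPar n fun i => F i.succ)

/-- The inference rules of system GS (premise, conclusion). -/
inductive GSRule : LGraph → LGraph → Prop
  /-- ai↓ : premise `∅`, conclusion `ā ⅋ a`. -/
  | ai (a : Atom) : GSRule LGraph.empty ((single (dualAtom a)).par (single a))
  /-- ss↓ : premise `B[A]_S`, conclusion `B ⅋ A`, for `A ≠ ∅` and `S ≠ ∅`. -/
  | ss (A B : LGraph) (S : Set B.V) :
      Nonempty A.V → S ≠ ∅ → GSRule (B.plug S A) (B.par A)
  /-- p↓ : premise `(M₁ ⅋ N₁) ⊗ ⋯ ⊗ (Mₙ ⅋ Nₙ)`, conclusion `P̄⟨M₁,…,Mₙ⟩ ⅋ P⟨N₁,…,Nₙ⟩`,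
  for `P` prime with `n = |V(P)| ≥ 4` and all `Mᵢ ≠ ∅`. -/
  | p (n : ℕ) (P : LGraph) (e : P.V ≃ Fin n) (M N : Fin n → LGraph) :
      P.Prime → 4 ≤ n → (∀ i, Nonempty (M i).V) →
      GSRule (bigTensor n fun i => (M i).par (N i))
        ((P.dual.comp fun v => M (e v)).par (P.comp fun v => N (e v)))

/-- The "up" rules ai↑, ss↑, p↑ (premise, conclusion). -/
inductive UpRule : LGraph → LGraph → Prop
  /-- ai↑ : premise `a ⊗ ā`, conclusion `∅`. -/
  | ai (a : Atom) : UpRule ((single a).tensor (single (dualAtom a))) LGraph.empty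
  /-- ss↑ : premise `B ⊗ A`, conclusion `B[A]_S`, for `A ≠ ∅` and `S ≠ V(B)`. -/
  | ss (A B : LGraph) (S : Set B.V) :
      Nonempty A.V → S ≠ Set.univ → UpRule (B.tensor A) (B.plug S A)
  /-- p↑ : premise `P⟨M₁,…,Mₙ⟩ ⊗ P̄⟨N₁,…,Nₙ⟩`, conclusion `(M₁ ⊗ N₁) ⅋ ⋯ ⅋ (Mₙ ⊗ Nₙ)`,
  for `P` prime with `n = |V(P)| ≥ 4` and all `Mᵢ ≠ ∅`. -/
  | p (n : ℕ) (P : LGraph) (e : P.V ≃ Fin n) (M N : Fin n → LGraph) :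
      P.Prime → 4 ≤ n → (∀ i, Nonempty (M i).V) →
      UpRule ((P.comp fun v => M (e v)).tensor (P.dual.comp fun v => N (e v)))
        (bigPar n fun i => (M i).tensor (N i))

/-- The rules of system SGS : the rules of GS together with their duals. -/
def SGSRule (G H : LGraph) : Prop := GSRule G H ∨ UpRule G H

/-- A single inference step in a system: inside some context, replace a module
isomorphic to the premise of a rule by the corresponding conclusion. -/
def Step (Rules : LGraph → LGraph → Prop) (G H : LGraph) : Prop :=
  ∃ (C : LGraph) (R : Set C.V) (p c : LGraph),
    Rules p c ∧ G.iso (C.plug R p) ∧ H.iso (C.plug R c)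

/-- A derivation in a system from `G` to `H` : a finite sequence of inference steps
and isomorphisms leading from `G` to `H`. -/
def Deriv (Rules : LGraph → LGraph → Prop) (G H : LGraph) : Prop :=
  Relation.ReflTransGen (fun X Y => X.iso Y ∨ Step Rules X Y) G H

/-- A graph is provable in a system if there is a derivation from `∅` to it. -/
def Provable (Rules : LGraph → LGraph → Prop) (G : LGraph) : Prop :=
  Deriv Rules LGraph.empty G

/-- Formulas: unit, positive and negative atoms, par and tensor. -/
inductive Formula where
  | unit : Formula
  | pos (a : ℕ) : Formula
  | neg (a : ℕ) : Formula
  | par (φ ψ : Formula) : Formula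
  | tens (φ ψ : Formula) : Formula

/-- The graph `[φ]` of a formula `φ`. -/
def Formula.graph : Formula → LGraph
  | .unit => LGraph.empty
  | .pos a => single (a, true)
  | .neg a => single (a, false)
  | .par φ ψ => φ.graph.par ψ.graph
  | .tens φ ψ => φ.graph.tensor ψ.graph

/-- Structural equivalence of formulas: the smallest congruence making `⅋` and `⊗`
associative and commutative with unit `∘`. -/
inductive Formula.equiv : Formula → Formula → Prop
  | refl (φ) : Formula.equiv φ φ
  | symm {φ ψ} : Formula.equiv φ ψ → Formula.equiv ψ φ
  | trans {φ ψ χ} : Formula.equiv φ ψ → Formula.equiv ψ χ → Formula.equiv φ χ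
  | parComm (φ ψ) : Formula.equiv (.par φ ψ) (.par ψ φ)
  | parAssoc (φ ψ χ) : Formula.equiv (.par φ (.par ψ χ)) (.par (.par φ ψ) χ)
  | parUnit (φ) : Formula.equiv (.par φ .unit) φ
  | tensComm (φ ψ) : Formula.equiv (.tens φ ψ) (.tens ψ φ)
  | tensAssoc (φ ψ χ) : Formula.equiv (.tens φ (.tens ψ χ)) (.tens (.tens φ ψ) χ)
  | tensUnit (φ) : Formula.equiv (.tens φ .unit) φ
  | parCongr {φ φ' ψ ψ'} : Formula.equiv φ φ' → Formula.equiv ψ ψ' →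
      Formula.equiv (.par φ ψ) (.par φ' ψ')
  | tensCongr {φ φ' ψ ψ'} : Formula.equiv φ φ' → Formula.equiv ψ ψ' →
      Formula.equiv (.tens φ ψ) (.tens φ' ψ')

/-- A formula is unit-free if it contains no occurrence of the unit `∘`. -/
def Formula.UnitFree : Formula → Prop
  | .unit => False
  | .pos _ => True
  | .neg _ => True
  | .par φ ψ => φ.UnitFree ∧ ψ.UnitFree
  | .tens φ ψ => φ.UnitFree ∧ ψ.UnitFree

/-- The sequent calculus MLL° (multiplicative linear logic with mix) on multisets
of formulas. -/
inductive MLL : Multiset Formula → Prop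
  | ax (a : ℕ) : MLL {Formula.pos a, Formula.neg a}
  | tens {Γ Δ : Multiset Formula} (φ ψ : Formula) :
      MLL (φ ::ₘ Γ) → MLL (ψ ::ₘ Δ) → MLL (Formula.tens φ ψ ::ₘ (Γ + Δ))
  | par {Γ : Multiset Formula} (φ ψ : Formula) :
      MLL (φ ::ₘ ψ ::ₘ Γ) → MLL (Formula.par φ ψ ::ₘ Γ)
  | mix {Γ Δ : Multiset Formula} : MLL Γ → MLL Δ → MLL (Γ + Δ)

open LGraph

/-! ### Isomorphisms and embeddings -/

theorem iso_refl (G : LGraph) : G.iso G := ⟨⟨Equiv.refl _, fun _ _ => Iff.rfl, fun _ => rfl⟩⟩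

theorem iso_symm {G H : LGraph} (h : G.iso H) : H.iso G := by
  obtain ⟨e, ha, hl⟩ := h
  exact ⟨⟨e.symm, fun v w => by simp [ha], fun v => by simp [← hl]⟩⟩

theorem iso_trans {G H K : LGraph} (h : G.iso H) (h' : H.iso K) : G.iso K := by
  obtain ⟨e, ha, hl⟩ := h
  obtain ⟨e', ha', hl'⟩ := h'
  exact ⟨⟨e.trans e', fun v w => by simp [ha, ha'], fun v => by simp [hl, hl']⟩⟩

/-- The quotient of graphs by isomorphism. -/
def isoSetoid : Setoid LGraph := ⟨LGraph.iso, iso_refl, iso_symm, iso_trans⟩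

def GQ := Quotient isoSetoid

def mk (G : LGraph) : GQ := Quotient.mk isoSetoid G

theorem mk_eq {G H : LGraph} : mk G = mk H ↔ G.iso H := by
  unfold mk
  exact Quotient.eq (r := isoSetoid)

/-- An embedding as an induced subgraph. -/
structure Emb (A G : LGraph) where
  f : A.V → G.V
  inj : Function.Injective f
  adj : ∀ x y, A.adj x y ↔ G.adj (f x) (f y)
  lab : ∀ x, G.label (f x) = A.label x

theorem iso_of_emb {A G : LGraph} (a : Emb A G) (h : Function.Surjective a.f) : A.iso G :=
  ⟨⟨Equiv.ofBijective a.f ⟨a.inj, h⟩, a.adj, a.lab⟩⟩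

/-- The induced subgraph. -/
noncomputable def ind (G : LGraph) (S : Set G.V) : LGraph where
  V := S
  fintype := Fintype.ofFinite _
  adj x y := G.adj x.1 y.1
  symm h := G.symm h
  irrefl v := G.irrefl v.1
  label v := G.label v.1

def Emb.ind (G : LGraph) (S : Set G.V) : Emb (ind G S) G where
  f := Subtype.val
  inj := Subtype.val_injective
  adj _ _ := Iff.rfl
  lab _ := rfl

def Emb.refl (G : LGraph) : Emb G G := ⟨id, Function.injective_id, fun _ _ => Iff.rfl, fun _ => rfl⟩

def Emb.trans {A B C : LGraph} (a : Emb A B) (b : Emb B C) : Emb A C where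
  f := fun x => b.f (a.f x)
  inj := b.inj.comp a.inj
  adj x y := (a.adj x y).trans (b.adj _ _)
  lab x := (b.lab _).trans (a.lab _)

def Emb.ofIso {A B : LGraph} (h : LGraph.Iso A B) : Emb A B :=
  ⟨h.toEquiv, h.toEquiv.injective, h.adj_iff, h.label_eq⟩

def Emb.empty (G : LGraph) : Emb LGraph.empty G where
  f := fun x => x.elim
  inj := fun x => x.elim
  adj x := x.elim
  lab x := x.elim

def Emb.parL (G H : LGraph) : Emb G (G.par H) :=
  ⟨Sum.inl, Sum.inl_injective, fun _ _ => Iff.rfl, fun _ => rfl⟩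
def Emb.parR (G H : LGraph) : Emb H (G.par H) :=
  ⟨Sum.inr, Sum.inr_injective, fun _ _ => Iff.rfl, fun _ => rfl⟩
def Emb.plugL (C : LGraph) (R : Set C.V) (X : LGraph) : Emb C (C.plug R X) :=
  ⟨Sum.inl, Sum.inl_injective, fun _ _ => Iff.rfl, fun _ => rfl⟩
def Emb.plugR (C : LGraph) (R : Set C.V) (X : LGraph) : Emb X (C.plug R X) :=
  ⟨Sum.inr, Sum.inr_injective, fun _ _ => Iff.rfl, fun _ => rfl⟩
def Emb.tenL (G H : LGraph) : Emb G (G.tensor H) :=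
  ⟨Sum.inl, Sum.inl_injective, fun _ _ => Iff.rfl, fun _ => rfl⟩
def Emb.tenR (G H : LGraph) : Emb H (G.tensor H) :=
  ⟨Sum.inr, Sum.inr_injective, fun _ _ => Iff.rfl, fun _ => rfl⟩

def Emb.plug {C X G : LGraph} {R : Set C.V} (c : Emb C G) (x : Emb X G)
    (hd : ∀ i j, c.f i ≠ x.f j) (ha : ∀ i j, G.adj (c.f i) (x.f j) ↔ i ∈ R) :
    Emb (C.plug R X) G where
  f := Sum.elim c.f x.f
  inj := by
    rintro (i | i) (j | j) h
    · exact congrArg _ (c.inj h)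
    · exact (hd _ _ h).elim
    · exact (hd _ _ h.symm).elim
    · exact congrArg _ (x.inj h)
  adj := by
    rintro (i | i) (j | j)
    · exact c.adj i j
    · exact (ha i j).symm
    · exact ((ha j i).symm.trans ⟨fun h => G.symm h, fun h => G.symm h⟩)
    · exact x.adj i j
  lab := by
    rintro (i | i)
    · exact c.lab i
    · exact x.lab i

def Emb.par {C X G : LGraph} (c : Emb C G) (x : Emb X G)
    (hd : ∀ i j, c.f i ≠ x.f j) (ha : ∀ i j, ¬ G.adj (c.f i) (x.f j)) :
    Emb (C.par X) G where
  f := Sum.elim c.f x.f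
  inj := (Emb.plug (R := {i | False}) c x hd (fun i j => by simp [ha])).inj
  adj := by
    rintro (i | i) (j | j)
    · exact c.adj i j
    · exact ⟨False.elim, ha i j⟩
    · exact ⟨False.elim, fun h => ha j i (G.symm h)⟩
    · exact x.adj i j
  lab := by
    rintro (i | i)
    · exact c.lab i
    · exact x.lab i

/-- Two embeddings with the same range have isomorphic sources. -/
theorem emb_iso {A B G : LGraph} (a : Emb A G) (b : Emb B G)
    (h1 : ∀ x, ∃ y, b.f y = a.f x) (h2 : ∀ y, ∃ x, a.f x = b.f y) : A.iso B := by
  choose g hg using h1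
  refine iso_of_emb ⟨g, ?_, ?_, ?_⟩ ?_
  · intro x y h
    apply a.inj
    rw [← hg, ← hg, h]
  · intro x y
    rw [a.adj, b.adj, hg, hg]
  · intro x
    rw [← b.lab, hg, a.lab]
  · intro y
    obtain ⟨x, hx⟩ := h2 y
    exact ⟨x, b.inj (by rw [hg, hx])⟩

/-- An embedding into an induced subgraph -/
def Emb.toInd {A G : LGraph} (a : Emb A G) (S : Set G.V) (h : ∀ x, a.f x ∈ S) : Emb A (GSP.ind G S) where
  f := fun x => ⟨a.f x, h x⟩
  inj := fun x y e => a.inj (congrArg Subtype.val e)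
  adj := a.adj
  lab := a.lab

theorem iso_ind_of_emb {A G : LGraph} (a : Emb A G) (S : Set G.V)
    (h : ∀ y, y ∈ S ↔ ∃ x, a.f x = y) : A.iso (ind G S) :=
  emb_iso a (Emb.ind G S) (fun x => ⟨⟨a.f x, (h _).2 ⟨x, rfl⟩⟩, rfl⟩) (fun y => (h _).1 y.2)

theorem iso_plug_of_emb {C X G : LGraph} {R : Set C.V} (c : Emb C G) (x : Emb X G)
    (hd : ∀ i j, c.f i ≠ x.f j) (ha : ∀ i j, G.adj (c.f i) (x.f j) ↔ i ∈ R)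
    (hs : ∀ y, (∃ i, c.f i = y) ∨ (∃ j, x.f j = y)) : G.iso (C.plug R X) := by
  refine iso_symm (iso_of_emb (Emb.plug c x hd ha) ?_)
  intro y
  rcases hs y with ⟨i, h⟩ | ⟨j, h⟩
  · exact ⟨Sum.inl i, h⟩
  · exact ⟨Sum.inr j, h⟩

theorem iso_par_of_emb {C X G : LGraph} (c : Emb C G) (x : Emb X G)
    (hd : ∀ i j, c.f i ≠ x.f j) (ha : ∀ i j, ¬ G.adj (c.f i) (x.f j))
    (hs : ∀ y, (∃ i, c.f i = y) ∨ (∃ j, x.f j = y)) : G.iso (C.par X) := by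
  refine iso_symm (iso_of_emb (Emb.par c x hd ha) ?_)
  intro y
  rcases hs y with ⟨i, h⟩ | ⟨j, h⟩
  · exact ⟨Sum.inl i, h⟩
  · exact ⟨Sum.inr j, h⟩

/-- splitting an induced subgraph as a plug -/
theorem ind_plug {G : LGraph} (S A B : Set G.V) (R : Set (ind G A).V)
    (hS : ∀ x, x ∈ S ↔ x ∈ A ∨ x ∈ B) (hd : ∀ x, x ∈ A → x ∈ B → False)
    (ha : ∀ (x : (ind G A).V), ∀ y ∈ B, (G.adj x.1 y ↔ x ∈ R)) :
    (ind G S).iso ((ind G A).plug R (ind G B)) := by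
  refine iso_plug_of_emb ((Emb.ind G A).toInd S fun x => (hS _).2 (Or.inl x.2))
    ((Emb.ind G B).toInd S fun x => (hS _).2 (Or.inr x.2)) ?_ ?_ ?_
  · intro i j h
    have h' : i.1 = j.1 := congrArg Subtype.val h
    exact hd i.1 i.2 (h' ▸ j.2)
  · intro i j
    exact ha i j.1 j.2
  · rintro ⟨y, hy⟩
    rcases (hS y).1 hy with h | h
    · exact Or.inl ⟨⟨y, h⟩, rfl⟩
    · exact Or.inr ⟨⟨y, h⟩, rfl⟩

theorem ind_par {G : LGraph} (S A B : Set G.V)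
    (hS : ∀ x, x ∈ S ↔ x ∈ A ∨ x ∈ B) (hd : ∀ x, x ∈ A → x ∈ B → False)
    (ha : ∀ x ∈ A, ∀ y ∈ B, ¬ G.adj x y) :
    (ind G S).iso ((ind G A).par (ind G B)) := by
  refine iso_par_of_emb ((Emb.ind G A).toInd S fun x => (hS _).2 (Or.inl x.2))
    ((Emb.ind G B).toInd S fun x => (hS _).2 (Or.inr x.2)) ?_ ?_ ?_
  · intro i j h
    have h' : i.1 = j.1 := congrArg Subtype.val h
    exact hd i.1 i.2 (h' ▸ j.2)
  · intro i j
    exact ha i.1 i.2 j.1 j.2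
  · rintro ⟨y, hy⟩
    rcases (hS y).1 hy with h | h
    · exact Or.inl ⟨⟨y, h⟩, rfl⟩
    · exact Or.inr ⟨⟨y, h⟩, rfl⟩

theorem ind_all {G : LGraph} (S : Set G.V) (h : ∀ x, x ∈ S) : (ind G S).iso G :=
  iso_of_emb (Emb.ind G S) fun y => ⟨⟨y, h y⟩, rfl⟩

theorem ind_ind {G : LGraph} (S : Set G.V) (T : Set (ind G S).V) (U : Set G.V)
    (h : ∀ x, x ∈ U ↔ ∃ hx : x ∈ S, (⟨x, hx⟩ : (ind G S).V) ∈ T) :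
    (ind (ind G S) T).iso (ind G U) := by
  refine iso_ind_of_emb ((Emb.ind _ T).trans (Emb.ind G S)) U ?_
  intro y
  rw [h]
  constructor
  · rintro ⟨hx, ht⟩
    exact ⟨⟨⟨y, hx⟩, ht⟩, rfl⟩
  · rintro ⟨x, rfl⟩
    exact ⟨x.1.2, x.2⟩

theorem ind_congr {G H : LGraph} (e : LGraph.Iso G H) (S : Set G.V) (T : Set H.V)
    (h : ∀ x, e.toEquiv x ∈ T ↔ x ∈ S) : (ind G S).iso (ind H T) := by
  refine iso_ind_of_emb ((Emb.ind G S).trans (Emb.ofIso e)) T ?_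
  intro y
  constructor
  · intro hy
    exact ⟨⟨e.toEquiv.symm y, (h _).1 (by simpa using hy)⟩, by simp [Emb.trans, Emb.ind, Emb.ofIso]⟩
  · rintro ⟨x, rfl⟩
    exact (h _).2 x.2

theorem ind_eq {G : LGraph} {S T : Set G.V} (h : ∀ x, x ∈ S ↔ x ∈ T) : (ind G S).iso (ind G T) := by
  have : S = T := Set.ext h
  subst this
  exact iso_refl _

theorem iso_empty {G : LGraph} (h : IsEmpty G.V) : G.iso LGraph.empty :=
  iso_symm (iso_of_emb (Emb.empty G) fun y => (h.false y).elim)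

/-! ### The monoid of isomorphism classes under par -/

theorem plug_congr_right {C X Y : LGraph} (R : Set C.V) (h : X.iso Y) :
    (C.plug R X).iso (C.plug R Y) := by
  obtain ⟨e⟩ := h
  refine iso_plug_of_emb (Emb.plugL C R X)
    ((Emb.ofIso ⟨e.toEquiv.symm, ?_, ?_⟩ : Emb Y X).trans (Emb.plugR C R X)) ?_ ?_ ?_
  · intro v w; simp [e.adj_iff]
  · intro v; simp [← e.label_eq]
  · intro i j h; cases h
  · intro i j; exact Iff.rfl
  · rintro (y | y)
    · exact Or.inl ⟨y, rfl⟩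
    · exact Or.inr ⟨e.toEquiv y, by simp [Emb.trans, Emb.ofIso, Emb.plugR]; rfl⟩

theorem plug_congr_left {C D X : LGraph} (R : Set C.V) (S : Set D.V) (e : LGraph.Iso C D)
    (h : ∀ x, e.toEquiv x ∈ S ↔ x ∈ R) : (C.plug R X).iso (D.plug S X) := by
  refine iso_symm (iso_plug_of_emb ((Emb.ofIso e).trans (Emb.plugL D S X)) (Emb.plugR D S X) ?_ ?_ ?_)
  · intro i j h; cases h
  · intro i j; exact h i
  · rintro (y | y)
    · exact Or.inl ⟨e.toEquiv.symm y, by simp [Emb.trans, Emb.ofIso, Emb.plugL]; rfl⟩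
    · exact Or.inr ⟨y, rfl⟩

theorem par_iso_plug (C X : LGraph) (R : Set C.V) (hR : ∀ x, x ∉ R) : (C.par X).iso (C.plug R X) := by
  refine iso_plug_of_emb (Emb.parL C X) (Emb.parR C X) ?_ ?_ ?_
  · intro i j h; cases h
  · intro i j; exact ⟨False.elim, fun h => hR i h⟩
  · rintro (y | y)
    · exact Or.inl ⟨y, rfl⟩
    · exact Or.inr ⟨y, rfl⟩

theorem tensor_iso_plug (C X : LGraph) : (C.tensor X).iso (C.plug Set.univ X) := by
  refine iso_plug_of_emb (Emb.tenL C X) (Emb.tenR C X) ?_ ?_ ?_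
  · intro i j h; cases h
  · intro i j; exact ⟨fun _ => trivial, fun _ => trivial⟩
  · rintro (y | y)
    · exact Or.inl ⟨y, rfl⟩
    · exact Or.inr ⟨y, rfl⟩

theorem par_comm' (G H : LGraph) : (G.par H).iso (H.par G) := by
  refine iso_par_of_emb (Emb.parR G H) (Emb.parL G H) ?_ ?_ ?_
  · intro i j h; cases h
  · intro i j; exact id
  · rintro (y | y)
    · exact Or.inr ⟨y, rfl⟩
    · exact Or.inl ⟨y, rfl⟩

theorem par_assoc' (G H K : LGraph) : ((G.par H).par K).iso (G.par (H.par K)) := by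
  refine iso_par_of_emb ((Emb.parL G H).trans (Emb.parL _ K))
    (Emb.par ((Emb.parR G H).trans (Emb.parL _ K)) (Emb.parR _ K) ?_ ?_) ?_ ?_ ?_
  · intro i j h; cases h
  · intro i j; exact id
  · rintro i (j | j) h <;> cases h
  · rintro i (j | j) <;> exact id
  · rintro ((y | y) | y)
    · exact Or.inl ⟨y, rfl⟩
    · exact Or.inr ⟨Sum.inl y, rfl⟩
    · exact Or.inr ⟨Sum.inr y, rfl⟩

theorem par_congr {G G' H H' : LGraph} (h : G.iso G') (h' : H.iso H') :
    (G.par H).iso (G'.par H') := by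
  obtain ⟨e⟩ := h
  obtain ⟨e'⟩ := h'
  refine iso_symm (iso_par_of_emb ((Emb.ofIso e).trans (Emb.parL _ _))
    ((Emb.ofIso e').trans (Emb.parR _ _)) ?_ ?_ ?_)
  · intro i j h; cases h
  · intro i j; exact id
  · rintro (y | y)
    · exact Or.inl ⟨e.toEquiv.symm y, by simp [Emb.trans, Emb.ofIso, Emb.parL]; rfl⟩
    · exact Or.inr ⟨e'.toEquiv.symm y, by simp [Emb.trans, Emb.ofIso, Emb.parR]; rfl⟩

theorem empty_par (G : LGraph) : (LGraph.empty.par G).iso G := by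
  refine iso_symm (iso_of_emb (Emb.parR _ G) ?_)
  rintro (y | y)
  · exact y.elim
  · exact ⟨y, rfl⟩

instance : Add GQ := ⟨Quotient.map₂ LGraph.par fun _ _ h _ _ h' => par_congr h h'⟩
instance : Zero GQ := ⟨mk LGraph.empty⟩
instance : AddCommMonoid GQ where
  add_assoc a b c := by
    induction a using Quotient.inductionOn
    induction b using Quotient.inductionOn
    induction c using Quotient.inductionOn
    exact mk_eq.2 (par_assoc' _ _ _)
  add_comm a b := by
    induction a using Quotient.inductionOn
    induction b using Quotient.inductionOn
    exact mk_eq.2 (par_comm' _ _)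
  zero_add a := by
    induction a using Quotient.inductionOn
    exact mk_eq.2 (empty_par _)
  add_zero a := by
    induction a using Quotient.inductionOn
    exact mk_eq.2 (iso_trans (par_comm' _ _) (empty_par _))
  nsmul := nsmulRec

theorem mk_par (G H : LGraph) : mk (G.par H) = mk G + mk H := rfl
theorem mk_empty : mk LGraph.empty = 0 := rfl
theorem mk_zero {G : LGraph} (h : IsEmpty G.V) : mk G = 0 := mk_eq.2 (iso_empty h)

/-- plugging into a plug -/
def plugSet (C : LGraph) (R : Set C.V) (D : LGraph) (S : Set D.V) : Set (C.plug R D).V :=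
  fun x => Sum.elim (fun c => c ∈ R) (fun d => d ∈ S) x

theorem plug_plug (C : LGraph) (R : Set C.V) (D : LGraph) (S : Set D.V) (X : LGraph) :
    (C.plug R (D.plug S X)).iso ((C.plug R D).plug (plugSet C R D S) X) := by
  refine iso_plug_of_emb
    (Emb.plug (Emb.plugL C R _) ((Emb.plugL D S X).trans (Emb.plugR C R _)) ?_ ?_)
    ((Emb.plugR D S X).trans (Emb.plugR C R _)) ?_ ?_ ?_
  · intro i j h; cases h
  · intro i j; exact Iff.rfl
  · rintro (i | i) j h <;> cases h
  · rintro (i | i) j <;> exact Iff.rfl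
  · rintro (y | (y | y))
    · exact Or.inl ⟨Sum.inl y, rfl⟩
    · exact Or.inl ⟨Sum.inr y, rfl⟩
    · exact Or.inr ⟨y, rfl⟩

theorem plug_empty (C : LGraph) (R : Set C.V) : C.iso (C.plug R LGraph.empty) := by
  refine iso_of_emb (Emb.plugL C R _) ?_
  rintro (y | y)
  · exact ⟨y, rfl⟩
  · exact y.elim

theorem empty_plug (R : Set LGraph.empty.V) (X : LGraph) : X.iso (LGraph.empty.plug R X) := by
  refine iso_of_emb (Emb.plugR _ R X) ?_
  rintro (y | y)
  · exact y.elim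
  · exact ⟨y, rfl⟩

/-- C[A ⅋ B] = (C[A])[B] -/
theorem plug_par (C : LGraph) (R : Set C.V) (A B : LGraph) :
    (C.plug R (A.par B)).iso ((C.plug R A).plug (plugSet C R A ∅) B) :=
  iso_trans (plug_congr_right R (par_iso_plug A B ∅ (fun _ => id))) (plug_plug C R A ∅ B)

/-- (C ⅋ D)[X]_S with S in D -/
theorem par_plug (C D : LGraph) (S : Set D.V) (X : LGraph) :
    (C.par (D.plug S X)).iso ((C.par D).plug (fun x => Sum.elim (fun _ => False) (fun d => d ∈ S) x) X) := by
  refine iso_plug_of_emb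
    (Emb.par (Emb.parL C _) ((Emb.plugL D S X).trans (Emb.parR C _)) ?_ ?_)
    ((Emb.plugR D S X).trans (Emb.parR C _)) ?_ ?_ ?_
  · intro i j h; cases h
  · intro i j; exact id
  · rintro (i | i) j h <;> cases h
  · rintro (i | i) j <;> exact Iff.rfl
  · rintro (y | (y | y))
    · exact Or.inl ⟨Sum.inl y, rfl⟩
    · exact Or.inl ⟨Sum.inr y, rfl⟩
    · exact Or.inr ⟨y, rfl⟩

/-! ### Derivations -/

abbrev Dv (G H : LGraph) : Prop := Deriv GSRule G H
abbrev Pr (G : LGraph) : Prop := Provable GSRule G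

theorem dv_refl (G : LGraph) : Dv G G := Relation.ReflTransGen.refl
theorem dv_trans {G H K : LGraph} (h : Dv G H) (h' : Dv H K) : Dv G K := Relation.ReflTransGen.trans h h'
theorem dv_iso {G H : LGraph} (h : G.iso H) : Dv G H := Relation.ReflTransGen.single (Or.inl h)
theorem dv_mk {G H : LGraph} (h : mk G = mk H) : Dv G H := dv_iso (mk_eq.1 h)
theorem dv_step {G H : LGraph} (h : Step GSRule G H) : Dv G H := Relation.ReflTransGen.single (Or.inr h)
theorem dv_rule {p c : LGraph} (h : GSRule p c) : Dv p c :=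
  dv_step ⟨LGraph.empty, ∅, p, c, h, empty_plug _ _, empty_plug _ _⟩
theorem pr_dv {G H : LGraph} (h : Pr G) (h' : Dv G H) : Pr H := dv_trans h h'
theorem pr_mk {G H : LGraph} (h : Pr G) (h' : mk G = mk H) : Pr H := pr_dv h (dv_mk h')
theorem pr_empty : Pr LGraph.empty := dv_refl _
theorem pr_zero {G : LGraph} (h : IsEmpty G.V) : Pr G := pr_mk pr_empty (mk_zero h).symm

theorem dv_plug {X Y : LGraph} (C : LGraph) (R : Set C.V) (h : Dv X Y) :
    Dv (C.plug R X) (C.plug R Y) := by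
  induction h with
  | refl => exact dv_refl _
  | tail _ h ih =>
    refine dv_trans ih ?_
    rcases h with h | ⟨D, S, p, c, hr, h1, h2⟩
    · exact dv_iso (plug_congr_right R h)
    · exact dv_step ⟨C.plug R D, plugSet C R D S, p, c, hr,
        iso_trans (plug_congr_right R h1) (plug_plug _ _ _ _ _),
        iso_trans (plug_congr_right R h2) (plug_plug _ _ _ _ _)⟩

theorem dv_par_right {X Y : LGraph} (Z : LGraph) (h : Dv X Y) : Dv (Z.par X) (Z.par Y) :=
  dv_trans (dv_iso (par_iso_plug Z X ∅ fun _ => id))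
    (dv_trans (dv_plug Z ∅ h) (dv_iso (iso_symm (par_iso_plug Z Y ∅ fun _ => id))))

theorem dv_par_left {X Y : LGraph} (Z : LGraph) (h : Dv X Y) : Dv (X.par Z) (Y.par Z) :=
  dv_trans (dv_iso (par_comm' _ _)) (dv_trans (dv_par_right Z h) (dv_iso (par_comm' _ _)))

theorem dv_ins {X : LGraph} (C : LGraph) (R : Set C.V) (h : Pr X) : Dv C (C.plug R X) :=
  dv_trans (dv_iso (plug_empty C R)) (dv_plug C R h)

theorem pr_plug {C X : LGraph} (R : Set C.V) (hC : Pr C) (h : Pr X) : Pr (C.plug R X) :=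
  pr_dv hC (dv_ins C R h)

theorem pr_par {C X : LGraph} (hC : Pr C) (h : Pr X) : Pr (C.par X) :=
  pr_dv (pr_plug ∅ hC h) (dv_iso (iso_symm (par_iso_plug C X ∅ fun _ => id)))

theorem dv_ss (B : LGraph) (S : Set B.V) (A : LGraph) : Dv (B.plug S A) (B.par A) := by
  by_cases hA : Nonempty A.V
  · by_cases hS : S = ∅
    · exact dv_iso (iso_symm (par_iso_plug B A S (by simp [hS])))
    · exact dv_rule (GSRule.ss A B S hA hS)
  · have hA' : A.iso LGraph.empty := iso_empty (not_nonempty_iff.1 hA)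
    refine dv_trans (dv_iso (iso_trans (plug_congr_right S hA') (iso_symm (plug_empty B S)))) ?_
    refine dv_mk ?_
    rw [mk_par, mk_eq.2 hA', mk_empty, add_zero]

/-- extrusion -/
theorem dv_extrude (C : LGraph) (R : Set C.V) (A B : LGraph) :
    Dv (C.plug R (A.par B)) ((C.plug R A).par B) :=
  dv_trans (dv_iso (plug_par C R A B)) (dv_ss _ _ _)

/-- M2: inserting a slot -/
theorem dv_slot {K N : LGraph} (D : LGraph) (S : Set D.V) (h : Pr (K.par N)) :
    Dv D ((D.plug S N).par K) :=
  dv_trans (dv_ins D S (pr_mk h (mk_eq.2 (par_comm' _ _)))) (dv_extrude D S N K)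

/-! ### Reduction modulo provable contexts -/

def Red (K G : LGraph) : Prop := ∃ (C : LGraph) (R : Set C.V), Pr C ∧ Dv (C.plug R K) G

theorem red_dv {K G : LGraph} (h : Dv K G) : Red K G :=
  ⟨LGraph.empty, ∅, pr_empty, dv_trans (dv_iso (iso_symm (empty_plug _ _))) h⟩
theorem red_mk {K G : LGraph} (h : mk K = mk G) : Red K G := red_dv (dv_mk h)

theorem red_trans {K L G : LGraph} (h : Red K L) (h' : Red L G) : Red K G := by
  obtain ⟨C, R, hC, hd⟩ := h
  obtain ⟨D, S, hD, hd'⟩ := h'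
  refine ⟨D.plug S C, plugSet D S C R, pr_plug S hD hC, ?_⟩
  exact dv_trans (dv_iso (iso_symm (plug_plug _ _ _ _ _))) (dv_trans (dv_plug D S hd) hd')

theorem red_par_left {K L : LGraph} (Z : LGraph) (h : Red K L) : Red (K.par Z) (L.par Z) := by
  obtain ⟨C, R, hC, hd⟩ := h
  exact ⟨C, R, hC, dv_trans (dv_extrude C R K Z) (dv_par_left Z hd)⟩

theorem red_par_right {K L : LGraph} (Z : LGraph) (h : Red K L) : Red (Z.par K) (Z.par L) :=
  red_trans (red_mk (mk_eq.2 (par_comm' _ _)))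
    (red_trans (red_par_left Z h) (red_mk (mk_eq.2 (par_comm' _ _))))

/-- M1 -/
theorem red_slot {KY D : LGraph} (S : Set D.V) (KX X : LGraph) (h : Pr (KY.par D)) :
    Red (KX.par X) ((KX.par KY).par (D.plug S X)) := by
  refine ⟨KY.par D, fun x => Sum.elim (fun _ => False) (fun d => d ∈ S) x, h, ?_⟩
  refine dv_trans (dv_plug _ _ (dv_iso (par_comm' _ _))) ?_
  refine dv_trans (dv_extrude _ _ _ _) ?_
  refine dv_trans (dv_par_left _ (dv_iso (iso_symm (par_plug _ _ _ _)))) (dv_mk ?_)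
  simp only [mk_par]
  abel

/-! ### Size -/

noncomputable def sz (G : LGraph) : ℕ := Nat.card G.V

theorem sz_iso {G H : LGraph} (h : G.iso H) : sz G = sz H := by
  obtain ⟨e⟩ := h
  exact Nat.card_congr e.toEquiv
theorem sz_par (G H : LGraph) : sz (G.par H) = sz G + sz H := Nat.card_sum
theorem sz_plug (G H : LGraph) (R : Set G.V) : sz (G.plug R H) = sz G + sz H := Nat.card_sum
theorem sz_tensor (G H : LGraph) : sz (G.tensor H) = sz G + sz H := Nat.card_sum
theorem sz_comp (P : LGraph) (H : P.V → LGraph) : sz (P.comp H) = ∑ v, sz (H v) := by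
  unfold sz
  simp only [Nat.card_eq_fintype_card]
  exact Fintype.card_sigma
theorem sz_pos {G : LGraph} (h : Nonempty G.V) : 0 < sz G := Nat.card_pos
theorem sz_mk {G H : LGraph} (h : mk G = mk H) : sz G = sz H := sz_iso (mk_eq.1 h)
theorem sz_emb {A G : LGraph} (a : Emb A G) : sz A ≤ sz G := Nat.card_le_card_of_injective a.f a.inj
theorem sz_ind_split (G : LGraph) (S : Set G.V) : sz G = sz (ind G S) + sz (ind G Sᶜ) := by
  classical
  unfold sz
  rw [← Nat.card_sum]
  exact (Nat.card_congr (Equiv.Set.sumCompl S)).symm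

theorem sz_bigTensor (n : ℕ) (F : Fin n → LGraph) : sz (bigTensor n F) = ∑ i, sz (F i) := by
  induction n with
  | zero => simp [bigTensor, sz, LGraph.empty]
  | succ n ih => rw [bigTensor, sz_tensor, ih, Fin.sum_univ_succ]

theorem sz_rule {p c : LGraph} (h : GSRule p c) : sz p ≤ sz c := by
  cases h with
  | ai a => simp [sz, LGraph.empty]
  | ss A B S _ _ => rw [sz_plug, sz_par]
  | p n P e M N _ _ _ =>
    rw [sz_bigTensor, sz_par, sz_comp, sz_comp]
    simp only [sz_par]
    rw [Finset.sum_add_distrib]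
    rw [← Equiv.sum_comp e (fun i => sz (M i)), ← Equiv.sum_comp e (fun i => sz (N i))]
    rfl

theorem sz_dv {G H : LGraph} (h : Dv G H) : sz G ≤ sz H := by
  induction h with
  | refl => exact le_refl _
  | tail _ h ih =>
    refine le_trans ih ?_
    rcases h with h | ⟨D, S, p, c, hr, h1, h2⟩
    · exact (sz_iso h).le
    · rw [sz_iso h1, sz_iso h2, sz_plug, sz_plug]
      exact Nat.add_le_add_left (sz_rule hr) _

theorem sz_red {K G : LGraph} (h : Red K G) : sz K ≤ sz G := by
  obtain ⟨C, R, _, h⟩ := h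
  have := sz_dv h
  rw [sz_plug] at this
  omega

/-! ### Prime graphs -/

theorem prime_two {P : LGraph} (h : P.Prime) : ∃ a b : P.V, a ≠ b := by
  have := h.1
  exact Fintype.one_lt_card_iff.1 (by omega)

theorem edge_ne {P : LGraph} {a b : P.V} (h : P.adj a b) : a ≠ b := by
  rintro rfl
  exact P.irrefl _ h

theorem dual_module {P : LGraph} {M : Set P.V} (h : P.dual.IsModule M) : P.IsModule M := by
  intro v hv x hx y hy
  have h1 := h v hv x hx y hy
  have e1 : v ≠ x := fun e => hv (e ▸ hx)
  have e2 : v ≠ y := fun e => hv (e ▸ hy)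
  have h2 : (v ≠ x ∧ ¬ P.adj v x) ↔ (v ≠ y ∧ ¬ P.adj v y) := h1
  tauto

theorem prime_dual {P : LGraph} (h : P.Prime) : P.dual.Prime :=
  ⟨h.1, fun M hM => h.2 M (dual_module hM)⟩

theorem prime_connected {P : LGraph} (h : P.Prime) (he : ∃ a b, P.adj a b) (S : Set P.V)
    (hn : S.Nonempty) (hc : ∀ x ∈ S, ∀ y, P.adj x y → y ∈ S) : ∀ x, x ∈ S := by
  have hmod : P.IsModule S := by
    intro v hv x hx y hy
    exact ⟨fun h => (hv (hc x hx v (P.symm h))).elim, fun h => (hv (hc y hy v (P.symm h))).elim⟩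
  have hmod2 : P.IsModule Sᶜ := by
    intro v hv x hx y hy
    have hv' : v ∈ S := by simpa using hv
    exact ⟨fun h => (hx (hc v hv' x h)).elim, fun h => (hy (hc v hv' y h)).elim⟩
  rcases h.2 S hmod with h1 | ⟨v, h1⟩ | h1
  · simp [h1] at hn
  · rcases h.2 Sᶜ hmod2 with h2 | ⟨w, h2⟩ | h2
    · intro x
      by_contra hx
      have : x ∈ Sᶜ := hx
      rw [h2] at this
      exact this
    · exfalso
      obtain ⟨a, b, hab⟩ := he
      have key : ∀ x, x = v ∨ x = w := by
        intro x
        by_cases hx : x ∈ S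
        · rw [h1] at hx; exact Or.inl hx
        · have : x ∈ Sᶜ := hx
          rw [h2] at this; exact Or.inr this
      have hvS : v ∈ S := by rw [h1]; rfl
      have hne := edge_ne hab
      rcases key a with ha | ha <;> rcases key b with hb | hb
      · exact hne (ha.trans hb.symm)
      · subst ha; subst hb
        have := hc _ hvS _ hab
        rw [h1] at this
        exact hne (this : b = a).symm
      · subst ha; subst hb
        have := hc _ hvS _ (P.symm hab)
        rw [h1] at this
        exact hne (this : a = b)
      · exact hne (ha.trans hb.symm)
    · obtain ⟨x, hx⟩ := hn
      have : x ∈ Sᶜ := by rw [h2]; trivial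
      exact (this hx).elim
  · intro x; rw [h1]; trivial

theorem prime_nbr {P : LGraph} (h : P.Prime) (he : ∃ a b, P.adj a b) (v : P.V) : ∃ w, P.adj v w := by
  by_contra hw
  have := prime_connected h he {v} ⟨v, rfl⟩ (by
    rintro x hx y hy
    have hx' : x = v := hx
    subst hx'
    exact (hw ⟨y, hy⟩).elim)
  obtain ⟨a, b, hab⟩ := prime_two h
  exact hab ((this a : a = v).trans (this b : b = v).symm)

theorem prime_edgeless {P : LGraph} (h : P.Prime) (he : ¬ ∃ a b, P.adj a b) : Fintype.card P.V = 2 := by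
  classical
  obtain ⟨a, b, hab⟩ := prime_two h
  have hm : P.IsModule {a, b} := by
    intro v _ x _ y _
    exact ⟨fun h => (he ⟨_, _, h⟩).elim, fun h => (he ⟨_, _, h⟩).elim⟩
  rcases h.2 _ hm with h1 | ⟨v, h1⟩ | h1
  · have : a ∈ ({a, b} : Set P.V) := by simp
    rw [h1] at this; exact this.elim
  · have h2 : a ∈ ({a, b} : Set P.V) := by simp
    have h3 : b ∈ ({a, b} : Set P.V) := by simp
    rw [h1] at h2 h3
    exact (hab ((h2 : a = v).trans (h3 : b = v).symm)).elim
  · rw [← Finset.card_univ, Finset.card_eq_two]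
    refine ⟨a, b, hab, ?_⟩
    ext x
    have : x ∈ ({a, b} : Set P.V) := by rw [h1]; trivial
    simpa using this

theorem prime_edge {P : LGraph} (h : P.Prime) (hc : 3 ≤ Fintype.card P.V) : ∃ a b, P.adj a b := by
  by_contra he
  have := prime_edgeless h he
  omega

theorem prime_card {P : LGraph} (h : P.Prime) : Fintype.card P.V = 2 ∨ 4 ≤ Fintype.card P.V := by
  classical
  have h2 := h.1
  by_contra hcon
  have h3 : Fintype.card P.V = 3 := by omega
  rw [← Finset.card_univ, Finset.card_eq_three] at h3
  obtain ⟨a, b, c, hab, hac, hbc, hu⟩ := h3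
  have key : ∀ x, x = a ∨ x = b ∨ x = c := by
    intro x
    have := Finset.mem_univ x
    rw [hu] at this
    simpa using this
  have aux : ∀ x y z : P.V, x ≠ y → z ≠ x → z ≠ y → (∀ w, w = x ∨ w = y ∨ w = z) →
      ¬ (P.adj z x ↔ P.adj z y) := by
    intro x y z hxy hzx hzy hall hiff
    have hm : P.IsModule {x, y} := by
      intro v hv s hs t ht
      have hv' : v = z := by
        rcases hall v with h | h | h
        · exact (hv (by simp [h])).elim
        · exact (hv (by simp [h])).elim
        · exact h
      subst hv'
      rcases hs with rfl | rfl <;> rcases ht with rfl | rfl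
      · exact Iff.rfl
      · exact hiff
      · exact hiff.symm
      · exact Iff.rfl
    rcases h.2 _ hm with h1 | ⟨v, h1⟩ | h1
    · have : x ∈ ({x, y} : Set P.V) := by simp
      rw [h1] at this; exact this.elim
    · have h2 : x ∈ ({x, y} : Set P.V) := by simp
      have h3 : y ∈ ({x, y} : Set P.V) := by simp
      rw [h1] at h2 h3
      exact hxy ((h2 : x = v).trans (h3 : y = v).symm)
    · have : z ∈ ({x, y} : Set P.V) := by rw [h1]; trivial
      rcases this with h | h
      · exact hzx h
      · exact hzy h
  have k1 := aux a b c hab hac.symm hbc.symm key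
  have k2 := aux a c b hac hab.symm hbc (fun w => by rcases key w with h | h | h <;> simp [h])
  have k3 := aux b c a hbc hab hac (fun w => by rcases key w with h | h | h <;> simp [h])
  have s1 : P.adj a b ↔ P.adj b a := ⟨fun h => P.symm h, fun h => P.symm h⟩
  have s2 : P.adj a c ↔ P.adj c a := ⟨fun h => P.symm h, fun h => P.symm h⟩
  have s3 : P.adj b c ↔ P.adj c b := ⟨fun h => P.symm h, fun h => P.symm h⟩
  tauto

/-! ### Quotient maps -/

def IsQ (W : LGraph) {I : Type} (r : I → I → Prop) (ρ : W.V → I) : Prop :=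
  ∀ x y, ρ x ≠ ρ y → (W.adj x y ↔ r (ρ x) (ρ y))

noncomputable def fib (W : LGraph) {I : Type} (ρ : W.V → I) (v : I) : LGraph := ind W {x | ρ x = v}

theorem isq_connected {W P : LGraph} {ρ : W.V → P.V} (hP : P.Prime) (he : ∃ a b, P.adj a b)
    (hq : IsQ W P.adj ρ) (hs : Function.Surjective ρ) (S : Set W.V) (hn : S.Nonempty)
    (hc : ∀ x ∈ S, ∀ y, W.adj x y → y ∈ S) : ∀ x, x ∈ S := by
  have h1 : ∀ v, v ∈ ρ '' S := by
    apply prime_connected hP he (ρ '' S) (hn.image _)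
    rintro _ ⟨x, hx, rfl⟩ v hv
    obtain ⟨y, rfl⟩ := hs v
    exact ⟨y, hc x hx y ((hq x y (edge_ne hv)).2 hv), rfl⟩
  intro x
  obtain ⟨w, hw⟩ := prime_nbr hP he (ρ x)
  obtain ⟨s, hs, rfl⟩ := h1 w
  have hw' := P.symm hw
  exact hc s hs x ((hq s x (edge_ne hw')).2 hw')

theorem isq_module {W P : LGraph} {ρ : W.V → P.V} (hP : P.Prime) (he : ∃ a b, P.adj a b)
    (hq : IsQ W P.adj ρ) (hs : Function.Surjective ρ) (N : Set W.V) (hn : N.Nonempty)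
    (hm : W.IsModule N) :
    (∃ v, ∀ x ∈ N, ρ x = v) ∨ (∀ x, x ∈ N) ∨
      (Fintype.card P.V = 2 ∧ ∀ x ∉ N, ∀ y ∈ N, W.adj x y) := by
  have hmod : P.IsModule (ρ '' N) := by
    rintro v hv _ ⟨x, hx, rfl⟩ _ ⟨y, hy, rfl⟩
    obtain ⟨z, rfl⟩ := hs v
    have hz : z ∉ N := fun h => hv ⟨z, h, rfl⟩
    have e1 : ρ z ≠ ρ x := fun e => hv ⟨x, hx, e.symm⟩
    have e2 : ρ z ≠ ρ y := fun e => hv ⟨y, hy, e.symm⟩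
    rw [← hq z x e1, ← hq z y e2]
    exact hm z hz x hx y hy
  rcases hP.2 _ hmod with h1 | ⟨v, h1⟩ | h1
  · simp at h1; simp [h1] at hn
  · left
    refine ⟨v, fun x hx => ?_⟩
    have : ρ x ∈ ρ '' N := ⟨x, hx, rfl⟩
    rw [h1] at this
    exact this
  · right
    by_cases hall : ∀ x, x ∈ N
    · exact Or.inl hall
    right
    have hex : ∀ v, ∃ n ∈ N, ρ n = v := by
      intro v
      have : v ∈ ρ '' N := by rw [h1]; trivial
      exact this
    have full : ∀ x ∉ N, ∀ y ∈ N, W.adj x y := by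
      intro x hx y hy
      obtain ⟨w, hw⟩ := prime_nbr hP he (ρ x)
      obtain ⟨n, hn, rfl⟩ := hex w
      exact (hm x hx n hn y hy).1 ((hq x n (edge_ne hw)).2 hw)
    refine ⟨?_, full⟩
    push Not at hall
    obtain ⟨x, hx⟩ := hall
    have hm2 : P.IsModule {w | w ≠ ρ x} := by
      intro v hv a ha b hb
      have hv' : v = ρ x := by simpa using hv
      subst hv'
      have aux : ∀ a, a ≠ ρ x → P.adj (ρ x) a := by
        intro a ha
        obtain ⟨n, hn, rfl⟩ := hex a
        exact (hq x n (Ne.symm ha)).1 (full x hx n hn)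
      exact ⟨fun _ => aux b hb, fun _ => aux a ha⟩
    obtain ⟨a, b, hab⟩ := prime_two hP
    rcases hP.2 _ hm2 with h2 | ⟨v, h2⟩ | h2
    · exfalso
      have : ∀ w, w = ρ x := by
        intro w
        by_contra hw
        have : w ∈ {w | w ≠ ρ x} := hw
        rw [h2] at this; exact this
      exact hab ((this a).trans (this b).symm)
    · classical
      rw [← Finset.card_univ, Finset.card_eq_two]
      have hv : v ≠ ρ x := by
        have : v ∈ {w | w ≠ ρ x} := by rw [h2]; rfl
        exact this
      refine ⟨ρ x, v, hv.symm, ?_⟩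
      ext w
      simp only [Finset.mem_univ, true_iff, Finset.mem_insert, Finset.mem_singleton]
      by_contra hw
      push Not at hw
      have : w ∈ {w | w ≠ ρ x} := hw.1
      rw [h2] at this
      exact hw.2 this
    · exfalso
      have : ρ x ∈ {w | w ≠ ρ x} := by rw [h2]; trivial
      exact this rfl

theorem prime_decomp : ∀ (n : ℕ) (Q : LGraph), sz Q = n → 2 ≤ sz Q →
    ∃ P : LGraph, P.Prime ∧ ∃ τ : Q.V → P.V, Function.Surjective τ ∧ IsQ Q P.adj τ := by
  classical
  intro n
  induction n using Nat.strong_induction_on with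
  | _ n ih =>
  intro Q hn h2
  by_cases hQ : Q.Prime
  · exact ⟨Q, hQ, id, Function.surjective_id, fun x y _ => Iff.rfl⟩
  have : ∃ M, Q.IsModule M ∧ ¬ (M = ∅ ∨ (∃ v, M = {v}) ∨ M = Set.univ) := by
    by_contra hcon
    push Not at hcon
    refine hQ ⟨by simpa [sz] using h2, ?_⟩
    intro M hM
    by_contra h'
    exact h' (hcon M hM)
  obtain ⟨M, hM, hM'⟩ := this
  push Not at hM'
  obtain ⟨hM1, hM2, hM3⟩ := hM'
  obtain ⟨m0, hm0⟩ := hM1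
  obtain ⟨m1, hm1, hne⟩ : ∃ m1 ∈ M, m1 ≠ m0 := by
    by_contra hcon
    push Not at hcon
    exact hM2 m0 (Set.eq_singleton_iff_unique_mem.2 ⟨hm0, hcon⟩)
  obtain ⟨x0, hx0⟩ : ∃ x, x ∉ M := by
    by_contra hcon
    push Not at hcon
    exact hM3 (Set.eq_univ_of_forall hcon)
  let A : Set Q.V := {x | x ∉ M ∨ x = m0}
  let c : Q.V → (ind Q A).V := fun x => if h : x ∈ M then ⟨m0, Or.inr rfl⟩ else ⟨x, Or.inl h⟩
  have hsz := sz_ind_split Q A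
  have hlt : 0 < sz (ind Q Aᶜ) := by
    apply sz_pos
    refine ⟨⟨m1, ?_⟩⟩
    rintro (h | h)
    · exact h hm1
    · exact hne h
  have hge : 2 ≤ sz (ind Q A) := by
    have : 1 < Fintype.card (ind Q A).V := by
      rw [Fintype.one_lt_card_iff]
      refine ⟨⟨m0, Or.inr rfl⟩, ⟨x0, Or.inl hx0⟩, ?_⟩
      intro h
      have h' : m0 = x0 := congrArg Subtype.val h
      exact hx0 (h' ▸ hm0)
    have h3 : sz (ind Q A) = Fintype.card (ind Q A).V := Nat.card_eq_fintype_card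
    omega
  have hcM : ∀ x, x ∈ M → (c x).1 = m0 := by
    intro x hx
    have : c x = ⟨m0, Or.inr rfl⟩ := dif_pos hx
    rw [this]
  have hcN : ∀ x, x ∉ M → (c x).1 = x := by
    intro x hx
    have : c x = ⟨x, Or.inl hx⟩ := dif_neg hx
    rw [this]
  obtain ⟨P, hP, τ, hs, hq⟩ := ih _ (by omega) (ind Q A) rfl hge
  refine ⟨P, hP, fun x => τ (c x), ?_, ?_⟩
  · intro v
    obtain ⟨⟨x, hx⟩, rfl⟩ := hs v
    refine ⟨x, congrArg τ (Subtype.ext ?_)⟩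
    by_cases h : x ∈ M
    · have : x = m0 := hx.resolve_left (fun h' => h' h)
      exact (hcM x h).trans this.symm
    · rw [hcN x h]
  · intro x y hxy
    rw [← hq _ _ hxy]
    change _ ↔ Q.adj (c x).1 (c y).1
    by_cases hx : x ∈ M <;> by_cases hy : y ∈ M
    · exact (hxy (congrArg τ (Subtype.ext ((hcM x hx).trans (hcM y hy).symm)))).elim
    · rw [hcM x hx, hcN y hy]
      have := hM y hy x hx m0 hm0
      constructor
      · intro h; exact Q.symm (this.1 (Q.symm h))
      · intro h; exact Q.symm (this.2 (Q.symm h))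
    · rw [hcN x hx, hcM y hy]
      exact hM x hx y hy m0 hm0
    · rw [hcN x hx, hcN y hy]

theorem comp_decomp (D : LGraph) (S : Set D.V) (hn : S.Nonempty)
    (hc : ∀ T : Set D.V, (∀ x ∈ S, x ∈ T) → (∀ x ∈ T, ∀ y, D.adj x y → y ∈ T) → ∀ x, x ∈ T) :
    ∃ (P : LGraph) (τ : D.V → P.V) (u : P.V), P.Prime ∧ (∃ a b, P.adj a b) ∧
      IsQ D P.adj τ ∧ (∀ x, τ x ≠ u → (x ∈ S ↔ P.adj (τ x) u)) ∧ (∀ v, v ≠ u → ∃ x, τ x = v) := by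
  have h2 : 2 ≤ sz (D.plug S (single (0, true))) := by
    rw [sz_plug]
    have h1 : 0 < sz D := sz_pos ⟨hn.some⟩
    have h3 : 0 < sz (single (0, true)) := sz_pos ⟨()⟩
    omega
  obtain ⟨P, hP, τ, hs, hq⟩ := prime_decomp _ _ rfl h2
  have hS : ∀ x, τ (Sum.inl x) ≠ τ (Sum.inr ()) → (x ∈ S ↔ P.adj (τ (Sum.inl x)) (τ (Sum.inr ()))) := by
    intro x hx
    exact hq (Sum.inl x) (Sum.inr ()) hx
  refine ⟨P, fun x => τ (Sum.inl x), τ (Sum.inr ()), hP, ?_, ?_, hS, ?_⟩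
  · by_contra he
    have := hc {x | τ (Sum.inl x) = τ (Sum.inr ())} (by
      intro x hx
      by_contra hne
      exact he ⟨_, _, (hS x hne).1 hx⟩) (by
      intro x hx y hxy
      by_contra hne
      have hne' : τ (Sum.inl x) ≠ τ (Sum.inl y) := by
        intro h; exact hne (h.symm.trans hx)
      exact he ⟨_, _, (hq (Sum.inl x) (Sum.inl y) hne').1 hxy⟩)
    have key : ∀ v, v = τ (Sum.inr ()) := by
      intro v
      obtain ⟨x | x, rfl⟩ := hs v
      · exact this x
      · rfl
    obtain ⟨a, b, hab⟩ := prime_two hP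
    exact hab ((key a).trans (key b).symm)
  · intro x y hxy
    exact hq (Sum.inl x) (Sum.inl y) hxy
  · intro v hv
    obtain ⟨x | x, rfl⟩ := hs v
    · exact ⟨x, rfl⟩
    · exact (hv rfl).elim

/-- the component(s) meeting `S` -/
def reach (D : LGraph) (S : Set D.V) : Set D.V :=
  {x | ∀ T : Set D.V, (∀ x ∈ S, x ∈ T) → (∀ x ∈ T, ∀ y, D.adj x y → y ∈ T) → x ∈ T}

theorem reach_sub (D : LGraph) (S : Set D.V) : ∀ x ∈ S, x ∈ reach D S := fun x hx _ h _ => h x hx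
theorem reach_closed (D : LGraph) (S : Set D.V) : ∀ x ∈ reach D S, ∀ y, D.adj x y → y ∈ reach D S :=
  fun x hx y hxy T h1 h2 => h2 x (hx T h1 h2) y hxy

theorem reach_conn (D : LGraph) (S : Set D.V) :
    ∀ T : Set (ind D (reach D S)).V, (∀ x, x.1 ∈ S → x ∈ T) →
      (∀ x ∈ T, ∀ y, (ind D (reach D S)).adj x y → y ∈ T) → ∀ x, x ∈ T := by
  intro T h1 h2 x
  have := x.2 {y | ∃ h : y ∈ reach D S, (⟨y, h⟩ : (ind D (reach D S)).V) ∈ T}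
    (fun y hy => ⟨reach_sub D S y hy, h1 _ hy⟩) (by
      rintro y ⟨hy, hy'⟩ z hyz
      exact ⟨reach_closed D S y hy z hyz, h2 _ hy' _ hyz⟩)
  obtain ⟨_, h⟩ := this
  exact h

theorem comp_isq (P : LGraph) (F : P.V → LGraph) : IsQ (P.comp F) P.adj Sigma.fst := by
  intro x y hxy
  constructor
  · rintro (⟨v, a, b, rfl, rfl, _⟩ | ⟨_, h⟩)
    · exact (hxy rfl).elim
    · exact h
  · intro h; exact Or.inr ⟨hxy, h⟩

/-- conclusions of rules are co-connected -/
theorem rule_coconn {p c : LGraph} (h : GSRule p c) (S : Set c.V) (hn : S.Nonempty)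
    (hc : ∀ x ∈ S, ∀ y, ¬ c.adj x y → y ∈ S) : ∀ x, x ∈ S := by
  have cross : ∀ (A B : LGraph) (S : Set (A.par B).V), S.Nonempty →
      (∀ x ∈ S, ∀ y, ¬ (A.par B).adj x y → y ∈ S) → Nonempty A.V → Nonempty B.V → ∀ x, x ∈ S := by
    rintro A B S ⟨s, hs⟩ hc ⟨a⟩ ⟨b⟩
    have nadj : ∀ a b, ¬ (A.par B).adj (Sum.inl a) (Sum.inr b) := fun a b h => h
    have nadj' : ∀ a b, ¬ (A.par B).adj (Sum.inr b) (Sum.inl a) := fun a b h => h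
    have h1 : (∀ a, Sum.inl a ∈ S) ∧ (∀ b, Sum.inr b ∈ S) := by
      rcases s with s | s
      · have hB : ∀ b, Sum.inr b ∈ S := fun b => hc _ hs _ (nadj s b)
        exact ⟨fun a => hc _ (hB b) _ (nadj' a b), hB⟩
      · have hA : ∀ a, Sum.inl a ∈ S := fun a => hc _ hs _ (nadj' a s)
        exact ⟨hA, fun b => hc _ (hA a) _ (nadj a b)⟩
    rintro (x | x)
    · exact h1.1 x
    · exact h1.2 x
  cases h with
  | ai a => exact cross _ _ S hn hc ⟨()⟩ ⟨()⟩
  | ss A B S' hA hS =>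
    exact cross _ _ S hn hc ⟨(Set.nonempty_iff_ne_empty.2 hS).some⟩ hA
  | p n P e M N hP h4 hM =>
    have hcard : Fintype.card P.V = n := by simpa using Fintype.card_congr e
    obtain ⟨v0⟩ : Nonempty P.V := Fintype.card_pos_iff.1 (by omega)
    by_cases hN : Nonempty (P.comp fun v => N (e v)).V
    · exact cross _ _ S hn hc ⟨⟨v0, (hM (e v0)).some⟩⟩ hN
    · have hl : ∀ x, Sum.inl x ∈ S := by
        refine isq_connected (W := (P.dual.comp fun v => M (e v)).dual) (P := P) (ρ := Sigma.fst) hP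
          (prime_edge hP (by omega)) ?_ ?_ {x | Sum.inl x ∈ S} ?_ ?_
        · intro x y hxy
          have h1 := comp_isq P.dual (fun v => M (e v)) x y hxy
          have h2 : (P.dual.comp fun v => M (e v)).dual.adj x y ↔
            (x ≠ y ∧ ¬ (P.dual.comp fun v => M (e v)).adj x y) := Iff.rfl
          have h3 : P.dual.adj x.1 y.1 ↔ (x.1 ≠ y.1 ∧ ¬ P.adj x.1 y.1) := Iff.rfl
          have h4 : x ≠ y := fun e => hxy (by rw [e])
          rw [h2, h1, h3]
          tauto
        · intro v
          exact ⟨⟨v, (hM (e v)).some⟩, rfl⟩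
        · obtain ⟨x | x, hx⟩ := hn
          · exact ⟨x, hx⟩
          · exact (hN ⟨x⟩).elim
        · intro x hx y hxy
          exact hc _ hx _ hxy.2
      rintro (x | x)
      · exact hl x
      · exact (hN ⟨x⟩).elim

theorem rule_nonempty {p c : LGraph} (h : GSRule p c) : Nonempty c.V := by
  cases h with
  | ai a => exact ⟨Sum.inl ()⟩
  | ss A B S' hA hS => exact ⟨Sum.inr hA.some⟩
  | p n P e M N hP h4 hM =>
    have hcard : Fintype.card P.V = n := by simpa using Fintype.card_congr e
    obtain ⟨v0⟩ : Nonempty P.V := Fintype.card_pos_iff.1 (by omega)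
    exact ⟨Sum.inl ⟨v0, (hM (e v0)).some⟩⟩

/-! ### Fibres of quotient maps -/

theorem isq_ind {Y : LGraph} {I : Type} {r : I → I → Prop} {κ : Y.V → I} (h : IsQ Y r κ)
    (A : Set Y.V) : IsQ (ind Y A) r (fun y => κ y.1) := fun x y hxy => h x.1 y.1 hxy

theorem isq_congr {Y : LGraph} {I : Type} {r r' : I → I → Prop} {κ : Y.V → I} (h : IsQ Y r κ)
    (hr : ∀ a b, a ≠ b → (r a b ↔ r' a b)) : IsQ Y r' κ :=
  fun x y hxy => (h x y hxy).trans (hr _ _ hxy)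

theorem fib_ind_iso {Y : LGraph} {I : Type} (κ : Y.V → I) (A : Set Y.V) (w : I)
    (h : ∀ y, κ y = w → y ∈ A) : (fib (ind Y A) (fun y => κ y.1) w).iso (fib Y κ w) := by
  refine ind_ind A _ _ ?_
  intro x
  exact ⟨fun hx => ⟨h x hx, hx⟩, fun ⟨_, hx⟩ => hx⟩

theorem fib_ind_empty {Y : LGraph} {I : Type} (κ : Y.V → I) (A : Set Y.V) (w : I)
    (h : ∀ y ∈ A, κ y ≠ w) : IsEmpty (fib (ind Y A) (fun y => κ y.1) w).V :=
  ⟨fun x => h x.1.1 x.1.2 x.2⟩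

theorem fib_empty {Y : LGraph} {I : Type} (κ : Y.V → I) (w : I)
    (h : ∀ y, κ y ≠ w) : IsEmpty (fib Y κ w).V := ⟨fun x => h x.1 x.2⟩

theorem fib_congr {Y : LGraph} {I : Type} (κ : Y.V → I) {v w : I} (h : v = w) :
    (fib Y κ v).iso (fib Y κ w) := by
  subst h
  exact iso_refl _

/-- `Y` is its fibre over `v` plugged in the rest -/
theorem fib_plug {Y : LGraph} {I : Type} {r : I → I → Prop} {κ : Y.V → I} (h : IsQ Y r κ) (v : I) :
    Y.iso ((ind Y {y | κ y ≠ v}).plug {y | r (κ y.1) v} (fib Y κ v)) := by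
  refine iso_trans (iso_symm (ind_all Set.univ fun _ => trivial)) ?_
  refine ind_plug _ _ _ _ ?_ ?_ ?_
  · intro x
    have := em (κ x = v)
    simp only [Set.mem_univ, true_iff, Set.mem_ofPred_eq]
    tauto
  · intro x h1 h2; exact h1 h2
  · intro x y hy
    have hy' : κ y = v := hy
    have := h x.1 y (by rw [hy']; exact x.2)
    rw [this, hy']
    rfl

theorem drop_fib {Y : LGraph} {I : Type} {r : I → I → Prop} {κ : Y.V → I} (h : IsQ Y r κ) (v : I)
    (hv : Pr (fib Y κ v)) : Dv (ind Y {y | κ y ≠ v}) Y :=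
  by
  exact dv_trans (dv_ins _ _ hv) (dv_iso (iso_symm (fib_plug h v)))

theorem sz_drop {Y : LGraph} {I : Type} {κ : Y.V → I} (y : Y.V) :
    sz (ind Y {x | κ x ≠ κ y}) < sz Y := by
  have h := sz_ind_split Y {x | κ x ≠ κ y}
  have : 0 < sz (ind Y {x | κ x ≠ κ y}ᶜ) := sz_pos ⟨⟨y, by simp⟩⟩
  omega

theorem fill_aux : ∀ (n : ℕ) (Y : LGraph) {I : Type} {r : I → I → Prop} {κ : Y.V → I}, sz Y = n →
    IsQ Y r κ → ∀ J : Set I, (∀ v ∉ J, Pr (fib Y κ v)) → Dv (ind Y {y | κ y ∈ J}) Y := by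
  intro n
  induction n using Nat.strong_induction_on with
  | _ n ih =>
  intro Y I r κ hn hq J hJ
  by_cases hall : ∀ y, κ y ∈ J
  · exact dv_iso (ind_all _ hall)
  push Not at hall
  obtain ⟨y, hy⟩ := hall
  have h1 := ih _ (by have := sz_drop (κ := κ) y; omega) (ind Y {x | κ x ≠ κ y}) rfl
    (isq_ind hq _) J (by
      intro v hv
      by_cases hvy : v = κ y
      · exact pr_zero (fib_ind_empty _ _ _ (by intro x hx; rw [hvy]; exact hx))
      · refine pr_dv (hJ v hv) (dv_iso (iso_symm (fib_ind_iso κ _ _ ?_)))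
        intro x hx
        change κ x ≠ κ y
        rw [hx]; exact hvy)
  refine dv_trans ?_ (dv_trans h1 (drop_fib hq _ (hJ _ hy)))
  refine dv_iso (iso_symm (ind_ind _ _ _ ?_))
  intro x
  constructor
  · intro hx
    have hx' : κ x ∈ J := hx
    refine ⟨?_, hx'⟩
    intro e
    exact hy (e ▸ hx')
  · rintro ⟨_, hx⟩; exact hx

theorem fill {Y : LGraph} {I : Type} {r : I → I → Prop} {κ : Y.V → I}
    (hq : IsQ Y r κ) (J : Set I) (hJ : ∀ v ∉ J, Pr (fib Y κ v)) : Dv (ind Y {y | κ y ∈ J}) Y :=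
  fill_aux _ Y rfl hq J hJ

/-! ### Compositions -/

theorem comp_iso {P W : LGraph} {ρ : W.V → P.V} (hq : IsQ W P.adj ρ) (F : P.V → LGraph)
    (h : ∀ v, (F v).iso (fib W ρ v)) : (P.comp F).iso W := by
  let e : ∀ v, LGraph.Iso (F v) (fib W ρ v) := fun v => Classical.choice (h v)
  have hρ : ∀ v (x : (F v).V), ρ ((e v).toEquiv x).1 = v := fun v x => ((e v).toEquiv x).2
  refine iso_of_emb ⟨fun x => ((e x.1).toEquiv x.2).1, ?_, ?_, ?_⟩ ?_
  · rintro ⟨v, x⟩ ⟨w, y⟩ hxy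
    have hvw : v = w := by rw [← hρ v x, ← hρ w y]; exact congrArg ρ hxy
    subst hvw
    have : x = y := (e v).toEquiv.injective (Subtype.ext hxy)
    rw [this]
  · rintro ⟨v, x⟩ ⟨w, y⟩
    by_cases hvw : v = w
    · subst hvw
      constructor
      · rintro (⟨v', a, b, hx, hy, hab⟩ | ⟨hne, _⟩)
        · obtain rfl : v = v' := congrArg Sigma.fst hx
          obtain rfl : x = a := by simpa using hx
          obtain rfl : y = b := by simpa using hy
          exact ((e v).adj_iff x y).1 hab
        · exact (hne rfl).elim
      · intro hab
        exact Or.inl ⟨v, x, y, rfl, rfl, ((e v).adj_iff x y).2 hab⟩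
    · have h1 := comp_isq P F ⟨v, x⟩ ⟨w, y⟩ hvw
      have h2 := hq ((e v).toEquiv x).1 ((e w).toEquiv y).1 (by rw [hρ, hρ]; exact hvw)
      rw [h1, h2, hρ, hρ]
  · rintro ⟨v, x⟩
    exact (e v).label_eq x
  · intro y
    refine ⟨⟨ρ y, (e (ρ y)).toEquiv.symm ⟨y, rfl⟩⟩, ?_⟩
    exact congrArg Subtype.val ((e (ρ y)).toEquiv.apply_symm_apply ⟨y, rfl⟩)

theorem tensor_comm' (G H : LGraph) : (G.tensor H).iso (H.tensor G) := by
  refine iso_trans (iso_plug_of_emb (Emb.tenR G H) (Emb.tenL G H) (R := Set.univ) ?_ ?_ ?_)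
    (iso_symm (tensor_iso_plug _ _))
  · intro i j h; cases h
  · intro i j; exact ⟨fun _ => trivial, fun _ => trivial⟩
  · rintro (y | y)
    · exact Or.inr ⟨y, rfl⟩
    · exact Or.inl ⟨y, rfl⟩

theorem pr_bigTensor (n : ℕ) (F : Fin n → LGraph) (h : ∀ i, Pr (F i)) : Pr (bigTensor n F) := by
  induction n with
  | zero => exact pr_empty
  | succ n ih =>
    exact pr_dv (pr_plug Set.univ (h 0) (ih (fun i => F i.succ) fun i => h _))
      (dv_iso (iso_symm (tensor_iso_plug _ _)))

theorem dv_bigTensor (n : ℕ) (F : Fin n → LGraph) (i : Fin n) (h : ∀ j, j ≠ i → Pr (F j)) :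
    Dv (F i) (bigTensor n F) := by
  induction n with
  | zero => exact i.elim0
  | succ n ih =>
    refine Fin.cases ?_ ?_ i (motive := fun i => (∀ j, j ≠ i → Pr (F j)) → Dv (F i) (bigTensor (n+1) F)) h
    · intro h
      exact dv_trans (dv_ins _ Set.univ (pr_bigTensor n (fun j => F j.succ)
        fun j => h _ (Fin.succ_ne_zero j))) (dv_iso (iso_symm (tensor_iso_plug _ _)))
    · intro i h
      refine dv_trans (ih (fun j => F j.succ) i fun j hj => h _ (fun e => hj (Fin.succ_injective _ e))) ?_
      refine dv_trans (dv_ins _ Set.univ (h 0 (Fin.succ_ne_zero i).symm)) ?_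
      exact dv_iso (iso_trans (iso_symm (tensor_iso_plug _ _)) (tensor_comm' _ _))

/-! ### The general interaction lemma -/

theorem two_cases {α : Type} [Fintype α] (h : Fintype.card α = 2) {a b : α} (hab : a ≠ b) (x : α) :
    x = a ∨ x = b := by
  classical
  by_contra hcon
  push Not at hcon
  have : ({a, b, x} : Finset α).card ≤ Fintype.card α := Finset.card_le_univ _
  rw [Finset.card_eq_three.2 ⟨a, b, x, hab, hcon.1.symm, hcon.2.symm, rfl⟩] at this
  omega

theorem prime_lder {P Y N : LGraph} {κ : Y.V → P.V} {q : N.V → P.V} (hP : P.Prime)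
    (hκ : IsQ Y (fun a b => ¬ P.adj a b) κ) (hq : IsQ N P.adj q)
    (hs : Function.Surjective κ ∨ Function.Surjective q) (u : P.V)
    (h : ∀ v, v ≠ u → Pr ((fib Y κ v).par (fib N q v))) :
    Dv ((fib Y κ u).par (fib N q u)) (Y.par N) := by
  rcases prime_card hP with h2 | h4
  · obtain ⟨w, hw⟩ : ∃ w, w ≠ u := by
      obtain ⟨a, b, hab⟩ := prime_two hP
      by_cases ha : a = u
      · exact ⟨b, fun e => hab (ha.trans e.symm)⟩
      · exact ⟨a, ha⟩
    have hc := two_cases h2 hw.symm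
    have eY : (ind Y {y | κ y ≠ w}).iso (fib Y κ u) := ind_eq (fun x => by
      change κ x ≠ w ↔ κ x = u
      rcases hc (κ x) with e | e <;> rw [e] <;> simp [hw, hw.symm])
    have eN : (ind N {y | q y ≠ w}).iso (fib N q u) := ind_eq (fun x => by
      change q x ≠ w ↔ q x = u
      rcases hc (q x) with e | e <;> rw [e] <;> simp [hw, hw.symm])
    have pY := fib_plug hκ w
    have pN := fib_plug hq w
    by_cases hadj : P.adj u w
    · have e1 : mk Y = mk (fib Y κ u) + mk (fib Y κ w) := by
        rw [← mk_eq.2 eY, ← mk_par, mk_eq]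
        refine iso_trans pY (iso_symm (par_iso_plug _ _ _ ?_))
        intro x hx
        have hx1 : κ x.1 = u := by
          rcases hc (κ x.1) with e | e
          · exact e
          · exact (x.2 e).elim
        have hx2 : ¬ P.adj (κ x.1) w := hx
        rw [hx1] at hx2
        exact hx2 hadj
      refine dv_trans (dv_par_right _ (dv_trans (dv_iso (iso_symm eN))
        (dv_trans (dv_slot _ _ (h w hw)) (dv_par_left _ (dv_iso (iso_symm pN)))))) (dv_mk ?_)
      simp only [mk_par, e1]
      abel
    · have e1 : mk N = mk (fib N q u) + mk (fib N q w) := by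
        rw [← mk_eq.2 eN, ← mk_par, mk_eq]
        refine iso_trans pN (iso_symm (par_iso_plug _ _ _ ?_))
        intro x hx
        have hx1 : q x.1 = u := by
          rcases hc (q x.1) with e | e
          · exact e
          · exact (x.2 e).elim
        have hx2 : P.adj (q x.1) w := hx
        rw [hx1] at hx2
        exact hadj hx2
      refine dv_trans (dv_par_left _ (dv_trans (dv_iso (iso_symm eY))
        (dv_trans (dv_slot _ _ (pr_dv (h w hw) (dv_iso (par_comm' _ _))))
          (dv_par_left _ (dv_iso (iso_symm pY)))))) (dv_mk ?_)
      simp only [mk_par, e1]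
      abel
  · let n := Fintype.card P.V
    let e : P.V ≃ Fin n := Fintype.equivFin P.V
    have hκ' : IsQ Y P.dual.adj κ := isq_congr hκ fun a b hab => by
      change _ ↔ (a ≠ b ∧ ¬ P.adj a b)
      tauto
    rcases hs with hs | hs
    · let F : Fin n → LGraph := fun i => (fib Y κ (e.symm i)).par (fib N q (e.symm i))
      have h1 : Dv (F (e u)) (bigTensor n F) := dv_bigTensor n F (e u) (fun j hj => h _ (fun he =>
        hj (by rw [← he]; simp)))
      have h2 := dv_rule (GSRule.p n P e (fun i => fib Y κ (e.symm i)) (fun i => fib N q (e.symm i)) hP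
        h4 (fun i => by
          obtain ⟨y, hy⟩ := hs (e.symm i)
          exact ⟨⟨y, hy⟩⟩))
      have h3 : F (e u) = (fib Y κ u).par (fib N q u) := by simp [F]
      rw [← h3]
      refine dv_trans h1 (dv_trans h2 (dv_iso (par_congr ?_ ?_)))
      · exact comp_iso hκ' _ (fun v => fib_congr _ (Equiv.symm_apply_apply e v))
      · exact comp_iso hq _ (fun v => fib_congr _ (Equiv.symm_apply_apply e v))
    · let F : Fin n → LGraph := fun i => (fib N q (e.symm i)).par (fib Y κ (e.symm i))
      have h1 : Dv (F (e u)) (bigTensor n F) := dv_bigTensor n F (e u) (fun j hj =>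
        pr_dv (h _ (fun he => hj (by rw [← he]; simp))) (dv_iso (par_comm' _ _)))
      have h2 := dv_rule (GSRule.p n P.dual e (fun i => fib N q (e.symm i)) (fun i => fib Y κ (e.symm i))
        (prime_dual hP) h4 (fun i => by
          obtain ⟨y, hy⟩ := hs (e.symm i)
          exact ⟨⟨y, hy⟩⟩))
      have h3 : F (e u) = (fib N q u).par (fib Y κ u) := by simp [F]
      refine dv_trans (dv_iso (par_comm' _ _)) ?_
      rw [← h3]
      refine dv_trans h1 (dv_trans h2 (dv_iso (iso_trans (par_congr ?_ ?_) (par_comm' _ _))))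
      · refine comp_iso (P := P.dual.dual) (ρ := q) (isq_congr hq ?_) _ (fun v => ?_)
        · intro a b hab
          change _ ↔ (a ≠ b ∧ ¬ (a ≠ b ∧ ¬ P.adj a b))
          tauto
        · exact fib_congr q (Equiv.symm_apply_apply e v)
      · exact comp_iso (P := P.dual) hκ' _ (fun v => fib_congr κ (Equiv.symm_apply_apply e v))

theorem isq_symm_dual {Q Y N : LGraph} {κ : Y.V → Q.V} {q : N.V → Q.V}
    (hκ : IsQ Y (fun a b => ¬ Q.adj a b) κ) (hq : IsQ N Q.adj q) :
    IsQ N (fun a b => ¬ Q.dual.adj a b) q ∧ IsQ Y Q.dual.adj κ := by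
  refine ⟨isq_congr hq ?_, isq_congr hκ ?_⟩
  · intro a b hab
    change _ ↔ ¬ (a ≠ b ∧ ¬ Q.adj a b)
    tauto
  · intro a b hab
    change _ ↔ (a ≠ b ∧ ¬ Q.adj a b)
    tauto

def LderP (n : ℕ) : Prop := ∀ (Q Y N : LGraph) (κ : Y.V → Q.V) (q : N.V → Q.V), sz Y + sz N = n →
    IsQ Y (fun a b => ¬ Q.adj a b) κ → IsQ N Q.adj q → ∀ u,
    (∀ v, v ≠ u → Pr ((fib Y κ v).par (fib N q v))) →
    Dv ((fib Y κ u).par (fib N q u)) (Y.par N)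

/-- dropping a vacuous slot -/
theorem lder_drop {n : ℕ} (ih : ∀ m < n, LderP m) {Q Y N : LGraph} {κ : Y.V → Q.V} {q : N.V → Q.V}
    (hn : sz Y + sz N = n) (hκ : IsQ Y (fun a b => ¬ Q.adj a b) κ) (hq : IsQ N Q.adj q) (u : Q.V)
    (h : ∀ v, v ≠ u → Pr ((fib Y κ v).par (fib N q v))) (y : Y.V) (hy : κ y ≠ u)
    (hy' : ∀ x, q x ≠ κ y) : Dv ((fib Y κ u).par (fib N q u)) (Y.par N) := by
  have hsz := sz_drop (κ := κ) y
  have hY := drop_fib hκ (κ y) (pr_mk (h _ hy) (by rw [mk_par, mk_zero (fib_empty q _ hy'), add_zero]))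
  have h1 := ih _ (by omega) Q (ind Y {x | κ x ≠ κ y}) N (fun x => κ x.1) q rfl (isq_ind hκ _) hq u (by
    intro v hv
    by_cases hvy : v = κ y
    · subst hvy
      refine pr_zero ⟨?_⟩
      rintro (x | x)
      · exact (fib_ind_empty κ _ (κ y) (fun _ h => h)).false x
      · exact hy' _ x.2
    · refine pr_dv (h v hv) (dv_iso (par_congr (iso_symm (fib_ind_iso κ _ _ ?_)) (iso_refl _)))
      intro x hx
      change κ x ≠ κ y
      rw [hx]; exact hvy)
  refine dv_trans ?_ (dv_trans h1 (dv_par_left _ hY))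
  refine dv_iso (par_congr (iso_symm (fib_ind_iso κ _ _ ?_)) (iso_refl _))
  intro x hx
  change κ x ≠ κ y
  rw [hx]; exact hy.symm

theorem lder_aux (n : ℕ) : LderP n := by
  classical
  induction n using Nat.strong_induction_on with
  | _ n ih =>
  intro Q Y N κ q hn hκ hq
  -- the case of an active `u`
  have main : ∀ u, ((∃ y, κ y = u) ∨ ∃ x, q x = u) →
      (∀ v, v ≠ u → Pr ((fib Y κ v).par (fib N q v))) →
      Dv ((fib Y κ u).par (fib N q u)) (Y.par N) := by
    intro u hu h
    by_cases c1 : ∃ y, κ y ≠ u ∧ ∀ x, q x ≠ κ y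
    · obtain ⟨y, h1, h2⟩ := c1
      exact lder_drop ih hn hκ hq u h y h1 h2
    by_cases c2 : ∃ x, q x ≠ u ∧ ∀ y, κ y ≠ q x
    · obtain ⟨x, h1, h2⟩ := c2
      obtain ⟨hq', hκ'⟩ := isq_symm_dual hκ hq
      refine dv_trans (dv_iso (par_comm' _ _)) (dv_trans ?_ (dv_iso (par_comm' _ _)))
      exact lder_drop (Q := Q.dual) ih (by omega) hq' hκ' u
        (fun v hv => pr_dv (h v hv) (dv_iso (par_comm' _ _))) x h1 h2
    push Not at c1 c2
    by_cases c3 : (∀ y, κ y = u) ∧ ∀ x, q x = u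
    · exact dv_iso (par_congr (ind_all _ c3.1) (ind_all _ c3.2))
    let J : Set Q.V := {v | (∃ y, κ y = v) ∨ ∃ x, q x = v}
    have hv0 : ∃ v0, v0 ≠ u ∧ v0 ∈ J := by
      by_contra hcon
      push Not at hcon
      apply c3
      constructor
      · intro y
        by_contra hy
        exact hcon _ hy (Or.inl ⟨y, rfl⟩)
      · intro x
        by_contra hx
        exact hcon _ hx (Or.inr ⟨x, rfl⟩)
    obtain ⟨v0, hv0, hv0J⟩ := hv0
    have h2 : 2 ≤ sz (ind Q J) := by
      have : 1 < Fintype.card (ind Q J).V := by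
        rw [Fintype.one_lt_card_iff]
        refine ⟨⟨v0, hv0J⟩, ⟨u, hu⟩, ?_⟩
        intro h
        exact hv0 (congrArg Subtype.val h)
      have h3 : sz (ind Q J) = Fintype.card (ind Q J).V := Nat.card_eq_fintype_card
      omega
    obtain ⟨P, hP, τ, hτs, hτ⟩ := prime_decomp _ (ind Q J) rfl h2
    let kJ : Y.V → (ind Q J).V := fun y => ⟨κ y, Or.inl ⟨y, rfl⟩⟩
    let qJ : N.V → (ind Q J).V := fun x => ⟨q x, Or.inr ⟨x, rfl⟩⟩
    have hκ2 : IsQ Y (fun a b => ¬ P.adj a b) (fun y => τ (kJ y)) := by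
      intro x y hxy
      have h1 := hτ _ _ hxy
      have h2 := hκ x y (fun e => hxy (congrArg τ (Subtype.ext e)))
      change _ ↔ ¬ P.adj (τ (kJ x)) (τ (kJ y))
      rw [← h1, h2]
      exact Iff.rfl
    have hq2 : IsQ N P.adj (fun y => τ (qJ y)) := by
      intro x y hxy
      have h1 := hτ _ _ hxy
      have h2 := hq x y (fun e => hxy (congrArg τ (Subtype.ext e)))
      change _ ↔ P.adj (τ (qJ x)) (τ (qJ y))
      rw [← h1, h2]
      exact Iff.rfl
    have hsurj : Function.Surjective (fun y => τ (kJ y)) ∨ Function.Surjective (fun y => τ (qJ y)) := by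
      rcases hu with ⟨y, hy⟩ | ⟨x, hx⟩
      · left
        intro w
        obtain ⟨⟨v, hv⟩, rfl⟩ := hτs w
        by_cases hvu : v = u
        · exact ⟨y, congrArg τ (Subtype.ext (hy.trans hvu.symm))⟩
        · rcases hv with ⟨y', hy'⟩ | ⟨x', hx'⟩
          · exact ⟨y', congrArg τ (Subtype.ext hy')⟩
          · obtain ⟨y', hy'⟩ := c2 x' (by rw [hx']; exact hvu)
            exact ⟨y', congrArg τ (Subtype.ext (hy'.trans hx'))⟩
      · right
        intro w
        obtain ⟨⟨v, hv⟩, rfl⟩ := hτs w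
        by_cases hvu : v = u
        · exact ⟨x, congrArg τ (Subtype.ext (hx.trans hvu.symm))⟩
        · rcases hv with ⟨y', hy'⟩ | ⟨x', hx'⟩
          · obtain ⟨x', hx'⟩ := c1 y' (by rw [hy']; exact hvu)
            exact ⟨x', congrArg τ (Subtype.ext (hx'.trans hy'))⟩
          · exact ⟨x', congrArg τ (Subtype.ext hx')⟩
    -- the induction hypothesis on blocks
    have block : ∀ j : (ind Q J).V, (∀ j', τ j' = τ j → j' ≠ j → j'.1 ≠ u) →
        Dv ((fib Y κ j.1).par (fib N q j.1))
          ((fib Y (fun y => τ (kJ y)) (τ j)).par (fib N (fun x => τ (qJ x)) (τ j))) := by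
      intro j hj
      have hlt : sz (fib Y (fun y => τ (kJ y)) (τ j)) + sz (fib N (fun x => τ (qJ x)) (τ j)) < n := by
        obtain ⟨a, b, hab⟩ := prime_two hP
        have : ∃ w, w ≠ τ j := by
          by_cases ha : a = τ j
          · exact ⟨b, fun e => hab (ha.trans e.symm)⟩
          · exact ⟨a, ha⟩
        obtain ⟨w, hw⟩ := this
        have s1 := sz_ind_split Y {y | τ (kJ y) = τ j}
        have s2 := sz_ind_split N {y | τ (qJ y) = τ j}
        have s3 : 0 < sz (ind Y {y | τ (kJ y) = τ j}ᶜ) ∨ 0 < sz (ind N {y | τ (qJ y) = τ j}ᶜ) := by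
          rcases hsurj with hs | hs
          · obtain ⟨y, hy⟩ := hs w
            left; apply sz_pos
            refine ⟨⟨y, ?_⟩⟩
            intro h'
            exact hw (hy.symm.trans h')
          · obtain ⟨y, hy⟩ := hs w
            right; apply sz_pos
            refine ⟨⟨y, ?_⟩⟩
            intro h'
            exact hw (hy.symm.trans h')
        have e1 : fib Y (fun y => τ (kJ y)) (τ j) = ind Y {y | τ (kJ y) = τ j} := rfl
        have e2 : fib N (fun y => τ (qJ y)) (τ j) = ind N {y | τ (qJ y) = τ j} := rfl
        rw [e1, e2]
        omega
      have isoY : ∀ j' : (ind Q J).V, τ j' = τ j →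
          (fib (fib Y (fun y => τ (kJ y)) (τ j)) (fun y => κ y.1) j'.1).iso (fib Y κ j'.1) := by
        intro j' hj'
        refine fib_ind_iso κ _ _ ?_
        intro y hy
        have : kJ y = j' := Subtype.ext hy
        change τ (kJ y) = τ j
        rw [this, hj']
      have isoN : ∀ j' : (ind Q J).V, τ j' = τ j →
          (fib (fib N (fun y => τ (qJ y)) (τ j)) (fun y => q y.1) j'.1).iso (fib N q j'.1) := by
        intro j' hj'
        refine fib_ind_iso q _ _ ?_
        intro y hy
        have : qJ y = j' := Subtype.ext hy
        change τ (qJ y) = τ j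
        rw [this, hj']
      have := ih _ hlt Q (fib Y (fun y => τ (kJ y)) (τ j)) (fib N (fun x => τ (qJ x)) (τ j))
        (fun y => κ y.1) (fun x => q x.1) rfl (isq_ind hκ _) (isq_ind hq _) j.1 (by
          intro v hv
          by_cases hvJ : ∃ hv : v ∈ J, τ ⟨v, hv⟩ = τ j
          · obtain ⟨hvJ, hvt⟩ := hvJ
            refine pr_dv (h v ?_) (dv_iso (iso_symm (par_congr (isoY ⟨v, hvJ⟩ hvt) (isoN ⟨v, hvJ⟩ hvt))))
            exact hj ⟨v, hvJ⟩ hvt (fun e => hv (congrArg Subtype.val e))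
          · refine pr_zero ⟨?_⟩
            rintro (x | x)
            · apply hvJ
              refine ⟨Or.inl ⟨x.1.1, x.2⟩, ?_⟩
              have hx : τ (kJ x.1.1) = τ j := x.1.2
              exact (congrArg τ (Subtype.ext x.2.symm)).trans hx
            · apply hvJ
              refine ⟨Or.inr ⟨x.1.1, x.2⟩, ?_⟩
              have hx : τ (qJ x.1.1) = τ j := x.1.2
              exact (congrArg τ (Subtype.ext x.2.symm)).trans hx)
      exact dv_trans (dv_iso (iso_symm (par_congr (isoY j rfl) (isoN j rfl)))) this
    have hu' := block ⟨u, hu⟩ (fun j' _ hne e => hne (Subtype.ext e))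
    refine dv_trans hu' (prime_lder hP hκ2 hq2 hsurj _ ?_)
    intro w hw
    obtain ⟨j, rfl⟩ := hτs w
    have hju : j.1 ≠ u := by
      intro e
      apply hw
      exact congrArg τ (Subtype.ext e)
    refine pr_dv (h _ hju) (block j ?_)
    intro j' hj' _ e
    apply hw
    rw [← hj']
    exact congrArg τ (Subtype.ext e)
  intro u h
  by_cases hu : (∃ y, κ y = u) ∨ ∃ x, q x = u
  · exact main u hu h
  push Not at hu
  have hemp : Pr ((fib Y κ u).par (fib N q u)) := by
    refine pr_zero ⟨?_⟩
    rintro (x | x)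
    · exact hu.1 _ x.2
    · exact hu.2 _ x.2
  have hall : ∀ v, Pr ((fib Y κ v).par (fib N q v)) := by
    intro v
    by_cases hv : v = u
    · rw [hv]; exact hemp
    · exact h v hv
  have hpr : Pr (Y.par N) := by
    by_cases hne : Nonempty (Y.par N).V
    · obtain ⟨x | x⟩ := hne
      · exact pr_dv (hall (κ x)) (main _ (Or.inl ⟨x, rfl⟩) fun v _ => hall v)
      · exact pr_dv (hall (q x)) (main _ (Or.inr ⟨x, rfl⟩) fun v _ => hall v)
    · exact pr_zero (not_nonempty_iff.1 hne)
  refine dv_trans (dv_mk ?_) hpr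
  have : IsEmpty ((fib Y κ u).par (fib N q u)).V := ⟨by
    rintro (x | x)
    · exact hu.1 _ x.2
    · exact hu.2 _ x.2⟩
  rw [mk_zero this, mk_empty]

theorem lder {Q Y N : LGraph} {κ : Y.V → Q.V} {q : N.V → Q.V}
    (hκ : IsQ Y (fun a b => ¬ Q.adj a b) κ) (hq : IsQ N Q.adj q) (u : Q.V)
    (h : ∀ v, v ≠ u → Pr ((fib Y κ v).par (fib N q v))) :
    Dv ((fib Y κ u).par (fib N q u)) (Y.par N) :=
  lder_aux _ Q Y N κ q rfl hκ hq u h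

theorem lprov {Q Y N : LGraph} {κ : Y.V → Q.V} {q : N.V → Q.V}
    (hκ : IsQ Y (fun a b => ¬ Q.adj a b) κ) (hq : IsQ N Q.adj q)
    (h : ∀ v, Pr ((fib Y κ v).par (fib N q v))) : Pr (Y.par N) := by
  by_cases hne : Nonempty Q.V
  · obtain ⟨u⟩ := hne
    exact pr_dv (h u) (lder hκ hq u fun v _ => h v)
  · refine pr_zero ⟨?_⟩
    rintro (x | x)
    · exact hne ⟨κ x⟩
    · exact hne ⟨q x⟩

/-- Lemma J -/
theorem lemJ {P Y N : LGraph} {κ : Y.V → P.V} {q : N.V → P.V}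
    (hκ : IsQ Y (fun a b => ¬ P.adj a b) κ) (hq : IsQ N P.adj q) (I : Set P.V)
    (h1 : ∀ n, q n ∉ I) (h2 : ∀ v ∈ I, ∀ n, ¬ P.adj v (q n))
    (h : ∀ v, v ∉ I → Pr ((fib Y κ v).par (fib N q v))) :
    Dv (ind Y {y | κ y ∈ I}) (Y.par N) := by
  have hT : Pr ((ind Y {y | κ y ∈ Set.range q}).par N) := by
    refine lprov (isq_ind hκ _) hq ?_
    intro v
    by_cases hv : v ∈ Set.range q
    · have hvI : v ∉ I := by
        obtain ⟨n, rfl⟩ := hv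
        exact h1 n
      refine pr_dv (h v hvI) (dv_iso (par_congr (iso_symm (fib_ind_iso κ _ _ ?_)) (iso_refl _)))
      intro y hy
      change κ y ∈ Set.range q
      rw [hy]; exact hv
    · refine pr_zero ⟨?_⟩
      rintro (x | x)
      · apply hv
        have := x.1.2
        change κ x.1.1 ∈ Set.range q at this
        have e : κ x.1.1 = v := x.2
        rwa [e] at this
      · exact hv ⟨x.1, x.2⟩
  refine dv_trans (dv_slot (ind Y {y | κ y ∈ I}) Set.univ
    (pr_dv hT (dv_iso (par_comm' _ _)))) (dv_par_left _ ?_)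
  refine dv_trans (dv_iso (iso_symm (ind_plug {y | κ y ∈ I ∪ Set.range q} _ _ _ ?_ ?_ ?_)))
    (fill hκ (I ∪ Set.range q) ?_)
  · intro x; exact Iff.rfl
  · rintro x hx ⟨n, hn⟩
    exact h1 n (hn ▸ hx)
  · rintro ⟨x, hx⟩ y ⟨n, hn⟩
    have hx' : κ x ∈ I := hx
    have := hκ x y (by rw [← hn]; intro e; exact h1 n (e ▸ hx'))
    rw [this, ← hn]
    exact ⟨fun _ => trivial, fun _ => h2 _ hx' n⟩
  · intro v hv
    refine pr_mk (h v fun hI => hv (Or.inl hI)) ?_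
    rw [mk_par, mk_zero (fib_empty q v fun n hn => hv (Or.inr ⟨n, hn⟩)), add_zero]

/-! ### Absorbing graphs into slots -/

def absG (Y : LGraph) {I : Type} (r : I → I → Prop) (κ : Y.V → I) (u : I) (A : LGraph) : LGraph :=
  Y.plug {y | κ y ≠ u ∧ r (κ y) u} A

def absK {Y : LGraph} {I : Type} (r : I → I → Prop) (κ : Y.V → I) (u : I) (A : LGraph) :
    (absG Y r κ u A).V → I := Sum.elim κ (fun _ => u)

theorem abs_isq {Y : LGraph} {I : Type} {r : I → I → Prop} (hr : ∀ a b, r a b → r b a)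
    {κ : Y.V → I} (h : IsQ Y r κ) (u : I) (A : LGraph) : IsQ (absG Y r κ u A) r (absK r κ u A) := by
  rintro (x | x) (y | y) hxy
  · exact h x y hxy
  · exact ⟨fun h => h.2, fun h => ⟨hxy, h⟩⟩
  · exact ⟨fun h => hr _ _ h.2, fun h => ⟨hxy.symm, hr _ _ h⟩⟩
  · exact (hxy rfl).elim

theorem abs_dv {Y : LGraph} {I : Type} (r : I → I → Prop) (κ : Y.V → I) (u : I) (A : LGraph) :
    Dv (absG Y r κ u A) (Y.par A) := dv_ss _ _ _

theorem abs_fib {Y : LGraph} {I : Type} (r : I → I → Prop)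
    (κ : Y.V → I) (u v : I) (A : LGraph) (hv : v ≠ u) :
    mk (fib (absG Y r κ u A) (absK r κ u A) v) = mk (fib Y κ v) := by
  refine (mk_eq.2 (emb_iso ((Emb.ind Y _).trans (Emb.plugL Y _ A)) (Emb.ind _ _) ?_ ?_)).symm
  · rintro ⟨x, hx⟩
    exact ⟨⟨Sum.inl x, hx⟩, rfl⟩
  · rintro ⟨x | x, hx⟩
    · exact ⟨⟨x, hx⟩, rfl⟩
    · exact (hv (hx : u = v).symm).elim

theorem abs_fib_self {Y : LGraph} {I : Type} (r : I → I → Prop) (κ : Y.V → I) (u : I) (A : LGraph) :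
    mk (fib (absG Y r κ u A) (absK r κ u A) u) = mk (fib Y κ u) + mk A := by
  rw [← mk_par, mk_eq]
  refine iso_par_of_emb (((Emb.ind Y {y | κ y = u}).trans (Emb.plugL Y _ A)).toInd _ ?_)
    ((Emb.plugR Y _ A).toInd _ ?_) ?_ ?_ ?_
  · intro x; exact x.2
  · intro x; rfl
  · intro i j h
    have : (Sum.inl i.1 : Y.V ⊕ A.V) = Sum.inr j := congrArg Subtype.val h
    cases this
  · intro i j h
    exact h.1 i.2
  · rintro ⟨x | x, hx⟩
    · exact Or.inl ⟨⟨x, hx⟩, rfl⟩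
    · exact Or.inr ⟨x, rfl⟩

theorem abs_many {I : Type} {r : I → I → Prop} (hr : ∀ a b, r a b → r b a) (n : ℕ)
    (K : Fin n → LGraph) (f : Fin n → I) (hf : Function.Injective f) (Y : LGraph) (κ : Y.V → I)
    (h : IsQ Y r κ) : ∃ (Y' : LGraph) (κ' : Y'.V → I), IsQ Y' r κ' ∧ Dv Y' (Y.par (bigPar n K)) ∧
      (∀ i, mk (fib Y' κ' (f i)) = mk (fib Y κ (f i)) + mk (K i)) ∧
      (∀ v, (∀ i, f i ≠ v) → mk (fib Y' κ' v) = mk (fib Y κ v)) := by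
  induction n with
  | zero =>
    refine ⟨Y, κ, h, dv_mk ?_, fun i => i.elim0, fun v _ => rfl⟩
    rw [mk_par]
    exact (add_zero _).symm
  | succ n ih =>
    obtain ⟨Y1, κ1, h1, h2, h3, h4⟩ := ih (fun i => K i.succ) (fun i => f i.succ)
      (hf.comp (Fin.succ_injective n))
    refine ⟨absG Y1 r κ1 (f 0) (K 0), absK r κ1 (f 0) (K 0), abs_isq hr h1 _ _, ?_, ?_, ?_⟩
    · refine dv_trans (abs_dv _ _ _ _) (dv_trans (dv_par_left _ h2) (dv_mk ?_))
      rw [bigPar]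
      simp only [mk_par]
      abel
    · intro i
      refine Fin.cases ?_ (fun i => ?_) i
      · rw [abs_fib_self, h4]
        intro i e
        exact Fin.succ_ne_zero i (hf e)
      · rw [abs_fib, h3]
        intro e
        exact Fin.succ_ne_zero i (hf e)
    · intro v hv
      rw [abs_fib _ _ _ _ _ (hv 0).symm, h4 v fun i => hv i.succ]

/-! ### The splitting goal -/

def Goal (G W P : LGraph) (ρ : W.V → P.V) : Prop :=
  (∃ (Y : LGraph) (κ : Y.V → P.V), IsQ Y (fun a b => ¬ P.adj a b) κ ∧ Red Y G ∧
    ∀ v, Pr ((fib Y κ v).par (fib W ρ v))) ∨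
  (∃ (KX KY : LGraph) (v : P.V), Red (KX.par KY) G ∧ Pr (KX.par (fib W ρ v)) ∧
    Pr (KY.par (ind W {x | ρ x ≠ v})))

def SplitAt (H : LGraph) : Prop := ∀ (G W P : LGraph) (ρ : W.V → P.V), (G.par W).iso H → P.Prime →
  (∃ a b, P.adj a b) → IsQ W P.adj ρ → Function.Surjective ρ → Goal G W P ρ

def Small (m : ℕ) : Prop := ∀ H, Pr H → sz H < m → SplitAt H

theorem goal_mon {G1 G W P : LGraph} {ρ : W.V → P.V} (h : Goal G1 W P ρ) (hr : Red G1 G) :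
    Goal G W P ρ := by
  rcases h with ⟨Y, κ, h1, h2, h3⟩ | ⟨KX, KY, v, h1, h2, h3⟩
  · exact Or.inl ⟨Y, κ, h1, red_trans h2 hr, h3⟩
  · exact Or.inr ⟨KX, KY, v, red_trans h1 hr, h2, h3⟩

theorem goal_iso {G W W' P : LGraph} (e : LGraph.Iso W W') {ρ : W'.V → P.V}
    (h : Goal G W P (fun x => ρ (e.toEquiv x))) : Goal G W' P ρ := by
  rcases h with ⟨Y, κ, h1, h2, h3⟩ | ⟨KX, KY, v, h1, h2, h3⟩
  · refine Or.inl ⟨Y, κ, h1, h2, fun v => pr_dv (h3 v) (dv_par_right _ (dv_iso ?_))⟩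
    exact ind_congr e _ _ fun x => Iff.rfl
  · refine Or.inr ⟨KX, KY, v, h1, pr_dv h2 (dv_par_right _ (dv_iso ?_)),
      pr_dv h3 (dv_par_right _ (dv_iso ?_))⟩
    · exact ind_congr e _ _ fun x => Iff.rfl
    · exact ind_congr e _ _ fun x => Iff.rfl

theorem splitAt_iso {H H' : LGraph} (h : SplitAt H) (e : H.iso H') : SplitAt H' :=
  fun G W P ρ h' => h G W P ρ (iso_trans h' (iso_symm e))

theorem small_mono {m n : ℕ} (h : Small m) (hl : n ≤ m) : Small n :=
  fun H hp hs => h H hp (lt_of_lt_of_le hs hl)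

theorem small_goal {m : ℕ} (h : Small m) {G W P : LGraph} {ρ : W.V → P.V} (hp : Pr (G.par W))
    (hz : sz G + sz W < m) (hP : P.Prime) (he : ∃ a b, P.adj a b) (hq : IsQ W P.adj ρ)
    (hs : Function.Surjective ρ) : Goal G W P ρ :=
  h _ hp (by rw [sz_par]; exact hz) G W P ρ (iso_refl _) hP he hq hs

/-- filling in a module -/
theorem mod_dv {W KX : LGraph} (N T T' : Set W.V) (hT : ∀ x, x ∈ T ↔ x ∈ T' ∨ x ∈ N)
    (hd : ∀ x, x ∈ T' → x ∈ N → False) (hm : W.IsModule N) (hx : Pr (KX.par (ind W N))) :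
    Dv (ind W T') (KX.par (ind W T)) := by
  have h := ind_plug T T' N {x | ∃ y ∈ N, W.adj x.1 y} hT hd (by
    intro x y hy
    constructor
    · intro h
      exact ⟨y, hy, h⟩
    · rintro ⟨z, hz, h⟩
      exact (hm x.1 (fun hh => hd _ x.2 hh) z hz y hy).1 h)
  refine dv_trans (dv_slot (ind W T') {x | ∃ y ∈ N, W.adj x.1 y} hx) (dv_mk ?_)
  rw [mk_par, mk_par, mk_eq.2 h, add_comm]

theorem sz_ind_lt {W : LGraph} (S : Set W.V) (x : W.V) (hx : x ∉ S) : sz (ind W S) < sz W := by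
  have h := sz_ind_split W S
  have : 0 < sz (ind W Sᶜ) := sz_pos ⟨⟨x, hx⟩⟩
  omega

theorem sz_ind_le {W : LGraph} (S : Set W.V) : sz (ind W S) ≤ sz W := by
  have h := sz_ind_split W S
  omega

theorem isq_fib_module {W : LGraph} {I : Type} {r : I → I → Prop} {ρ : W.V → I} (hq : IsQ W r ρ) (v : I) :
    W.IsModule {x | ρ x = v} := by
  intro z hz x hx y hy
  have hx' : ρ x = v := hx
  have hy' : ρ y = v := hy
  have hz' : ρ z ≠ v := hz
  rw [hq z x (by rw [hx']; exact hz'), hq z y (by rw [hy']; exact hz'), hx', hy']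

theorem symm_nadj (P : LGraph) : ∀ a b, (¬ P.adj a b) → ¬ P.adj b a := fun _ _ h h' => h (P.symm h')

theorem lemR1 {G W P : LGraph} {ρ : W.V → P.V} (hP : P.Prime) (he : ∃ a b, P.adj a b)
    (hq : IsQ W P.adj ρ) (hs : Function.Surjective ρ) (N : Set W.V) (hn : N.Nonempty)
    (hm : W.IsModule N) (j : P.V) (hj : ∀ x ∈ N, ρ x = j)
    {KX KY : LGraph} (hr : Red (KX.par KY) G) (hx : Pr (KX.par (ind W N)))
    (hy : Pr (KY.par (ind W Nᶜ))) (hsm : Small (sz G + sz W)) : Goal G W P ρ := by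
  by_cases hf : ∀ x, ρ x = j → x ∈ N
  · refine Or.inr ⟨KX, KY, j, hr, pr_dv hx (dv_par_right _ (dv_iso (ind_eq ?_))),
      pr_dv hy (dv_par_right _ (dv_iso (ind_eq ?_)))⟩
    · exact fun x => ⟨hj x, hf x⟩
    · exact fun x => ⟨fun h h' => h (hf x h'), fun h h' => h (hj x h')⟩
  push Not at hf
  obtain ⟨x0, hx0, hx0'⟩ := hf
  have hzr : sz KX + sz KY ≤ sz G := by rw [← sz_par]; exact sz_red hr
  obtain ⟨n0, hn0⟩ := hn
  have hzn : sz (ind W Nᶜ) < sz W := sz_ind_lt _ n0 (fun h => h hn0)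
  have hs' : Function.Surjective (fun x : (ind W Nᶜ).V => ρ x.1) := by
    intro v
    by_cases hv : v = j
    · exact ⟨⟨x0, hx0'⟩, hx0.trans hv.symm⟩
    · obtain ⟨x, rfl⟩ := hs v
      exact ⟨⟨x, fun h => hv (hj x h)⟩, rfl⟩
  have hg := small_goal hsm hy (by omega) hP he (isq_ind hq _) hs'
  -- fibres of the restriction
  have hfj : (fib (ind W Nᶜ) (fun x => ρ x.1) j).iso (ind W {x | ρ x = j ∧ x ∉ N}) :=
    ind_ind _ _ _ fun x => ⟨fun h => ⟨h.2, h.1⟩, fun ⟨h, h'⟩ => ⟨h', h⟩⟩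
  have hfo : ∀ v, v ≠ j → (fib (ind W Nᶜ) (fun x => ρ x.1) v).iso (fib W ρ v) := fun v hv =>
    fib_ind_iso ρ _ v fun y hy h => hv (hy.symm.trans (hj y h))
  have hrj : (ind (ind W Nᶜ) {x | ρ x.1 ≠ j}).iso (ind W {x | ρ x ≠ j}) :=
    ind_ind _ _ _ fun x => ⟨fun h => ⟨fun h' => h (hj x h'), h⟩, fun ⟨h, h'⟩ => h'⟩
  have hro : ∀ v, (ind (ind W Nᶜ) {x | ρ x.1 ≠ v}).iso (ind W {x | ρ x ≠ v ∧ x ∉ N}) := fun v =>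
    ind_ind _ _ _ fun x => ⟨fun h => ⟨h.2, h.1⟩, fun ⟨h, h'⟩ => ⟨h', h⟩⟩
  have hdj : Dv (ind W {x | ρ x = j ∧ x ∉ N}) (KX.par (fib W ρ j)) := by
    refine mod_dv N _ _ ?_ (fun x h h' => h.2 h') hm hx
    intro x
    refine ⟨fun h => ?_, fun h => ?_⟩
    · by_cases hxN : x ∈ N
      · exact Or.inr hxN
      · exact Or.inl ⟨h, hxN⟩
    · exact h.elim (fun h => h.1) (hj x)
  have hdo : ∀ v, v ≠ j → Dv (ind W {x | ρ x ≠ v ∧ x ∉ N}) (KX.par (ind W {x | ρ x ≠ v})) := by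
    intro v hv
    refine mod_dv N _ _ ?_ (fun x h h' => h.2 h') hm hx
    intro x
    refine ⟨fun h => ?_, fun h => ?_⟩
    · by_cases hxN : x ∈ N
      · exact Or.inr hxN
      · exact Or.inl ⟨h, hxN⟩
    · exact h.elim (fun h => h.1) (fun h e => hv (e.symm.trans (hj x h)))
  rcases hg with ⟨Y, κ, h1, h2, h3⟩ | ⟨LX, LY, v, h1, h2, h3⟩
  · left
    refine ⟨absG Y _ κ j KX, absK (fun a b => ¬ P.adj a b) κ j KX, abs_isq (symm_nadj P) h1 j KX, ?_, ?_⟩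
    · refine red_trans (red_dv (abs_dv _ κ j KX)) (red_trans (red_par_left KX h2) (red_trans (red_mk ?_) hr))
      rw [mk_par, mk_par, add_comm]
    · intro v
      by_cases hv : v = j
      · subst hv
        refine pr_dv (h3 v) (dv_trans (dv_par_right _ (dv_trans (dv_iso hfj) hdj)) (dv_mk ?_))
        rw [mk_par, mk_par, mk_par, abs_fib_self]
        abel
      · refine pr_mk (h3 v) ?_
        rw [mk_par, mk_par, abs_fib _ _ _ _ _ hv, mk_eq.2 (hfo v hv)]
  · right
    by_cases hv : v = j
    · subst hv
      refine ⟨LX.par KX, LY, v, ?_, ?_, ?_⟩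
      · refine red_trans (red_mk ?_) (red_trans (red_par_right KX h1) hr)
        simp only [mk_par]; abel
      · refine pr_dv h2 (dv_trans (dv_par_right _ (dv_trans (dv_iso hfj) hdj)) (dv_mk ?_))
        simp only [mk_par]; abel
      · exact pr_dv h3 (dv_par_right _ (dv_iso hrj))
    · refine ⟨LX, LY.par KX, v, ?_, ?_, ?_⟩
      · refine red_trans (red_mk ?_) (red_trans (red_par_right KX h1) hr)
        simp only [mk_par]; abel
      · exact pr_dv h2 (dv_par_right _ (dv_iso (hfo v hv)))
      · refine pr_dv h3 (dv_trans (dv_par_right _ (dv_trans (dv_iso (hro v)) (hdo v hv))) (dv_mk ?_))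
        simp only [mk_par]; abel

/-- binary splitting -/
theorem goal_two {G W P : LGraph} {ρ : W.V → P.V} (hc : Fintype.card P.V = 2) {a b : P.V}
    (hab : P.adj a b) (h : Goal G W P ρ) :
    ∃ La Lb : LGraph, Red (La.par Lb) G ∧ Pr (La.par (fib W ρ a)) ∧ Pr (Lb.par (fib W ρ b)) := by
  have hne := edge_ne hab
  rcases h with ⟨Y, κ, h1, h2, h3⟩ | ⟨KX, KY, v, h1, h2, h3⟩
  · refine ⟨_, _, red_trans (red_mk ?_) h2, h3 a, h3 b⟩
    have h4 := ind_par (G := Y) Set.univ {x | κ x = a} {x | κ x = b}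
      (fun x => ⟨fun _ => two_cases hc hne (κ x), fun _ => trivial⟩)
      (fun x hx hx' => hne ((show κ x = a from hx).symm.trans hx'))
      (by
        intro x hx y hy
        have hx' : κ x = a := hx
        have hy' : κ y = b := hy
        rw [h1 x y (by rw [hx', hy']; exact hne), hx', hy']
        exact fun h => h hab)
    rw [← mk_eq.2 (ind_all (G := Y) Set.univ fun _ => trivial)]
    exact (mk_eq.2 h4).symm
  · rcases two_cases hc hne v with rfl | rfl
    · refine ⟨KX, KY, h1, h2, pr_dv h3 (dv_par_right _ (dv_iso (ind_eq ?_)))⟩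
      intro x
      rcases two_cases hc hne (ρ x) with e | e
      · simp [e, hne]
      · simp [e, hne.symm]
    · refine ⟨KY, KX, red_trans (red_mk ?_) h1, pr_dv h3 (dv_par_right _ (dv_iso (ind_eq ?_))), h2⟩
      · rw [mk_par, mk_par, add_comm]
      intro x
      rcases two_cases hc hne (ρ x) with e | e
      · simp [e, hne]
      · simp [e, hne.symm]

theorem lemR {G W P : LGraph} {ρ : W.V → P.V} (hP : P.Prime) (he : ∃ a b, P.adj a b)
    (hq : IsQ W P.adj ρ) (hs : Function.Surjective ρ) (N : Set W.V) (hn : N.Nonempty)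
    (hn' : ∃ x, x ∉ N) (hm : W.IsModule N)
    {KX KY : LGraph} (hr : Red (KX.par KY) G) (hx : Pr (KX.par (ind W N)))
    (hy : Pr (KY.par (ind W Nᶜ))) (hsm : Small (sz G + sz W)) : Goal G W P ρ := by
  by_cases hone : ∃ j, ∀ x ∈ N, ρ x = j
  · obtain ⟨j, hj⟩ := hone
    exact lemR1 hP he hq hs N hn hm j hj hr hx hy hsm
  obtain ⟨x0, hx0⟩ := hn'
  rcases isq_module hP he hq hs N hn hm with h | h | ⟨hc, hjoin⟩
  · exact absurd h hone
  · exact absurd (h x0) hx0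
  obtain ⟨a, b, hab⟩ := he
  have hne := edge_ne hab
  push Not at hone
  obtain ⟨xb, hxb, hxb'⟩ := hone a
  obtain ⟨xa, hxa, hxa'⟩ := hone b
  have hxb2 : ρ xb = b := (two_cases hc hne _).resolve_left hxb'
  have hxa2 : ρ xa = a := (two_cases hc hne _).resolve_right hxa'
  have hzr : sz KX + sz KY ≤ sz G := by rw [← sz_par]; exact sz_red hr
  have hs' : Function.Surjective (fun x : (ind W N).V => ρ x.1) := by
    intro v
    rcases two_cases hc hne v with rfl | rfl
    · exact ⟨⟨xa, hxa⟩, hxa2⟩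
    · exact ⟨⟨xb, hxb⟩, hxb2⟩
  have hg := small_goal hsm hx (by have := sz_ind_lt N x0 hx0; omega) hP ⟨a, b, hab⟩ (isq_ind hq _) hs'
  obtain ⟨La, Lb, h1, h2, h3⟩ := goal_two hc hab hg
  have hfa : ∀ v, (fib (ind W N) (fun x => ρ x.1) v).iso (ind W {x | x ∈ N ∧ ρ x = v}) := fun v =>
    ind_ind _ _ _ fun x => ⟨fun h => ⟨h.1, h.2⟩, fun ⟨h, h'⟩ => ⟨h, h'⟩⟩
  have hmod : ∀ v, W.IsModule {x | x ∈ N ∧ ρ x = v} := by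
    intro v z hz x hx y hy
    have hx' : x ∈ N ∧ ρ x = v := hx
    have hy' : y ∈ N ∧ ρ y = v := hy
    by_cases hzN : z ∈ N
    · have hzv : ρ z ≠ v := fun h => hz ⟨hzN, h⟩
      rw [hq z x (by rw [hx'.2]; exact hzv), hq z y (by rw [hy'.2]; exact hzv), hx'.2, hy'.2]
    · exact iff_of_true (hjoin z hzN x hx'.1) (hjoin z hzN y hy'.1)
  refine lemR1 (KX := La) (KY := Lb.par KY) hP ⟨a, b, hab⟩ hq hs {x | x ∈ N ∧ ρ x = a} ⟨xa, hxa, hxa2⟩ (hmod a) a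
    (fun x hx => hx.2) ?_ (pr_dv h2 (dv_par_right _ (dv_iso (hfa a)))) ?_ hsm
  · refine red_trans (red_mk ?_) (red_trans (red_par_left KY h1) hr)
    simp only [mk_par]; abel
  · have hd := mod_dv (KX := Lb) {x | x ∈ N ∧ ρ x = b} {x | x ∈ N ∧ ρ x = a}ᶜ Nᶜ ?_
      (fun x h h' => h h'.1) (hmod b) (pr_dv h3 (dv_par_right _ (dv_iso (hfa b))))
    · refine pr_dv hy (dv_trans (dv_par_right _ hd) (dv_mk ?_))
      simp only [mk_par]; abel
    · intro x
      constructor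
      · intro h
        by_cases hxN : x ∈ N
        · exact Or.inr ⟨hxN, (two_cases hc hne _).resolve_left fun e => h ⟨hxN, e⟩⟩
        · exact Or.inl hxN
      · rintro (h | h) ⟨h1, h2⟩
        · exact h h1
        · exact hne (h2.symm.trans h.2)

theorem pr_left_of_empty {K X : LGraph} (h : Pr (K.par X)) (hX : IsEmpty X.V) : Pr K :=
  pr_mk h (by rw [mk_par, mk_zero hX, add_zero])

theorem lemS {G W P Q Y : LGraph} {ρ : W.V → P.V} (hP : P.Prime) (he : ∃ a b, P.adj a b)
    (hq : IsQ W P.adj ρ) (hs : Function.Surjective ρ) {q : W.V → Q.V} {κ : Y.V → Q.V}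
    (hqQ : IsQ W Q.adj q) (hκ : IsQ Y (fun a b => ¬ Q.adj a b) κ) (hr : Red Y G)
    (hf : ∀ v, Pr ((fib Y κ v).par (fib W q v))) (hall : ∀ v, ∃ x, q x ≠ v)
    (hsm : Small (sz G + sz W)) : Goal G W P ρ := by
  have hfill : Dv (ind Y {y | κ y ∈ Set.range q}) Y := by
    refine fill hκ (Set.range q) fun v hv => pr_left_of_empty (hf v) ?_
    exact fib_empty _ _ fun x hx => hv ⟨x, hx⟩
  by_cases hc : ∀ v, ∃ j, ∀ x, q x = v → ρ x = j
  · choose f hf' using hc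
    left
    refine ⟨ind Y {y | κ y ∈ Set.range q}, fun y => f (κ y.1), ?_, red_trans (red_dv hfill) hr, ?_⟩
    · rintro ⟨y, x, hx⟩ ⟨y', x', hx'⟩ hne
      change f (κ y) ≠ f (κ y') at hne
      have e1 := hf' _ _ hx
      have e2 := hf' _ _ hx'
      change Y.adj y y' ↔ ¬ P.adj (f (κ y)) (f (κ y'))
      have hn2 : κ y ≠ κ y' := fun h => hne (by rw [h])
      rw [hκ y y' hn2, ← hx, ← hx']
      change ¬ Q.adj (q x) (q x') ↔ _
      rw [← hqQ x x' (by rw [hx, hx']; exact hn2),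
        hq x x' (by rw [e1, e2]; exact hne), e1, e2, hx, hx']
    · intro v
      refine lprov (Q := Q) (κ := fun y => κ y.1.1) (q := fun x => q x.1) ?_ (isq_ind hqQ _) ?_
      · exact isq_ind (isq_ind hκ _) _
      intro w
      by_cases hw : w ∈ Set.range q ∧ f w = v
      · obtain ⟨hw1, hw2⟩ := hw
        refine pr_mk (hf w) ?_
        rw [mk_par, mk_par]
        congr 1
        · refine mk_eq.2 (iso_symm (iso_trans (fib_ind_iso (fun y : (ind Y {y | κ y ∈ Set.range q}).V => κ y.1) _ w ?_) ?_))
          · intro y hy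
            change f (κ y.1) = v
            rw [hy]
            exact hw2
          · exact fib_ind_iso _ _ _ fun y hy => by rw [Set.mem_ofPred_eq, hy]; exact hw1
        · refine mk_eq.2 (iso_symm (fib_ind_iso q _ w ?_))
          intro x hx
          exact (hf' w x hx).trans hw2
      · refine pr_zero ⟨?_⟩
        rintro (⟨⟨⟨y, hy1⟩, hy2⟩, hy3⟩ | ⟨⟨x, hx1⟩, hx2⟩)
        · have hy3' : κ y = w := hy3
          have hy2' : f (κ y) = v := hy2
          have hy1' : κ y ∈ Set.range q := hy1
          exact hw ⟨hy3' ▸ hy1', hy3' ▸ hy2'⟩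
        · have hx2' : q x = w := hx2
          have hx1' : ρ x = v := hx1
          exact hw ⟨⟨x, hx2'⟩, (hf' w x hx2').symm.trans hx1'⟩
  · push Not at hc
    obtain ⟨v, hv⟩ := hc
    obtain ⟨j0, -, -⟩ := prime_two hP
    obtain ⟨x0, hx0, -⟩ := hv j0
    obtain ⟨x1, hx1⟩ := hall v
    have hmod := isq_fib_module hqQ v
    rcases isq_module hP he hq hs {x | q x = v} ⟨x0, hx0⟩ hmod with h | h | ⟨-, hjoin⟩
    · obtain ⟨j, hj⟩ := h
      obtain ⟨x, h1, h2⟩ := hv j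
      exact absurd (hj x h1) h2
    · exact absurd (h x1) hx1
    have hadj : ∀ w ∈ Set.range q, w ≠ v → Q.adj w v := by
      rintro w ⟨x, rfl⟩ hw
      have := hjoin x hw x0 hx0
      rw [hqQ x x0 (by rw [hx0]; exact hw), hx0] at this
      exact this
    refine lemR (KX := fib Y κ v) (KY := ind Y {y | κ y ≠ v ∧ κ y ∈ Set.range q}) hP he hq hs
      {x | q x = v} ⟨x0, hx0⟩ ⟨x1, hx1⟩ hmod ?_ (hf v) ?_ hsm
    · refine red_trans (red_mk ?_) (red_trans (red_dv hfill) hr)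
      refine (mk_eq.2 (ind_par _ _ _ ?_ ?_ ?_)).symm
      · intro y
        constructor
        · intro h
          by_cases hy : κ y = v
          · exact Or.inl hy
          · exact Or.inr ⟨hy, h⟩
        · rintro (h | h)
          · rw [Set.mem_ofPred_eq] at h ⊢
            rw [h]
            exact ⟨x0, hx0⟩
          · exact h.2
      · intro y h h'
        exact h'.1 h
      · intro y hy z hz
        have hy' : κ y = v := hy
        rw [hκ y z (by rw [hy']; exact hz.1.symm), hy', not_not]
        exact Q.symm (hadj _ hz.2 hz.1)
    · refine lprov (Q := Q) (κ := fun y => κ y.1) (q := fun x => q x.1) (isq_ind hκ _) (isq_ind hqQ _) ?_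
      intro w
      by_cases hw : w ≠ v ∧ w ∈ Set.range q
      · refine pr_mk (hf w) ?_
        rw [mk_par, mk_par]
        congr 1
        · refine mk_eq.2 (iso_symm (fib_ind_iso κ _ w ?_))
          intro y hy
          rw [Set.mem_ofPred_eq, hy]
          exact hw
        · refine mk_eq.2 (iso_symm (fib_ind_iso q _ w ?_))
          intro x hx h
          exact hw.1 (hx.symm.trans h)
      · refine pr_zero ⟨?_⟩
        rintro (⟨⟨y, hy1⟩, hy2⟩ | ⟨⟨x, hx1⟩, hx2⟩)
        · have hy2' : κ y = w := hy2
          exact hw (hy2' ▸ hy1)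
        · have hx2' : q x = w := hx2
          exact hw ⟨fun h => hx1 (hx2'.trans h), x, hx2'⟩

/-! ### Context reduction -/

theorem plugInd1 {D X : LGraph} (S : Set D.V) (F : Set (D.plug S X).V) (E : Set D.V)
    (hF : ∀ d, (Sum.inl d : (D.plug S X).V) ∈ F ↔ d ∈ E) (hX : ∀ x, (Sum.inr x : (D.plug S X).V) ∈ F) :
    (ind (D.plug S X) F).iso ((ind D E).plug {x | x.1 ∈ S} X) := by
  refine iso_plug_of_emb (((Emb.ind D E).trans (Emb.plugL D S X)).toInd F fun x => (hF _).2 x.2)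
    ((Emb.plugR D S X).toInd F hX) ?_ ?_ ?_
  · intro i j h
    have := congrArg Subtype.val h
    cases this
  · intro i j
    exact Iff.rfl
  · rintro ⟨y | y, hy⟩
    · exact Or.inl ⟨⟨y, (hF y).1 hy⟩, rfl⟩
    · exact Or.inr ⟨y, rfl⟩

theorem plugInd0 {D X : LGraph} (S : Set D.V) (F : Set (D.plug S X).V) (E : Set D.V)
    (hF : ∀ d, (Sum.inl d : (D.plug S X).V) ∈ F ↔ d ∈ E) (hX : ∀ x, (Sum.inr x : (D.plug S X).V) ∉ F) :
    (ind (D.plug S X) F).iso (ind D E) := by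
  refine iso_symm (iso_ind_of_emb ((Emb.ind D E).trans (Emb.plugL D S X)) F ?_)
  rintro (y | y)
  · constructor
    · intro h
      exact ⟨⟨y, (hF y).1 h⟩, rfl⟩
    · rintro ⟨x, hx⟩
      cases hx
      exact (hF _).2 x.2
  · constructor
    · intro h
      exact absurd h (hX y)
    · rintro ⟨x, hx⟩
      cases hx

/-- splitting off a union of components away from the hole -/
theorem plug_closed {D : LGraph} (S T : Set D.V) (hST : ∀ x ∈ S, x ∈ T)
    (hT : ∀ x ∈ T, ∀ y, D.adj x y → y ∈ T) (X : LGraph) :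
    (D.plug S X).iso ((ind D Tᶜ).par ((ind D T).plug {x | x.1 ∈ S} X)) := by
  refine iso_par_of_emb ((Emb.ind D Tᶜ).trans (Emb.plugL D S X))
    (Emb.plug ((Emb.ind D T).trans (Emb.plugL D S X)) (Emb.plugR D S X) ?_ ?_) ?_ ?_ ?_
  · intro i j h; cases h
  · intro i j; exact Iff.rfl
  · rintro i (j | j) h
    · have h' : i.1 = j.1 := Sum.inl_injective h
      exact i.2 (h' ▸ j.2)
    · cases h
  · rintro i (j | j) h
    · exact i.2 (hT j.1 j.2 i.1 (D.symm h))
    · exact i.2 (hST _ h)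
  · rintro (y | y)
    · by_cases hy : y ∈ T
      · exact Or.inr ⟨Sum.inl ⟨y, hy⟩, rfl⟩
      · exact Or.inl ⟨⟨y, hy⟩, rfl⟩
    · exact Or.inr ⟨Sum.inr y, rfl⟩

/-- the class map after filling the hole -/
def plugK {D P : LGraph} (S : Set D.V) (τ : D.V → P.V) (u : P.V) (X : LGraph) : (D.plug S X).V → P.V :=
  Sum.elim τ (fun _ => u)

theorem plugK_isq {D P : LGraph} {S : Set D.V} {τ : D.V → P.V} {u : P.V} (hq : IsQ D P.adj τ)
    (hS : ∀ x, τ x ≠ u → (x ∈ S ↔ P.adj (τ x) u)) (X : LGraph) :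
    IsQ (D.plug S X) P.adj (plugK S τ u X) := by
  rintro (x | x) (y | y) h
  · exact hq x y h
  · exact hS x h
  · exact (hS y (fun e => h e.symm)).trans ⟨P.symm, P.symm⟩
  · exact absurd rfl h

theorem plugK_surj {D P : LGraph} {S : Set D.V} {τ : D.V → P.V} {u : P.V}
    (hs : ∀ v, v ≠ u → ∃ x, τ x = v) {X : LGraph} (hX : Nonempty X.V) :
    Function.Surjective (plugK S τ u X) := by
  intro v
  by_cases hv : v = u
  · obtain ⟨x⟩ := hX
    exact ⟨Sum.inr x, hv.symm⟩
  · obtain ⟨x, hx⟩ := hs v hv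
    exact ⟨Sum.inl x, hx⟩

theorem plugK_fib {D P : LGraph} (S : Set D.V) (τ : D.V → P.V) (u : P.V) (X : LGraph) (v : P.V) (hv : v ≠ u) :
    (fib (D.plug S X) (plugK S τ u X) v).iso (fib D τ v) :=
  plugInd0 S _ _ (fun _ => Iff.rfl) (fun _ h => hv (show u = v from h).symm)

theorem plugK_fib_self {D P : LGraph} (S : Set D.V) (τ : D.V → P.V) (u : P.V) (X : LGraph) :
    (fib (D.plug S X) (plugK S τ u X) u).iso ((fib D τ u).plug {x | x.1 ∈ S} X) :=
  plugInd1 S _ _ (fun _ => Iff.rfl) (fun _ => rfl)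

theorem plugK_rest {D P : LGraph} (S : Set D.V) (τ : D.V → P.V) (u : P.V) (X : LGraph) (v : P.V) (hv : v ≠ u) :
    (ind (D.plug S X) {x | plugK S τ u X x ≠ v}).iso ((ind D {x | τ x ≠ v}).plug {x | x.1 ∈ S} X) :=
  plugInd1 S _ _ (fun _ => Iff.rfl) (fun _ => hv.symm)

theorem plugK_rest_self {D P : LGraph} (S : Set D.V) (τ : D.V → P.V) (u : P.V) (X : LGraph) :
    (ind (D.plug S X) {x | plugK S τ u X x ≠ u}).iso (ind D {x | τ x ≠ u}) :=
  plugInd0 S _ _ (fun _ => Iff.rfl) (fun _ h => h rfl)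

theorem fill_one {W KX : LGraph} {I : Type} {r : I → I → Prop} {ρ : W.V → I} (hq : IsQ W r ρ) (v : I)
    (h : Pr (KX.par (fib W ρ v))) : Dv (ind W {x | ρ x ≠ v}) (KX.par W) := by
  refine dv_trans (mod_dv {x | ρ x = v} Set.univ {x | ρ x ≠ v} ?_ ?_ (isq_fib_module hq v) h)
    (dv_par_right _ (dv_iso (ind_all _ fun _ => trivial)))
  · intro x
    exact ⟨fun _ => (em (ρ x = v)).symm, fun _ => trivial⟩
  · intro x h h'
    exact h h'

theorem lemCR : ∀ (n : ℕ) (D : LGraph) (S : Set D.V) (A : LGraph), sz D + sz A = n → Nonempty A.V →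
    Pr (D.plug S A) → SplitAt (D.plug S A) → Small n →
    ∃ K : LGraph, (∀ X, Red (K.par X) (D.plug S X)) ∧ Pr (K.par A) ∧ (S.Nonempty → sz K < sz D) := by
  intro n
  induction n using Nat.strong_induction_on with
  | _ n ih =>
  intro D S A hn hA hp hsp hsm
  by_cases hS : S.Nonempty
  swap
  · have hS' : ∀ x, x ∉ S := fun x hx => hS ⟨x, hx⟩
    refine ⟨D, fun X => red_dv (dv_iso (par_iso_plug D X S hS')), ?_, fun h => absurd h hS⟩
    exact pr_dv hp (dv_iso (iso_symm (par_iso_plug D A S hS')))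
  have key : ∀ (L E : LGraph) (S' : Set E.V), sz L + sz E < sz D → Pr (L.par (E.plug S' A)) →
      ∃ K : LGraph, (∀ X, Red (K.par X) (L.par (E.plug S' X))) ∧ Pr (K.par A) ∧ sz K < sz D := by
    intro L E S' hz hp'
    have hp2 := pr_dv hp' (dv_iso (par_plug L E S' A))
    have hz2 : sz (L.par E) + sz A < n := by rw [sz_par]; omega
    obtain ⟨K, h1, h2, -⟩ := ih _ hz2 (L.par E) _ A rfl hA hp2 (hsm _ hp2 ((sz_plug _ _ _).trans_lt hz2))
      (small_mono hsm hz2.le)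
    have h1' : ∀ X, Red (K.par X) (L.par (E.plug S' X)) := fun X =>
      red_trans (h1 X) (red_dv (dv_iso (iso_symm (par_plug L E S' X))))
    refine ⟨K, h1', h2, ?_⟩
    have := sz_red (h1' LGraph.empty)
    rw [sz_par, sz_par, sz_plug] at this
    omega
  suffices h : ∃ K : LGraph, (∀ X, Red (K.par X) (D.plug S X)) ∧ Pr (K.par A) ∧ sz K < sz D by
    obtain ⟨K, h1, h2, h3⟩ := h
    exact ⟨K, h1, h2, fun _ => h3⟩
  obtain ⟨s0, hs0⟩ := hS
  obtain ⟨G0, DT, ST, hiso, hszD, hSTn, hconn⟩ : ∃ (G0 DT : LGraph) (ST : Set DT.V),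
      (∀ X, (D.plug S X).iso (G0.par (DT.plug ST X))) ∧ sz D = sz DT + sz G0 ∧ ST.Nonempty ∧
      (∀ T : Set DT.V, (∀ x ∈ ST, x ∈ T) → (∀ x ∈ T, ∀ y, DT.adj x y → y ∈ T) → ∀ x, x ∈ T) :=
    ⟨ind D (reach D S)ᶜ, ind D (reach D S), {x | x.1 ∈ S},
      plug_closed S (reach D S) (reach_sub D S) (reach_closed D S), sz_ind_split D (reach D S),
      ⟨⟨s0, reach_sub D S _ hs0⟩, hs0⟩, reach_conn D S⟩
  obtain ⟨P, τ, u, hP, he, hq, hSu, hsur⟩ := comp_decomp DT ST hSTn hconn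
  have hqX := plugK_isq hq hSu
  have hg := hsp G0 (DT.plug ST A) P (plugK ST τ u A) (iso_symm (hiso A)) hP he (hqX A) (plugK_surj hsur hA)
  obtain ⟨w0, hw0⟩ := prime_nbr hP he u
  obtain ⟨d0, hd0⟩ := hsur w0 (edge_ne hw0).symm
  have hlt1 : sz (fib DT τ u) < sz DT := sz_ind_lt _ d0 fun h =>
    (edge_ne hw0) ((show τ d0 = u from h).symm.trans hd0)
  rcases hg with ⟨Y, κ, h1, h2, h3⟩ | ⟨KX, KY, v, h1, h2, h3⟩
  · have hzY := sz_red h2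
    have hzf : sz (fib Y κ u) ≤ sz Y := sz_ind_le _
    obtain ⟨K, k1, k2, k3⟩ := key (fib Y κ u) (fib DT τ u) {x | x.1 ∈ ST} (by omega)
      (pr_dv (h3 u) (dv_par_right _ (dv_iso (plugK_fib_self ST τ u A))))
    refine ⟨K, fun X => ?_, k2, k3⟩
    refine red_trans (k1 X) (red_trans (red_dv ?_) (red_trans (red_par_left (DT.plug ST X) h2)
      (red_dv (dv_iso (iso_symm (hiso X))))))
    refine dv_trans (dv_par_right _ (dv_iso (iso_symm (plugK_fib_self ST τ u X)))) ?_
    refine lder h1 (hqX X) u fun v hv => pr_dv (h3 v) (dv_par_right _ (dv_iso ?_))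
    exact iso_trans (plugK_fib ST τ u A v hv) (iso_symm (plugK_fib ST τ u X v hv))
  · have hzK := sz_red h1
    rw [sz_par] at hzK
    by_cases hv : v = u
    · subst hv
      obtain ⟨K, k1, k2, k3⟩ := key KX (fib DT τ v) {x | x.1 ∈ ST} (by omega)
        (pr_dv h2 (dv_par_right _ (dv_iso (plugK_fib_self ST τ v A))))
      refine ⟨K, fun X => ?_, k2, k3⟩
      refine red_trans (k1 X) (red_trans (red_dv (dv_par_right _ (dv_iso (iso_symm (plugK_fib_self ST τ v X))))) ?_)
      refine red_trans (red_slot (D := ind (DT.plug ST X) {x | plugK ST τ v X x ≠ v})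
        {y | P.adj (plugK ST τ v X y.1) v} KX _ (KY := KY) ?_) ?_
      · refine pr_dv h3 (dv_par_right _ (dv_iso ?_))
        exact iso_trans (plugK_rest_self ST τ v A) (iso_symm (plugK_rest_self ST τ v X))
      · refine red_trans (red_dv (dv_par_right _ (dv_iso (iso_symm (fib_plug (hqX X) v))))) ?_
        exact red_trans (red_par_left (DT.plug ST X) h1) (red_dv (dv_iso (iso_symm (hiso X))))
    · obtain ⟨x1, hx1⟩ := hsur v hv
      have hlt2 : sz (ind DT {x | τ x ≠ v}) < sz DT := sz_ind_lt _ x1 fun h => h hx1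
      obtain ⟨K, k1, k2, k3⟩ := key KY (ind DT {x | τ x ≠ v}) {x | x.1 ∈ ST} (by omega)
        (pr_dv h3 (dv_par_right _ (dv_iso (plugK_rest ST τ u A v hv))))
      refine ⟨K, fun X => ?_, k2, k3⟩
      refine red_trans (k1 X) (red_trans (red_dv (dv_par_right _ (dv_iso (iso_symm (plugK_rest ST τ u X v hv))))) ?_)
      refine red_trans (red_dv (dv_par_right KY (fill_one (hqX X) v (KX := KX) ?_))) ?_
      · refine pr_dv h2 (dv_par_right _ (dv_iso ?_))
        exact iso_trans (plugK_fib ST τ u A v hv) (iso_symm (plugK_fib ST τ u X v hv))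
      · refine red_trans (red_mk ?_)
          (red_trans (red_par_left (DT.plug ST X) h1) (red_dv (dv_iso (iso_symm (hiso X)))))
        simp only [mk_par]; abel

theorem lemI {G W P D Z Z' : LGraph} {ρ : W.V → P.V} {m : ℕ} (hP : P.Prime) (he : ∃ a b, P.adj a b)
    (hq : IsQ W P.adj ρ) (hs : Function.Surjective ρ) (S : Set D.V) (hS : S.Nonempty) (hZ : Nonempty Z.V)
    (hp : Pr (D.plug S Z)) (hsp : SplitAt (D.plug S Z)) (hsm : Small m) (hz : sz D + sz Z ≤ m)
    (hzz : sz W + sz Z' ≤ sz Z) (hd : Dv Z (W.par Z')) (hd' : Dv (D.plug S Z') G) : Goal G W P ρ := by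
  obtain ⟨K, h1, h2, h3⟩ := lemCR _ D S Z rfl hZ hp hsp (small_mono hsm hz)
  have h3' := h3 hS
  have hp' : Pr ((K.par Z').par W) := pr_dv h2 (dv_trans (dv_par_right _ hd)
    (dv_mk (by simp only [mk_par]; abel)))
  exact goal_mon (small_goal hsm hp' (by rw [sz_par]; omega) hP he hq hs)
    (red_trans (h1 Z') (red_dv hd'))

def Closed (D : LGraph) (U : Set D.V) : Prop := ∀ x ∈ U, ∀ y, D.adj x y → y ∈ U

theorem closed_compl {D : LGraph} {U : Set D.V} (h : Closed D U) : Closed D Uᶜ :=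
  fun x hx y hxy hy => hx (h y hy x (D.symm hxy))

theorem closed_par {D : LGraph} {U : Set D.V} (h : Closed D U) (T T1 T2 : Set D.V)
    (h1 : ∀ x, x ∈ T1 ↔ x ∈ T ∧ x ∈ U) (h2 : ∀ x, x ∈ T2 ↔ x ∈ T ∧ x ∉ U) :
    mk (ind D T) = mk (ind D T1) + mk (ind D T2) := by
  refine mk_eq.2 (ind_par T T1 T2 ?_ ?_ ?_)
  · intro x
    rw [h1, h2]
    tauto
  · intro x hx hx'
    exact ((h2 x).1 hx').2 ((h1 x).1 hx).2
  · intro x hx y hy hxy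
    exact ((h2 y).1 hy).2 (h x ((h1 x).1 hx).2 y hxy)

/-- a connected closed set meeting two classes contains each class it meets -/
theorem closed_classes {D Q P : LGraph} {U : Set D.V} {ρ : (ind D U).V → P.V} (hP : P.Prime)
    (he : ∃ a b, P.adj a b) (hq : IsQ (ind D U) P.adj ρ) (hs : Function.Surjective ρ)
    {τ : D.V → Q.V} (hτ : IsQ D Q.adj τ) (hU : Closed D U) (hone : ∀ v, ∃ x ∈ U, τ x ≠ v)
    (x : D.V) (hx : x ∈ U) (y : D.V) (hy : τ y = τ x) : y ∈ U := by
  obtain ⟨z, hz, hzx⟩ := hone (τ x)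
  by_contra hyU
  have hcl := isq_connected hP he hq hs {d | τ d.1 = τ x} ⟨⟨x, hx⟩, rfl⟩ (by
    rintro ⟨a, ha⟩ ha' ⟨b, hb⟩ hab
    have ha2 : τ a = τ x := ha'
    have hab' : D.adj a b := hab
    change τ b = τ x
    by_contra hbx
    have h1 : D.adj y b := by
      rw [hτ y b (by rw [hy]; exact fun h => hbx h.symm), hy, ← ha2]
      rwa [← hτ a b (by rw [ha2]; exact fun h => hbx h.symm)]
    exact hyU (hU b hb y (D.symm h1)))
  exact hzx (hcl ⟨z, hz⟩)

theorem caseDA {G' D P Q Y : LGraph} {U : Set D.V} {ρ : (ind D U).V → P.V} (hP : P.Prime)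
    (he : ∃ a b, P.adj a b) (hq : IsQ (ind D U) P.adj ρ) (hs : Function.Surjective ρ)
    {τ : D.V → Q.V} {κ : Y.V → Q.V} (hτ : IsQ D Q.adj τ) (hκ : IsQ Y (fun a b => ¬ Q.adj a b) κ)
    (hU : Closed D U) (hr : Red Y G') (hf : ∀ v, Pr ((fib Y κ v).par (fib D τ v)))
    (hoth : ∀ v, (∃ d, τ d ≠ v) ∨ (∃ y, κ y ≠ v)) (hsm : Small (sz G' + sz D)) :
    Goal (G'.par (ind D Uᶜ)) (ind D U) P ρ := by
  have hzU := sz_ind_split D U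
  have hzY := sz_red hr
  by_cases hone : ∃ v, ∀ x ∈ U, τ x = v
  · obtain ⟨v, hv⟩ := hone
    have hsplit : mk (fib D τ v) = mk (ind D U) + mk (fib (ind D Uᶜ) (fun x => τ x.1) v) := by
      have h1 : mk (fib (ind D Uᶜ) (fun x => τ x.1) v) = mk (ind D {x | τ x = v ∧ x ∉ U}) :=
        mk_eq.2 (ind_ind _ _ _ fun x => ⟨fun h => ⟨h.2, h.1⟩, fun ⟨h, h'⟩ => ⟨h', h⟩⟩)
      rw [h1]
      exact closed_par hU _ _ _ (fun x => ⟨fun h => ⟨hv x h, h⟩, fun h => h.2⟩) (fun x => Iff.rfl)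
    have hd := lder (Y := Y) (N := ind D Uᶜ) hκ (isq_ind hτ _) v (fun w hw => pr_dv (hf w)
      (dv_par_right _ (dv_iso (iso_symm (fib_ind_iso τ _ w fun y hy h => hw (hy.symm.trans (hv y h)))))))
    have hp : Pr (((fib Y κ v).par (fib (ind D Uᶜ) (fun x => τ x.1) v)).par (ind D U)) := by
      refine pr_mk (hf v) ?_
      rw [mk_par, mk_par, mk_par, hsplit]
      abel
    have hz : sz (fib Y κ v) + sz (fib D τ v) < sz Y + sz D := by
      have h1 : sz (fib Y κ v) ≤ sz Y := sz_ind_le _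
      have h2 : sz (fib D τ v) ≤ sz D := sz_ind_le _
      rcases hoth v with ⟨d, hd⟩ | ⟨y, hy⟩
      · have : sz (fib D τ v) < sz D := sz_ind_lt _ d hd
        omega
      · have : sz (fib Y κ v) < sz Y := sz_ind_lt _ y hy
        omega
    have hz2 : sz (fib D τ v) = sz (ind D U) + sz (fib (ind D Uᶜ) (fun x => τ x.1) v) := by
      rw [← sz_par]
      exact sz_mk hsplit
    refine goal_mon (small_goal hsm hp ?_ hP he hq hs) (red_trans (red_dv hd) (red_par_left _ hr))
    rw [sz_par]
    omega
  · push Not at hone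
    have ha := closed_classes hP he hq hs hτ hU hone
    have hd := lemJ (Y := Y) (N := ind D Uᶜ) hκ (isq_ind hτ _) {v | ∃ x ∈ U, τ x = v}
      (by
        rintro ⟨n, hn⟩ ⟨x, hx, hxn⟩
        exact hn (ha x hx n hxn.symm))
      (by
        rintro v ⟨x, hx, rfl⟩ ⟨n, hn⟩ hadj
        have hadj' : Q.adj (τ x) (τ n) := hadj
        rw [← hτ x n (edge_ne hadj')] at hadj'
        exact hn (hU x hx n hadj'))
      (by
        intro v hv
        refine pr_dv (hf v) (dv_par_right _ (dv_iso (iso_symm (fib_ind_iso τ _ v fun y hy h => ?_))))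
        exact hv ⟨y, h, hy⟩)
    refine lemS (Q := Q) (Y := ind Y {y | κ y ∈ {v | ∃ x ∈ U, τ x = v}}) (κ := fun y => κ y.1)
      (q := fun x => τ x.1) hP he hq hs (isq_ind hτ _) (isq_ind hκ _)
      (red_trans (red_dv hd) (red_par_left _ hr)) ?_ ?_ ?_
    · intro v
      by_cases hv : ∃ x ∈ U, τ x = v
      · refine pr_mk (hf v) ?_
        rw [mk_par, mk_par]
        congr 1
        · refine mk_eq.2 (iso_symm (fib_ind_iso κ _ v fun y hy => ?_))
          rw [Set.mem_ofPred_eq, hy]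
          exact hv
        · refine mk_eq.2 (iso_symm (fib_ind_iso τ _ v fun y hy => ?_))
          obtain ⟨x, hx, hxv⟩ := hv
          exact ha x hx y (hy.trans hxv.symm)
      · refine pr_zero ⟨?_⟩
        rintro (⟨⟨y, hy1⟩, hy2⟩ | ⟨⟨x, hx1⟩, hx2⟩)
        · have hy2' : κ y = v := hy2
          exact hv (hy2' ▸ hy1)
        · exact hv ⟨x, hx1, hx2⟩
    · intro v
      obtain ⟨x, hx, hxv⟩ := hone v
      exact ⟨⟨x, hx⟩, hxv⟩
    · refine small_mono hsm ?_
      rw [sz_par]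
      omega

theorem caseDB {G' D P Q KX KY : LGraph} {U : Set D.V} {ρ : (ind D U).V → P.V} (hP : P.Prime)
    (he : ∃ a b, P.adj a b) (hq : IsQ (ind D U) P.adj ρ) (hs : Function.Surjective ρ)
    {τ : D.V → Q.V} (hτ : IsQ D Q.adj τ) (hU : Closed D U) (i : Q.V)
    (hr : Red (KX.par KY) G') (hx : Pr (KX.par (fib D τ i))) (hy : Pr (KY.par (ind D {x | τ x ≠ i})))
    (hzx : 0 < sz KX + sz (fib D τ i)) (hzy : 0 < sz KY + sz (ind D {x | τ x ≠ i}))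
    (hsm : Small (sz G' + sz D)) :
    Goal (G'.par (ind D Uᶜ)) (ind D U) P ρ := by
  have hzU := sz_ind_split D U
  have hzK := sz_red hr
  rw [sz_par] at hzK
  have hzi : sz D = sz (fib D τ i) + sz (ind D {x | τ x ≠ i}) := sz_ind_split D {x | τ x = i}
  by_cases hI : ∃ x ∈ U, τ x = i
  · obtain ⟨x0, hx0, hx0i⟩ := hI
    by_cases hone : ∀ x ∈ U, τ x = i
    · have hsplit : mk (fib D τ i) = mk (ind D U) + mk (ind D {x | τ x = i ∧ x ∉ U}) :=
        closed_par hU _ _ _ (fun x => ⟨fun h => ⟨hone x h, h⟩, fun h => h.2⟩) (fun x => Iff.rfl)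
      have hp : Pr ((KX.par (ind D {x | τ x = i ∧ x ∉ U})).par (ind D U)) := by
        refine pr_mk hx ?_
        rw [mk_par, mk_par, mk_par, hsplit]
        abel
      have hz2 : sz (fib D τ i) = sz (ind D U) + sz (ind D {x | τ x = i ∧ x ∉ U}) := by
        rw [← sz_par]
        exact sz_mk hsplit
      refine goal_mon (small_goal hsm hp ?_ hP he hq hs) ?_
      · rw [sz_par]
        omega
      · refine red_trans (red_slot (D := ind D {x | τ x ≠ i}) {x | Q.adj (τ x.1) i} KX
          (ind D {x | τ x = i ∧ x ∉ U}) hy) (red_trans (red_par_left _ hr) (red_dv (dv_par_right _ (dv_iso (iso_symm ?_)))))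
        refine ind_plug _ _ _ _ ?_ ?_ ?_
        · intro x
          constructor
          · intro h
            by_cases hxi : τ x = i
            · exact Or.inr ⟨hxi, h⟩
            · exact Or.inl hxi
          · rintro (h | h)
            · exact fun h' => h (hone x h')
            · exact h.2
        · intro x h h'
          exact h h'.1
        · intro x y hy
          have hy' : τ y = i := hy.1
          rw [hτ x.1 y (by rw [hy']; exact x.2), hy']
          exact Iff.rfl
    · push Not at hone
      obtain ⟨x1, hx1, hx1i⟩ := hone
      have hone : ∀ v, ∃ x ∈ U, τ x ≠ v := by
        intro v
        by_cases hv : v = i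
        · exact ⟨x1, hx1, by rw [hv]; exact hx1i⟩
        · exact ⟨x0, hx0, by rw [hx0i]; exact fun h => hv h.symm⟩
      have ha := closed_classes hP he hq hs hτ hU hone
      refine lemR (KX := KX) (KY := KY.par (ind D Uᶜ)) hP he hq hs {x | τ x.1 = i} ⟨⟨x0, hx0⟩, hx0i⟩
        ⟨⟨x1, hx1⟩, hx1i⟩ (isq_fib_module (isq_ind hτ U) i) ?_ ?_ ?_ (small_mono hsm (by rw [sz_par]; omega))
      · refine red_trans (red_mk ?_) (red_par_left _ hr)
        simp only [mk_par]; abel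
      · refine pr_dv hx (dv_par_right _ (dv_iso (iso_symm (ind_ind _ _ _ ?_))))
        exact fun x => ⟨fun h => ⟨ha x0 hx0 x ((show τ x = i from h).trans hx0i.symm), h⟩, fun ⟨_, h⟩ => h⟩
      · refine pr_mk hy ?_
        have h1 : mk (ind (ind D U) {x | τ x.1 = i}ᶜ) = mk (ind D {x | τ x ≠ i ∧ x ∈ U}) :=
          mk_eq.2 (ind_ind _ _ _ fun x => ⟨fun h => ⟨h.2, h.1⟩, fun ⟨h, h'⟩ => ⟨h', h⟩⟩)
        rw [mk_par, mk_par, mk_par, h1, closed_par hU {x | τ x ≠ i} {x | τ x ≠ i ∧ x ∈ U} Uᶜ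
          (fun x => Iff.rfl) (fun x => ⟨fun h => ⟨fun h' => h (ha x0 hx0 x (h'.trans hx0i.symm)), h⟩, fun h => h.2⟩)]
        abel
  · push Not at hI
    have hsplit : mk (ind D {x | τ x ≠ i}) = mk (ind D U) + mk (ind D {x | τ x ≠ i ∧ x ∉ U}) :=
      closed_par hU _ _ _ (fun x => ⟨fun h => ⟨hI x h, h⟩, fun h => h.2⟩) (fun x => Iff.rfl)
    have hp : Pr ((KY.par (ind D {x | τ x ≠ i ∧ x ∉ U})).par (ind D U)) := by
      refine pr_mk hy ?_
      rw [mk_par, mk_par, mk_par, hsplit]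
      abel
    have hz2 : sz (ind D {x | τ x ≠ i}) = sz (ind D U) + sz (ind D {x | τ x ≠ i ∧ x ∉ U}) := by
      rw [← sz_par]
      exact sz_mk hsplit
    refine goal_mon (small_goal hsm hp ?_ hP he hq hs) ?_
    · rw [sz_par]
      omega
    · have hd := mod_dv (KX := KX) {x | τ x = i} Uᶜ {x | τ x ≠ i ∧ x ∉ U} ?_ (fun x h h' => h.1 h')
        (isq_fib_module hτ i) hx
      · refine red_trans (red_dv (dv_par_right KY hd)) (red_trans (red_mk ?_) (red_par_left _ hr))
        simp only [mk_par]; abel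
      · intro x
        constructor
        · intro h
          by_cases hxi : τ x = i
          · exact Or.inr hxi
          · exact Or.inl ⟨hxi, h⟩
        · rintro (h | h)
          · exact h.2
          · exact fun h' => hI x h' h

/-- the reachable component case of ss -/
theorem caseC {G0 D A P : LGraph} {U : Set D.V} {ρ : (ind D U).V → P.V} (hP : P.Prime)
    (he : ∃ a b, P.adj a b) (hq : IsQ (ind D U) P.adj ρ) (hs : Function.Surjective ρ) (S : Set D.V)
    (hn : S.Nonempty)
    (hc : ∀ T : Set D.V, (∀ x ∈ S, x ∈ T) → (∀ x ∈ T, ∀ y, D.adj x y → y ∈ T) → ∀ x, x ∈ T)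
    (hA : Nonempty A.V) (hU : Closed D U) (hsp : SplitAt (G0.par (D.plug S A)))
    (hsm : Small (sz G0 + sz A + sz D)) :
    Goal ((G0.par A).par (ind D Uᶜ)) (ind D U) P ρ := by
  obtain ⟨Q, τ, u, hQ, heQ, hτ, hSu, hsur⟩ := comp_decomp D S hn hc
  have hg := hsp G0 (D.plug S A) Q (plugK S τ u A) (iso_refl _) hQ heQ (plugK_isq hτ hSu A) (plugK_surj hsur hA)
  have hsm' : Small (sz (G0.par A) + sz D) := by rw [sz_par]; exact hsm
  have hdu : Dv (fib (D.plug S A) (plugK S τ u A) u) ((fib D τ u).par A) :=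
    dv_trans (dv_iso (plugK_fib_self S τ u A)) (dv_ss _ _ _)
  obtain ⟨w0, hw0⟩ := prime_nbr hQ heQ u
  obtain ⟨d0, hd0⟩ := hsur w0 (edge_ne hw0).symm
  have hd0u : τ d0 ≠ u := by rw [hd0]; exact (edge_ne hw0).symm
  obtain ⟨a0⟩ := hA
  rcases hg with ⟨Y, κ, h1, h2, h3⟩ | ⟨KX, KY, v, h1, h2, h3⟩
  · refine caseDA (Y := absG Y _ κ u A) (κ := absK (fun a b => ¬ Q.adj a b) κ u A) hP he hq hs hτ
      (abs_isq (symm_nadj Q) h1 u A) hU (red_trans (red_dv (abs_dv _ κ u A)) (red_par_left A h2)) ?_ ?_ hsm'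
    · intro v
      by_cases hv : v = u
      · subst hv
        refine pr_dv (h3 v) (dv_trans (dv_par_right _ hdu) (dv_mk ?_))
        rw [mk_par, mk_par, mk_par, abs_fib_self]
        abel
      · refine pr_mk (h3 v) ?_
        rw [mk_par, mk_par, abs_fib _ _ _ _ _ hv, mk_eq.2 (plugK_fib S τ u A v hv)]
    · intro v
      by_cases hv : v = u
      · subst hv
        exact Or.inl ⟨d0, hd0u⟩
      · exact Or.inr ⟨Sum.inr a0, fun h => hv (show u = v from h).symm⟩
  · by_cases hv : v = u
    · subst hv
      refine caseDB (KX := KX.par A) (KY := KY) hP he hq hs hτ hU v ?_ ?_ ?_ ?_ ?_ hsm'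
      · refine red_trans (red_mk ?_) (red_par_left A h1)
        simp only [mk_par]; abel
      · refine pr_dv h2 (dv_trans (dv_par_right _ hdu) (dv_mk ?_))
        simp only [mk_par]; abel
      · exact pr_dv h3 (dv_par_right _ (dv_iso (plugK_rest_self S τ v A)))
      · have := sz_pos (G := A) ⟨a0⟩
        rw [sz_par]
        omega
      · have : 0 < sz (ind D {x | τ x ≠ v}) := sz_pos ⟨⟨d0, hd0u⟩⟩
        omega
    · obtain ⟨x1, hx1⟩ := hsur v hv
      refine caseDB (KX := KX) (KY := KY.par A) hP he hq hs hτ hU v ?_ ?_ ?_ ?_ ?_ hsm'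
      · refine red_trans (red_mk ?_) (red_par_left A h1)
        simp only [mk_par]; abel
      · exact pr_dv h2 (dv_par_right _ (dv_iso (plugK_fib S τ u A v hv)))
      · refine pr_dv h3 (dv_trans (dv_par_right _ (dv_trans (dv_iso (plugK_rest S τ u A v hv)) (dv_ss _ _ _))) (dv_mk ?_))
        simp only [mk_par]; abel
      · have : 0 < sz (fib D τ v) := sz_pos ⟨⟨x1, hx1⟩⟩
        omega
      · have := sz_pos (G := A) ⟨a0⟩
        rw [sz_par]
        omega

theorem goal_reduce {G G1 W W1 P : LGraph} {ρ : W.V → P.V} (e : W1.iso W) (hr : Red G1 G)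
    (hq : IsQ W P.adj ρ) (hs : Function.Surjective ρ)
    (h : ∀ ρ1 : W1.V → P.V, IsQ W1 P.adj ρ1 → Function.Surjective ρ1 → Goal G1 W1 P ρ1) :
    Goal G W P ρ := by
  obtain ⟨e⟩ := e
  refine goal_iso e (goal_mon (h _ ?_ ?_) hr)
  · intro x y hxy
    rw [e.adj_iff]
    exact hq _ _ hxy
  · exact hs.comp e.toEquiv.surjective

theorem caseB {D A P : LGraph} {U : Set D.V} {ρ : (ind D U).V → P.V} (hP : P.Prime)
    (he : ∃ a b, P.adj a b) (hq : IsQ (ind D U) P.adj ρ) (hs : Function.Surjective ρ) (S : Set D.V)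
    (hn : S.Nonempty) (hA : Nonempty A.V) (hU : Closed D U) (hsp : SplitAt (D.plug S A))
    (hsm : Small (sz D + sz A)) :
    Goal ((ind D Uᶜ).par A) (ind D U) P ρ := by
  by_cases hSU : ∃ x ∈ S, x ∈ U
  swap
  · push Not at hSU
    have hiso := plug_closed S Uᶜ hSU (closed_compl hU) A
    have hg := hsp ((ind D Uᶜ).plug {x | x.1 ∈ S} A) (ind D U) P ρ (by
      refine iso_symm (iso_trans hiso (mk_eq.1 ?_))
      rw [mk_par, mk_par, compl_compl, add_comm]) hP he hq hs
    exact goal_mon hg (red_dv (dv_ss _ _ _))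
  obtain ⟨s0, hs0, hs0U⟩ := hSU
  have hUT : ∀ x ∈ U, x ∈ reach D S := by
    intro x hx
    exact isq_connected hP he hq hs {d | d.1 ∈ reach D S} ⟨⟨s0, hs0U⟩, reach_sub D S _ hs0⟩
      (fun a ha b hab => reach_closed D S a.1 ha b.1 hab) ⟨x, hx⟩
  have hiso := plug_closed S (reach D S) (reach_sub D S) (reach_closed D S) A
  have hzT := sz_ind_split D (reach D S)
  refine goal_reduce (W1 := ind (ind D (reach D S)) {x | x.1 ∈ U})
    (G1 := ((ind D (reach D S)ᶜ).par A).par (ind (ind D (reach D S)) {x | x.1 ∈ U}ᶜ)) ?_ (red_mk ?_) hq hs ?_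
  · exact ind_ind _ _ _ fun x => ⟨fun h => ⟨hUT x h, h⟩, fun ⟨_, h⟩ => h⟩
  · have h1 : mk (ind (ind D (reach D S)) {x | x.1 ∈ U}ᶜ) = mk (ind D {x | x ∉ U ∧ x ∈ reach D S}) :=
      mk_eq.2 (ind_ind _ _ _ fun x => ⟨fun h => ⟨h.2, h.1⟩, fun ⟨h, h'⟩ => ⟨h', h⟩⟩)
    rw [mk_par, mk_par, mk_par, h1, closed_par (U := reach D S) (reach_closed D S) Uᶜ
      {x | x ∉ U ∧ x ∈ reach D S} (reach D S)ᶜ (fun x => Iff.rfl)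
      (fun x => ⟨fun h => ⟨fun h' => h (hUT x h'), h⟩, fun h => h.2⟩)]
    abel
  · intro ρ1 hq1 hs1
    refine caseC hP he hq1 hs1 {x | x.1 ∈ S} ⟨⟨s0, reach_sub D S _ hs0⟩, hs0⟩ (reach_conn D S) hA
      (fun x hx y hxy => hU x.1 hx y.1 hxy) (splitAt_iso hsp hiso) (small_mono hsm ?_)
    omega

theorem par_ind {G H : LGraph} (F : Set (G.par H).V) (E1 : Set G.V) (E2 : Set H.V)
    (h1 : ∀ x, (Sum.inl x : (G.par H).V) ∈ F ↔ x ∈ E1) (h2 : ∀ x, (Sum.inr x : (G.par H).V) ∈ F ↔ x ∈ E2) :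
    mk (ind (G.par H) F) = mk (ind G E1) + mk (ind H E2) := by
  refine mk_eq.2 (iso_par_of_emb (((Emb.ind G E1).trans (Emb.parL G H)).toInd F fun x => (h1 _).2 x.2)
    (((Emb.ind H E2).trans (Emb.parR G H)).toInd F fun x => (h2 _).2 x.2) ?_ ?_ ?_)
  · intro i j h
    have := congrArg Subtype.val h
    cases this
  · intro i j h
    exact h
  · rintro ⟨y | y, hy⟩
    · exact Or.inl ⟨⟨y, (h1 y).1 hy⟩, rfl⟩
    · exact Or.inr ⟨⟨y, (h2 y).1 hy⟩, rfl⟩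

theorem mk_all {G : LGraph} (S : Set G.V) (h : ∀ x, x ∈ S) : mk (ind G S) = mk G := mk_eq.2 (ind_all S h)
theorem mk_none {G : LGraph} (S : Set G.V) (h : ∀ x, x ∉ S) : mk (ind G S) = 0 := mk_zero ⟨fun x => h x.1 x.2⟩

/-- A connected part of a par lies on one side. -/
theorem conn_side {G H P : LGraph} {U : Set (G.par H).V} {ρ : (ind (G.par H) U).V → P.V} (hP : P.Prime)
    (he : ∃ a b, P.adj a b) (hq : IsQ (ind (G.par H) U) P.adj ρ) (hs : Function.Surjective ρ) :
    (∀ x, (Sum.inl x : (G.par H).V) ∉ U) ∨ (∀ x, (Sum.inr x : (G.par H).V) ∉ U) := by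
  by_contra hcon
  push Not at hcon
  obtain ⟨⟨x, hx⟩, ⟨y, hy⟩⟩ := hcon
  have := isq_connected hP he hq hs {d | Sum.isLeft d.1 = true} ⟨⟨Sum.inl x, hx⟩, rfl⟩ (by
    rintro ⟨a | a, ha⟩ h1 ⟨b | b, hb⟩ h
    · rfl
    · exact h.elim
    · exact h.elim
    · exact h1) ⟨Sum.inr y, hy⟩
  cases this

theorem caseSS {C A B P : LGraph} {U : Set (B.par A).V} {ρ : (ind (B.par A) U).V → P.V} (hP : P.Prime)
    (he : ∃ a b, P.adj a b) (hq : IsQ (ind (B.par A) U) P.adj ρ) (hs : Function.Surjective ρ) (S : Set B.V)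
    (hn : S.Nonempty) (hA : Nonempty A.V) (hU : Closed (B.par A) U) (hp : Pr (C.par (B.plug S A)))
    (hsp : SplitAt (C.par (B.plug S A))) (hsm : Small (sz C + sz (B.par A))) :
    Goal (C.par (ind (B.par A) Uᶜ)) (ind (B.par A) U) P ρ := by
  have hsp' := splitAt_iso hsp (par_plug C B S A)
  have hp' := pr_dv hp (dv_iso (par_plug C B S A))
  rw [sz_par] at hsm
  obtain ⟨s0, hs0⟩ := hn
  have hS' : Set.Nonempty (fun x => Sum.elim (fun _ => False) (fun d => d ∈ S) x : Set (C.par B).V) := ⟨Sum.inr s0, hs0⟩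
  have hm1 := par_ind U {b | (Sum.inl b : (B.par A).V) ∈ U} {b | (Sum.inr b : (B.par A).V) ∈ U}
    (fun _ => Iff.rfl) (fun _ => Iff.rfl)
  have hm2 := par_ind Uᶜ {b | (Sum.inl b : (B.par A).V) ∉ U} {b | (Sum.inr b : (B.par A).V) ∉ U}
    (fun _ => Iff.rfl) (fun _ => Iff.rfl)
  rcases conn_side hP he hq hs with hl | hr
  · rw [mk_none {b | (Sum.inl b : (B.par A).V) ∈ U} hl, zero_add] at hm1
    rw [mk_all {b | (Sum.inl b : (B.par A).V) ∉ U} hl] at hm2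
    have hcl : Closed A {b | (Sum.inr b : (B.par A).V) ∈ U} := fun x hx y hxy => hU (Sum.inr x) hx (Sum.inr y) hxy
    have hmA := closed_par hcl Set.univ {b | (Sum.inr b : (B.par A).V) ∈ U} {b | (Sum.inr b : (B.par A).V) ∉ U}
      (fun x => ⟨fun h => ⟨trivial, h⟩, fun h => h.2⟩) (fun x => ⟨fun h => ⟨trivial, h⟩, fun h => h.2⟩)
    rw [mk_all Set.univ (fun _ => trivial), ← hm1] at hmA
    have hzA := sz_mk (hmA.trans (mk_par _ _).symm)
    rw [sz_par] at hzA
    refine lemI (Z := A) (Z' := ind A {b | (Sum.inr b : (B.par A).V) ∉ U}) hP he hq hs _ hS' hA hp' hsp' hsm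
      (le_of_eq ?_) hzA.ge (dv_mk hmA) (dv_trans (dv_ss _ _ _) (dv_mk ?_))
    · rw [sz_par]; omega
    · rw [mk_par, mk_par, mk_par, hm2]
      abel
  · rw [mk_none {b | (Sum.inr b : (B.par A).V) ∈ U} hr, add_zero] at hm1
    rw [mk_all {b | (Sum.inr b : (B.par A).V) ∉ U} hr] at hm2
    have e1 := par_ind (G := C) (H := B) {x | Sum.elim (fun _ => False) (fun b => (Sum.inl b : (B.par A).V) ∈ U) x}
      {x | False} {b | (Sum.inl b : (B.par A).V) ∈ U} (fun _ => Iff.rfl) (fun _ => Iff.rfl)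
    have e2 := par_ind (G := C) (H := B) {x | Sum.elim (fun _ => False) (fun b => (Sum.inl b : (B.par A).V) ∈ U) x}ᶜ
      {x | ¬ False} {b | (Sum.inl b : (B.par A).V) ∉ U} (fun _ => Iff.rfl) (fun _ => Iff.rfl)
    rw [mk_none {x : C.V | False} (fun x h => h), zero_add, ← hm1] at e1
    rw [mk_all {x : C.V | ¬ False} (fun x h => h)] at e2
    refine goal_reduce (mk_eq.1 e1) (G1 := (ind (C.par B) {x | Sum.elim (fun _ => False) (fun b => (Sum.inl b : (B.par A).V) ∈ U) x}ᶜ).par A)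
      (red_mk ?_) hq hs ?_
    · rw [mk_par, mk_par, e2, hm2]
      abel
    · intro ρ1 hq1 hs1
      refine caseB hP he hq1 hs1 _ hS' hA ?_ hsp' (small_mono hsm (le_of_eq ?_))
      · rintro (x | x) hx (y | y) hxy
        · exact hx.elim
        · exact hx.elim
        · exact hxy.elim
        · exact hU (Sum.inl x) hx (Sum.inl y) hxy
      · rw [sz_par]; omega

/-! ### Tensors -/

def K2 : LGraph where
  V := Bool
  adj a b := a ≠ b
  symm h := h.symm
  irrefl _ h := h rfl
  label _ := (0, true)

theorem bool_sets (M : Set Bool) : M = ∅ ∨ (∃ v, M = {v}) ∨ M = Set.univ := by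
  by_cases h1 : true ∈ M <;> by_cases h2 : false ∈ M
  · exact Or.inr (Or.inr (Set.ext fun x => by cases x <;> simp [h1, h2]))
  · exact Or.inr (Or.inl ⟨true, Set.ext fun x => by cases x <;> simp [h1, h2]⟩)
  · exact Or.inr (Or.inl ⟨false, Set.ext fun x => by cases x <;> simp [h1, h2]⟩)
  · exact Or.inl (Set.ext fun x => by cases x <;> simp [h1, h2])

theorem K2_prime : K2.Prime :=
  ⟨le_of_eq (show 2 = Fintype.card Bool from rfl), fun M _ => bool_sets M⟩

theorem tensor_split {C X Z : LGraph} (hX : Nonempty X.V) (hZ : Nonempty Z.V)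
    (hsp : SplitAt (C.par (X.tensor Z))) :
    ∃ La Lb : LGraph, Red (La.par Lb) C ∧ Pr (La.par X) ∧ Pr (Lb.par Z) := by
  let ρ : (X.tensor Z).V → K2.V := Sum.elim (fun _ => true) (fun _ => false)
  have hg := hsp C (X.tensor Z) K2 ρ (iso_refl _) K2_prime ⟨true, false, Bool.noConfusion⟩
    (by
      rintro (x | x) (y | y) h
      · exact absurd rfl h
      · exact iff_of_true trivial h
      · exact iff_of_true trivial h
      · exact absurd rfl h)
    (by
      obtain ⟨x⟩ := hX
      obtain ⟨z⟩ := hZ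
      intro b
      cases b
      · exact ⟨Sum.inr z, rfl⟩
      · exact ⟨Sum.inl x, rfl⟩)
  obtain ⟨La, Lb, h1, h2, h3⟩ := goal_two (P := K2) (a := true) (b := false) (show Fintype.card Bool = 2 from rfl)
    Bool.noConfusion hg
  refine ⟨La, Lb, h1, pr_dv h2 (dv_par_right _ (dv_iso (iso_symm ?_))), pr_dv h3 (dv_par_right _ (dv_iso (iso_symm ?_)))⟩
  · refine iso_ind_of_emb (Emb.tenL X Z) _ ?_
    rintro (y | y)
    · exact iff_of_true rfl ⟨y, rfl⟩
    · refine iff_of_false (fun h => Bool.noConfusion (show false = true from h)) ?_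
      rintro ⟨x, hx⟩
      cases hx
  · refine iso_ind_of_emb (Emb.tenR X Z) _ ?_
    rintro (y | y)
    · refine iff_of_false (fun h => Bool.noConfusion (show true = false from h)) ?_
      rintro ⟨x, hx⟩
      cases hx
    · exact iff_of_true rfl ⟨y, rfl⟩

theorem lemMT : ∀ (n : ℕ) (C : LGraph) (Z : Fin n → LGraph), (∀ i, Nonempty (Z i).V) →
    Pr (C.par (bigTensor n Z)) → SplitAt (C.par (bigTensor n Z)) → Small (sz C + sz (bigTensor n Z)) →
    ∃ K : Fin n → LGraph, Red (bigPar n K) C ∧ ∀ i, Pr ((K i).par (Z i)) := by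
  intro n
  induction n with
  | zero =>
    intro C Z _ hp _ _
    refine ⟨fun _ => LGraph.empty, ⟨C, ∅, pr_mk hp ?_, dv_iso (iso_symm (plug_empty C ∅))⟩, fun i => i.elim0⟩
    rw [mk_par]
    exact add_zero _
  | succ n ih =>
    intro C Z hZ hp hsp hsm
    rcases n with _ | n
    · have hmk : mk (bigTensor 1 Z) = mk (Z 0) := by
        refine mk_eq.2 (iso_symm (iso_of_emb (Emb.tenL _ _) ?_))
        rintro (y | y)
        · exact ⟨y, rfl⟩
        · exact y.elim
      refine ⟨fun _ => C, red_mk (by change mk (C.par LGraph.empty) = mk C; rw [mk_par, mk_empty, add_zero]), fun i => pr_mk hp ?_⟩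
      rw [mk_par, mk_par, hmk, show i = 0 from Subsingleton.elim (α := Fin 1) i 0]
    · have hne : Nonempty (bigTensor (n + 1) fun i => Z i.succ).V := by
        obtain ⟨z⟩ := hZ (Fin.succ 0)
        exact ⟨Sum.inl z⟩
      obtain ⟨La, Lb, h1, h2, h3⟩ := tensor_split (hZ 0) hne hsp
      have hz1 := sz_red h1
      rw [sz_par] at hz1
      have hz2 : sz (bigTensor (n + 1 + 1) Z) = sz (Z 0) + sz (bigTensor (n + 1) fun i => Z i.succ) := sz_tensor _ _
      have hz3 := sz_pos (hZ 0)
      obtain ⟨K, k1, k2⟩ := ih Lb (fun i => Z i.succ) (fun i => hZ i.succ) h3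
        (hsm _ h3 (by rw [sz_par]; omega)) (small_mono hsm (by omega))
      refine ⟨Fin.cons La K, red_trans (red_par_right La k1) h1, fun i => ?_⟩
      refine Fin.cases ?_ (fun i => ?_) i
      · exact h2
      · exact k2 i

theorem comp_fib (P : LGraph) (F : P.V → LGraph) (v : P.V) :
    mk (fib (P.comp F) Sigma.fst v) = mk (F v) := by
  refine mk_eq.2 (iso_symm (iso_ind_of_emb (A := F v) (G := P.comp F)
    ⟨fun x => ⟨v, x⟩, ?_, ?_, fun x => rfl⟩ _ ?_))
  · intro x y h
    exact eq_of_heq (Sigma.mk.inj h).2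
  · intro x y
    constructor
    · intro h
      exact Or.inl ⟨v, x, y, rfl, rfl, h⟩
    · rintro (⟨w, a, b, h1, h2, h⟩ | ⟨h, _⟩)
      · cases h1
        cases h2
        exact h
      · exact absurd rfl h
  · rintro ⟨w, y⟩
    constructor
    · intro h
      cases h
      exact ⟨y, rfl⟩
    · rintro ⟨x, hx⟩
      cases hx
      rfl

theorem absP {Q C Y0 W : LGraph} {n : ℕ} (e : Q.V ≃ Fin n) {F H K : Fin n → LGraph} {κ0 : Y0.V → Q.V}
    {q : W.V → Q.V} (hκ : IsQ Y0 (fun a b => ¬ Q.adj a b) κ0)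
    (h1 : ∀ v, mk (fib Y0 κ0 v) = mk (F (e v))) (h2 : ∀ v, mk (fib W q v) = mk (H (e v)))
    (hr : Red (bigPar n K) C) (hp : ∀ i, Pr ((K i).par ((F i).par (H i)))) :
    ∃ (Y : LGraph) (κ : Y.V → Q.V), IsQ Y (fun a b => ¬ Q.adj a b) κ ∧ Red Y (C.par Y0) ∧
      (∀ v, Pr ((fib Y κ v).par (fib W q v))) ∧ ∀ v, mk (fib Y κ v) = mk (F (e v)) + mk (K (e v)) := by
  obtain ⟨Y, κ, y1, y2, y3, -⟩ := abs_many (symm_nadj Q) n K e.symm e.symm.injective Y0 κ0 hκ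
  have y4 : ∀ v, mk (fib Y κ v) = mk (F (e v)) + mk (K (e v)) := by
    intro v
    have := y3 (e v)
    rw [e.symm_apply_apply, h1] at this
    exact this
  refine ⟨Y, κ, y1, ?_, fun v => pr_mk (hp (e v)) ?_, y4⟩
  · refine red_trans (red_dv y2) (red_trans (red_par_right _ hr) (red_mk ?_))
    rw [mk_par, mk_par, add_comm]
  · rw [mk_par, mk_par, mk_par, y4, h2]
    abel

theorem casePcore {C P Q X Z : LGraph} {n : ℕ} (e : Q.V ≃ Fin n) {M N K : Fin n → LGraph} (hQ : Q.Prime) (hn : 4 ≤ n)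
    {σ : X.V → Q.V} {τ : Z.V → Q.V} (hσ : IsQ X (fun a b => ¬ Q.adj a b) σ) (hσs : Function.Surjective σ)
    (hτ : IsQ Z Q.adj τ) (h1 : ∀ v, mk (fib X σ v) = mk (M (e v))) (h2 : ∀ v, mk (fib Z τ v) = mk (N (e v)))
    {U : Set (X.par Z).V} {ρ : (ind (X.par Z) U).V → P.V} (hP : P.Prime)
    (he : ∃ a b, P.adj a b) (hq : IsQ (ind (X.par Z) U) P.adj ρ) (hs : Function.Surjective ρ)
    (hU : Closed (X.par Z) U) (hr : Red (bigPar n K) C) (hk : ∀ i, Pr ((K i).par ((M i).par (N i))))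
    (hsm : Small (sz C + sz (X.par Z))) :
    Goal (C.par (ind (X.par Z) Uᶜ)) (ind (X.par Z) U) P ρ := by
  have hcard : 4 ≤ Fintype.card Q.V := by
    rw [Fintype.card_congr e, Fintype.card_fin]; exact hn
  have hother : ∀ v : Q.V, ∃ x, σ x ≠ v := by
    intro v
    obtain ⟨a, b, hab⟩ := prime_two hQ
    obtain ⟨x, hx⟩ := hσs a
    obtain ⟨y, hy⟩ := hσs b
    by_cases h : a = v
    · exact ⟨y, fun h' => hab (h.trans (h'.symm.trans hy))⟩
    · exact ⟨x, fun h' => h (hx.symm.trans h')⟩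
  have hm1 := par_ind U {b | (Sum.inl b : (X.par Z).V) ∈ U} {b | (Sum.inr b : (X.par Z).V) ∈ U}
    (fun _ => Iff.rfl) (fun _ => Iff.rfl)
  have hm2 := par_ind Uᶜ {b | (Sum.inl b : (X.par Z).V) ∉ U} {b | (Sum.inr b : (X.par Z).V) ∉ U}
    (fun _ => Iff.rfl) (fun _ => Iff.rfl)
  have hσ' : IsQ X Q.dual.adj (σ : X.V → Q.dual.V) :=
    isq_congr (I := Q.V) (r' := Q.dual.adj) hσ fun a b hab => ⟨fun h => ⟨hab, h⟩, fun h => h.2⟩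
  have hτ' : IsQ Z (fun a b => ¬ Q.dual.adj a b) (τ : Z.V → Q.dual.V) :=
    isq_congr (I := Q.V) (r' := fun a b => ¬ Q.dual.adj a b) hτ fun a b hab =>
      ⟨fun h h' => h'.2 h, fun h => by
        by_contra h'
        exact h ⟨hab, h'⟩⟩
  rw [sz_par] at hsm
  rcases conn_side hP he hq hs with hl | hr'
  · rw [mk_none {b | (Sum.inl b : (X.par Z).V) ∈ U} hl, zero_add] at hm1
    rw [mk_all {b | (Sum.inl b : (X.par Z).V) ∉ U} hl] at hm2
    obtain ⟨Y, κ, y1, y2, y3, y4⟩ := absP e hσ h1 h2 hr hk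
    refine goal_reduce (mk_eq.1 hm1.symm)
      (G1 := (C.par X).par (ind Z {b | (Sum.inr b : (X.par Z).V) ∈ U}ᶜ)) (red_mk ?_) hq hs ?_
    · rw [mk_par, mk_par, mk_par, hm2, add_assoc]
      rfl
    · intro ρ1 hq1 hs1
      refine caseDA hP he hq1 hs1 hτ y1 (fun x hx y hxy => hU (Sum.inr x) hx (Sum.inr y) hxy) y2 y3 ?_
        (small_mono hsm (by rw [sz_par]; omega))
      intro v
      obtain ⟨x, hx⟩ := hother v
      right
      have hz : sz (fib Y κ (σ x)) = sz (fib X σ (σ x)) + sz (K (e (σ x))) := by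
        have := sz_mk ((y4 (σ x)).trans ((congrArg (· + mk (K (e (σ x)))) (h1 (σ x)).symm).trans (mk_par _ _).symm))
        rw [sz_par] at this
        exact this
      have hpos : 0 < sz (fib X σ (σ x)) := sz_pos ⟨⟨x, rfl⟩⟩
      have : Nonempty (fib Y κ (σ x)).V := by
        by_contra hcon
        rw [not_nonempty_iff] at hcon
        have : sz (fib Y κ (σ x)) = 0 := Nat.card_eq_zero.2 (Or.inl hcon)
        omega
      obtain ⟨y, hy⟩ := this
      exact ⟨y, fun h => hx ((show κ y = σ x from hy).symm.trans h)⟩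
  · have hdp := prime_dual hQ
    have hde := prime_edge hdp (show 3 ≤ Fintype.card Q.V by omega)
    obtain ⟨w0⟩ : Nonempty (ind (X.par Z) U).V := by
      obtain ⟨a, _⟩ := he
      obtain ⟨x, _⟩ := hs a
      exact ⟨x⟩
    have hne : ∃ x, (Sum.inl x : (X.par Z).V) ∈ U := by
      obtain ⟨x | x, hx⟩ := w0
      · exact ⟨x, hx⟩
      · exact absurd hx (hr' x)
    have hall : ∀ x, (Sum.inl x : (X.par Z).V) ∈ U :=
      isq_connected hdp hde hσ' hσs {b | (Sum.inl b : (X.par Z).V) ∈ U} hne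
        (fun x hx y hxy => hU (Sum.inl x) hx (Sum.inl y) hxy)
    rw [mk_none {b | (Sum.inr b : (X.par Z).V) ∈ U} hr', add_zero,
      mk_all {b | (Sum.inl b : (X.par Z).V) ∈ U} hall] at hm1
    rw [mk_all {b | (Sum.inr b : (X.par Z).V) ∉ U} hr',
      mk_none {b | (Sum.inl b : (X.par Z).V) ∉ U} (fun x h => h (hall x)), zero_add] at hm2
    obtain ⟨Y, κ, y1, y2, y3, y4⟩ := absP (Q := Q.dual) (F := N) (H := M) e hτ' h2 h1 hr
      (fun i => pr_mk (hk i) (by rw [mk_par, mk_par, mk_par, mk_par]; abel))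
    refine goal_reduce (mk_eq.1 hm1.symm) (G1 := C.par Z) (red_mk ?_) hq hs ?_
    · rw [mk_par, mk_par, hm2]
    · intro ρ1 hq1 hs1
      exact lemS hP he hq1 hs1 hσ' y1 y2 y3 hother (small_mono hsm (by rw [sz_par]; omega))

theorem caseP {C P P' : LGraph} {n : ℕ} (e : P'.V ≃ Fin n) (M N : Fin n → LGraph) (hP' : P'.Prime) (hn : 4 ≤ n)
    (hM : ∀ i, Nonempty (M i).V)
    {U : Set ((P'.dual.comp fun v => M (e v)).par (P'.comp fun v => N (e v))).V}
    {ρ : (ind ((P'.dual.comp fun v => M (e v)).par (P'.comp fun v => N (e v))) U).V → P.V} (hP : P.Prime)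
    (he : ∃ a b, P.adj a b)
    (hq : IsQ (ind ((P'.dual.comp fun v => M (e v)).par (P'.comp fun v => N (e v))) U) P.adj ρ)
    (hs : Function.Surjective ρ)
    (hU : Closed ((P'.dual.comp fun v => M (e v)).par (P'.comp fun v => N (e v))) U)
    (hp : Pr (C.par (bigTensor n fun i => (M i).par (N i))))
    (hsp : SplitAt (C.par (bigTensor n fun i => (M i).par (N i))))
    (hsm : Small (sz C + sz ((P'.dual.comp fun v => M (e v)).par (P'.comp fun v => N (e v))))) :
    Goal (C.par (ind ((P'.dual.comp fun v => M (e v)).par (P'.comp fun v => N (e v))) Uᶜ))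
      (ind ((P'.dual.comp fun v => M (e v)).par (P'.comp fun v => N (e v))) U) P ρ := by
  have hzr := sz_rule (GSRule.p n P' e M N hP' hn hM)
  obtain ⟨K, k1, k2⟩ := lemMT n C _ (fun i => by obtain ⟨x⟩ := hM i; exact ⟨Sum.inl x⟩) hp hsp
    (small_mono hsm (by omega))
  have hqM : IsQ (P'.dual.comp fun v => M (e v)) (I := P'.V) (fun a b => ¬ P'.adj a b) Sigma.fst :=
    isq_congr (comp_isq P'.dual (fun v => M (e v))) fun a b hab => ⟨fun h => h.2, fun h => ⟨hab, h⟩⟩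
  refine casePcore e hP' hn hqM ?_ (comp_isq P' _) (comp_fib P'.dual _) (comp_fib P' _) hP he hq hs hU k1 k2 hsm
  intro v
  obtain ⟨x⟩ := hM (e v)
  exact ⟨⟨v, x⟩, rfl⟩

theorem case3 {p c C P : LGraph} (h : GSRule p c) {U : Set c.V} {ρ : (ind c U).V → P.V} (hP : P.Prime)
    (he : ∃ a b, P.adj a b) (hq : IsQ (ind c U) P.adj ρ) (hs : Function.Surjective ρ) (hU : Closed c U)
    (hp : Pr (C.par p)) (hsp : SplitAt (C.par p)) (hsm : Small (sz C + sz c)) :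
    Goal (C.par (ind c Uᶜ)) (ind c U) P ρ := by
  cases h with
  | ai a =>
    exfalso
    obtain ⟨a, b, hab⟩ := he
    obtain ⟨x, rfl⟩ := hs a
    obtain ⟨y, rfl⟩ := hs b
    have := (hq x y (edge_ne hab)).2 hab
    obtain ⟨x | x, hx⟩ := x <;> obtain ⟨y | y, hy⟩ := y <;> exact this.elim
  | ss A B S hA hS => exact caseSS hP he hq hs S (Set.nonempty_iff_ne_empty.2 hS) hA hU hp hsp hsm
  | p n P' e M N h1 h2 h3 => exact caseP e M N h1 h2 h3 hP he hq hs hU hp hsp hsm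

theorem case2 {G E p c P : LGraph} (h : GSRule p c) (S : Set E.V) {τ : E.V → P.V} {v : P.V} (hP : P.Prime)
    (he : ∃ a b, P.adj a b) (hq : IsQ (E.plug S c) P.adj (plugK S τ v c))
    (hs : Function.Surjective (plugK S τ v c)) (hp : Pr (G.par (E.plug S p)))
    (hsp : SplitAt (G.par (E.plug S p))) : Goal G (E.plug S c) P (plugK S τ v c) := by
  obtain ⟨c0⟩ := rule_nonempty h
  have hqE : IsQ E P.adj τ := fun x y hxy => hq (Sum.inl x) (Sum.inl y) hxy
  have hS : ∀ x, τ x ≠ v → (x ∈ S ↔ P.adj (τ x) v) := fun x hx => hq (Sum.inl x) (Sum.inr c0) hx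
  have tf : ∀ w, Dv (fib (E.plug S p) (plugK S τ v p) w) (fib (E.plug S c) (plugK S τ v c) w) := by
    intro w
    by_cases hw : w = v
    · subst hw
      exact dv_trans (dv_iso (plugK_fib_self S τ w p)) (dv_trans (dv_plug _ _ (dv_rule h))
        (dv_iso (iso_symm (plugK_fib_self S τ w c))))
    · exact dv_trans (dv_iso (plugK_fib S τ v p w hw)) (dv_iso (iso_symm (plugK_fib S τ v c w hw)))
  have tr : ∀ w, Dv (ind (E.plug S p) {x | plugK S τ v p x ≠ w}) (ind (E.plug S c) {x | plugK S τ v c x ≠ w}) := by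
    intro w
    by_cases hw : w = v
    · subst hw
      exact dv_trans (dv_iso (plugK_rest_self S τ w p)) (dv_iso (iso_symm (plugK_rest_self S τ w c)))
    · exact dv_trans (dv_iso (plugK_rest S τ v p w hw)) (dv_trans (dv_plug _ _ (dv_rule h))
        (dv_iso (iso_symm (plugK_rest S τ v c w hw))))
  by_cases hsu : Function.Surjective (plugK S τ v p)
  · rcases hsp G _ P _ (iso_refl _) hP he (plugK_isq hqE hS p) hsu with
      ⟨Y, κ, h1, h2, h3⟩ | ⟨KX, KY, w, h1, h2, h3⟩
    · exact Or.inl ⟨Y, κ, h1, h2, fun w => pr_dv (h3 w) (dv_par_right _ (tf w))⟩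
    · exact Or.inr ⟨KX, KY, w, h1, pr_dv h2 (dv_par_right _ (tf w)), pr_dv h3 (dv_par_right _ (tr w))⟩
  · have hno : ∀ x, plugK S τ v p x ≠ v := by
      intro x hx
      refine hsu fun w => ?_
      by_cases hw : w = v
      · exact ⟨x, hx.trans hw.symm⟩
      · obtain ⟨y | y, hy⟩ := hs w
        · exact ⟨Sum.inl y, hy⟩
        · exact absurd hy.symm hw
    refine Or.inr ⟨LGraph.empty, G, v, red_mk ?_, ?_, ?_⟩
    · rw [mk_par, mk_empty, zero_add]
    · have : Pr (fib (E.plug S p) (plugK S τ v p) v) := pr_zero (fib_empty _ _ hno)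
      refine pr_mk (pr_dv this (tf v)) ?_
      rw [mk_par, mk_empty, zero_add]
    · refine pr_dv hp (dv_par_right _ (dv_trans (dv_mk ?_) (tr v)))
      exact (mk_all _ hno).symm

theorem case2' {G E p c P : LGraph} (h : GSRule p c) (S : Set E.V) (hE : Nonempty E.V)
    {ρ : (E.plug S c).V → P.V} (hP : P.Prime)
    (he : ∃ a b, P.adj a b) (hq : IsQ (E.plug S c) P.adj ρ)
    (hs : Function.Surjective ρ) (hp : Pr (G.par (E.plug S p)))
    (hsp : SplitAt (G.par (E.plug S p))) : Goal G (E.plug S c) P ρ := by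
  obtain ⟨c0⟩ := rule_nonempty h
  obtain ⟨e0⟩ := hE
  have hconst : ∃ v, ∀ x : c.V, ρ (Sum.inr x) = v := by
    rcases isq_module hP he hq hs {x | ∃ y, x = Sum.inr y} ⟨Sum.inr c0, c0, rfl⟩ (by
      rintro (z | z) hz x ⟨x, rfl⟩ y ⟨y, rfl⟩
      · exact Iff.rfl
      · exact absurd ⟨z, rfl⟩ hz) with ⟨v, hv⟩ | hall | ⟨hc, -⟩
    · exact ⟨v, fun x => hv _ ⟨x, rfl⟩⟩
    · obtain ⟨y, hy⟩ := hall (Sum.inl e0)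
      cases hy
    · refine ⟨ρ (Sum.inr c0), rule_coconn h {x | ρ (Sum.inr x) = ρ (Sum.inr c0)} ⟨c0, rfl⟩ ?_⟩
      intro x hx y hxy
      by_contra hne
      have hne' : ρ (Sum.inr x) ≠ ρ (Sum.inr y) := fun h => hne (h.symm.trans hx)
      refine hxy ((hq (Sum.inr x) (Sum.inr y) hne').2 ?_)
      obtain ⟨a, b, hab⟩ := he
      rcases two_cases hc (edge_ne hab) (ρ (Sum.inr x)) with h1 | h1 <;>
        rcases two_cases hc (edge_ne hab) (ρ (Sum.inr y)) with h2 | h2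
      · exact absurd (h1.trans h2.symm) hne'
      · rw [h1, h2]; exact hab
      · rw [h1, h2]; exact P.symm hab
      · exact absurd (h1.trans h2.symm) hne'
  obtain ⟨v, hv⟩ := hconst
  have hρ : ρ = plugK S (fun x => ρ (Sum.inl x)) v c := by
    funext x
    rcases x with x | x
    · rfl
    · exact hv x
  rw [hρ] at hq hs ⊢
  exact case2 h S hP he hq hs hp hsp

/-- The two sides of a decomposition of a context with a hole filled. -/
theorem split_step {m : ℕ} (hsm : Small m) {H H' : LGraph} (hp : Pr H') (hsp : SplitAt H')
    (hst : Step GSRule H' H) (hz : sz H ≤ m) : SplitAt H := by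
  obtain ⟨C, R, p, c, hr, hi1, hi2⟩ := hst
  have hp := pr_dv hp (dv_iso hi1)
  have hsp := splitAt_iso hsp hi1
  have hz' : sz C + sz c ≤ m := by
    have := sz_iso hi2
    rw [sz_plug] at this
    omega
  obtain ⟨c0⟩ := rule_nonempty hr
  intro G W P ρ hiso hP he hq hs
  obtain ⟨φ⟩ := iso_trans hiso hi2
  let g : Emb G (C.plug R c) := (Emb.parL G W).trans (Emb.ofIso φ)
  let w : Emb W (C.plug R c) := (Emb.parR G W).trans (Emb.ofIso φ)
  have hcov : ∀ y, (∃ x, g.f x = y) ∨ (∃ x, w.f x = y) := by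
    intro y
    obtain ⟨x | x, hx⟩ := φ.toEquiv.surjective y
    · exact Or.inl ⟨x, hx⟩
    · exact Or.inr ⟨x, hx⟩
  have hdis : ∀ x y, g.f x ≠ w.f y := by
    intro x y h
    have := φ.toEquiv.injective h
    cases this
  have hnad : ∀ x y, ¬ (C.plug R c).adj (g.f x) (w.f y) := by
    intro x y h
    exact ((φ.adj_iff (Sum.inl x) (Sum.inr y)).2 h).elim
  -- the image of W is closed
  have hcl : ∀ x y, (C.plug R c).adj (w.f x) y → ∃ x', w.f x' = y := by
    intro x y h
    rcases hcov y with ⟨a, rfl⟩ | h'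
    · exact absurd ((C.plug R c).symm h) (hnad a x)
    · exact h'
  have hG : G.iso (ind (C.plug R c) {y | ∃ x, w.f x = y}ᶜ) := by
    refine iso_ind_of_emb g _ fun y => ⟨fun h => (hcov y).resolve_right h, ?_⟩
    rintro ⟨x, rfl⟩ ⟨x', hx'⟩
    exact hdis _ _ hx'.symm
  have hW : W.iso (ind (C.plug R c) {y | ∃ x, w.f x = y}) := iso_ind_of_emb w _ fun y => Iff.rfl
  have hUcl : Closed C {d | ∃ x, w.f x = Sum.inl d} := by
    rintro d ⟨x, hx⟩ d' hd
    exact hcl x (Sum.inl d') (by rw [hx]; exact hd)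
  by_cases hc1 : ∀ y : c.V, ¬ ∃ x, w.f x = Sum.inr y
  · -- W avoids the redex
    have hRU : ∀ d ∈ R, d ∈ {d | ∃ x, w.f x = Sum.inl d}ᶜ := by
      rintro d hd ⟨x, hx⟩
      exact hc1 c0 (hcl x (Sum.inr c0) (by rw [hx]; exact hd))
    have hW1 := iso_trans hW (plugInd0 R _ {d | ∃ x, w.f x = Sum.inl d} (fun d => Iff.rfl) hc1)
    have hG1 := iso_trans hG (plugInd1 R _ {d | ∃ x, w.f x = Sum.inl d}ᶜ (fun d => Iff.rfl) hc1)
    refine goal_reduce (iso_symm hW1) (G1 := (ind C {d | ∃ x, w.f x = Sum.inl d}ᶜ).plug {x | x.1 ∈ R} p) ?_ hq hs ?_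
    · exact red_dv (dv_trans (dv_plug _ _ (dv_rule hr)) (dv_iso (iso_symm hG1)))
    · intro ρ1 hq1 hs1
      refine hsp _ _ P ρ1 ?_ hP he hq1 hs1
      refine iso_symm (iso_trans (plug_closed R _ hRU (closed_compl hUcl) p) (mk_eq.1 ?_))
      rw [mk_par, mk_par, compl_compl, add_comm]
  push Not at hc1
  obtain ⟨c1, x1, hx1⟩ := hc1
  have key3 : (∀ d, d ∉ R) → (∀ d x, w.f x ≠ Sum.inl d) → Goal G W P ρ := by
    intro hR hWc
    have e1 : (ind c {y | ∃ x, w.f x = Sum.inr y}).iso W := by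
      refine iso_trans (iso_ind_of_emb ((Emb.ind c _).trans (Emb.plugR C R c)) _ ?_) (iso_symm hW)
      rintro (y | y)
      · refine iff_of_false (fun ⟨x, hx⟩ => hWc _ _ hx) ?_
        rintro ⟨x, hx⟩
        cases hx
      · constructor
        · intro h
          exact ⟨⟨y, h⟩, rfl⟩
        · rintro ⟨⟨x, hx'⟩, hx⟩
          cases hx
          exact hx'
    have e2 : G.iso (C.par (ind c {y | ∃ x, w.f x = Sum.inr y}ᶜ)) := by
      refine iso_trans hG (iso_par_of_emb ((Emb.plugL C R c).toInd _ ?_)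
        (((Emb.ind c _).trans (Emb.plugR C R c)).toInd _ ?_) ?_ ?_ ?_)
      · rintro x ⟨y, hy⟩
        exact hWc _ _ hy
      · intro x
        exact x.2
      · intro i j h
        have := congrArg Subtype.val h
        cases this
      · intro i j h
        exact hR i h
      · rintro ⟨y | y, hy⟩
        · exact Or.inl ⟨y, rfl⟩
        · exact Or.inr ⟨⟨y, hy⟩, rfl⟩
    refine goal_reduce e1 (red_dv (dv_iso (iso_symm e2))) hq hs ?_
    intro ρ1 hq1 hs1
    have e3 := iso_symm (par_iso_plug C p R hR)
    refine case3 hr hP he hq1 hs1 ?_ (pr_dv hp (dv_iso e3)) (splitAt_iso hsp e3) (small_mono hsm hz')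
    rintro y ⟨x, hx⟩ y' hy
    exact hcl x (Sum.inr y') (by rw [hx]; exact hy)
  by_cases hc2 : ∃ y : c.V, ¬ ∃ x, w.f x = Sum.inr y
  · obtain ⟨c2, hc2⟩ := hc2
    have hR : ∀ d, d ∉ R := by
      intro d hd
      obtain ⟨x, hx⟩ := hcl x1 (Sum.inl d) (by rw [hx1]; exact hd)
      exact hc2 (hcl x (Sum.inr c2) (by rw [hx]; exact hd))
    refine key3 hR fun d x hx => ?_
    have := isq_connected hP he hq hs {x | ∃ y, w.f x = Sum.inr y} ⟨x1, c1, hx1⟩ (by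
      rintro x ⟨y, hy⟩ x' hxx
      have hxx := (w.adj _ _).1 hxx
      rcases hx' : w.f x' with d' | y'
      · rw [hy, hx'] at hxx
        exact absurd hxx (hR d')
      · exact ⟨y', hx'⟩) x
    obtain ⟨y, hy⟩ := this
    rw [hx] at hy
    cases hy
  · push Not at hc2
    have hRT : ∀ d ∈ R, d ∈ {d | ∃ x, w.f x = Sum.inl d} := by
      intro d hd
      exact hcl x1 (Sum.inl d) (by rw [hx1]; exact hd)
    by_cases hT : ∃ d x, w.f x = Sum.inl d
    swap
    · push Not at hT
      refine key3 (fun d hd => ?_) hT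
      obtain ⟨x, hx⟩ := hRT d hd
      exact hT d x hx
    obtain ⟨d0, hd0⟩ := hT
    have hW1 := iso_trans hW (plugInd1 R _ {d | ∃ x, w.f x = Sum.inl d} (fun d => Iff.rfl) hc2)
    have hG1 := iso_trans hG (plugInd0 R _ {d | ∃ x, w.f x = Sum.inl d}ᶜ (fun d => Iff.rfl) (fun y h => h (hc2 y)))
    have e3 := plug_closed R _ hRT hUcl p
    refine goal_reduce (iso_symm hW1) (red_dv (dv_iso (iso_symm hG1))) hq hs ?_
    intro ρ1 hq1 hs1
    exact case2' hr _ (show Nonempty (ind C {d | ∃ x, w.f x = Sum.inl d}).V from ⟨⟨d0, hd0⟩⟩) hP he hq1 hs1 (pr_dv hp (dv_iso e3)) (splitAt_iso hsp e3)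

theorem splitAt_empty : SplitAt LGraph.empty := by
  intro G W P ρ ⟨e⟩ _ ⟨a, _⟩ _ hs
  obtain ⟨x, _⟩ := hs a
  exact (e.toEquiv (Sum.inr x)).elim

theorem small_all : ∀ m, Small m := by
  intro m
  induction m with
  | zero => intro H _ h; omega
  | succ m ih =>
    intro H hp
    induction hp with
    | refl => exact fun _ => splitAt_empty
    | tail h1 h2 ih2 =>
      rename_i b d
      intro hz
      have hz' : sz b ≤ sz d := sz_dv (Relation.ReflTransGen.single h2)
      rcases h2 with h2 | h2
      · exact splitAt_iso (ih2 (by omega)) h2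
      · exact split_step ih h1 (ih2 (by omega)) h2 (by omega)

theorem split_main {G P W : LGraph} {ρ : W.V → P.V} (h : Pr (G.par W)) (hP : P.Prime) (he : ∃ a b, P.adj a b)
    (hq : IsQ W P.adj ρ) (hs : Function.Surjective ρ) : Goal G W P ρ :=
  small_all _ _ h (Nat.lt_succ_self _) G W P ρ (iso_refl _) hP he hq hs

/-- **Splitting for prime graphs.** Let `G` be a graph, `P` a prime
graph with `n` vertices that is not the two-vertex edgeless graph `⅋`, and
`M₁, …, Mₙ` non-empty graphs. If `G ⅋ P⟨M₁, …, Mₙ⟩` is provable in GS, then either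
(A) there are a context `C[·]_R` and graphs `K₁, …, Kₙ` with a GS derivation from
`C[P̄⟨K₁, …, Kₙ⟩]_R` to `G`, `Kᵢ ⅋ Mᵢ` provable in GS for all `i`, and `C` provable
in GS; or (B) there are a context `C[·]_R`, graphs `K_X`, `K_Y` and an index `i`
with a GS derivation from `C[K_X ⅋ K_Y]_R` to `G`, `K_X ⅋ Mᵢ` provable in GS,
`K_Y ⅋ P⟨M₁, …, M_{i-1}, ∅, M_{i+1}, …, Mₙ⟩` provable in GS, and `C` provable in GS. -/
theorem splitting_prime (G : LGraph) (n : ℕ) (P : LGraph) (e : P.V ≃ Fin n)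
    (hP : P.Prime) (hnotpar : ¬ (Fintype.card P.V = 2 ∧ ∀ v w, ¬ P.adj v w))
    (M : Fin n → LGraph) (hM : ∀ i, Nonempty (M i).V)
    (h : Provable GSRule (G.par (P.comp fun v => M (e v)))) :
    (∃ (C : LGraph) (R : Set C.V) (K : Fin n → LGraph),
      Deriv GSRule (C.plug R (P.dual.comp fun v => K (e v))) G ∧
      (∀ i, Provable GSRule ((K i).par (M i))) ∧
      Provable GSRule C) ∨
    (∃ (C : LGraph) (R : Set C.V) (KX KY : LGraph) (i : Fin n),
      Deriv GSRule (C.plug R (KX.par KY)) G ∧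
      Provable GSRule (KX.par (M i)) ∧
      Provable GSRule (KY.par (P.comp fun v => Function.update M i LGraph.empty (e v))) ∧
      Provable GSRule C) := by
  have he : ∃ a b, P.adj a b := by
    by_contra hcon
    refine hnotpar ⟨prime_edgeless hP hcon, fun v w hvw => hcon ⟨v, w, hvw⟩⟩
  have hq := comp_isq P (fun v => M (e v))
  have hf := comp_fib P (fun v => M (e v))
  have hs : Function.Surjective (Sigma.fst : (P.comp fun v => M (e v)).V → P.V) := by
    intro v
    obtain ⟨x⟩ := hM (e v)
    exact ⟨⟨v, x⟩, rfl⟩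
  rcases split_main h hP he hq hs with ⟨Y, κ, h1, ⟨C, R, hC, hd⟩, h3⟩ | ⟨KX, KY, v, ⟨C, R, hC, hd⟩, h2, h3⟩
  · refine Or.inl ⟨C, R, fun i => fib Y κ (e.symm i), dv_trans (dv_plug C R (dv_iso ?_)) hd, fun i => ?_, hC⟩
    · have h1' : IsQ Y P.dual.adj (κ : Y.V → P.dual.V) :=
        isq_congr (I := P.V) (r' := P.dual.adj) h1 fun a b hab => ⟨fun h => ⟨hab, h⟩, fun h => h.2⟩
      refine comp_iso h1' _ fun v => ?_
      exact fib_congr κ (e.symm_apply_apply v)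
    · refine pr_mk (h3 (e.symm i)) ?_
      rw [mk_par, mk_par, hf, e.apply_symm_apply]
  · refine Or.inr ⟨C, R, KX, KY, e v, hd, pr_mk h2 ?_, pr_dv h3 (dv_par_right _ (dv_iso (iso_symm ?_))), hC⟩
    · rw [mk_par, mk_par, hf]
    · refine comp_iso (isq_ind hq _) _ fun w => mk_eq.1 ?_
      by_cases hw : w = v
      · subst hw
        have h0 := mk_zero (fib_ind_empty (Y := P.comp fun v => M (e v)) (Sigma.fst : (P.comp fun v => M (e v)).V → P.V)
          {x | x.1 ≠ w} w (fun y hy => hy))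
        rw [Function.update_self, mk_empty]
        exact h0.symm
      · have h0 := mk_eq.2 (fib_ind_iso (Y := P.comp fun v => M (e v)) (Sigma.fst : (P.comp fun v => M (e v)).V → P.V)
          {x | x.1 ≠ v} w (fun y hy h => hw (hy.symm.trans h)))
        rw [Function.update_of_ne (fun h => hw (e.injective h))]
        exact (h0.trans (hf w)).symm

end GSP
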